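/- arXiv:1003.0238 — 2 statements merged into one kernel-verified Lean document; each statement's English description precedes it below -/
import Mathlib

section
/- Let (W̃, S̃) be an affine Weyl group (a Coxeter system), W_J ⊆ W̃ a standard parabolic subgroup for J ⊆ S̃ finite, acting on W̃ by conjugation. For a W_J-conjugacy orbit O ⊆ W̃ and v ∈ O, the following are equivalent: (1) v is minimal in O with respect to the restriction of the Bruhat order; (2) v has minimal length among elements of O. -/
namespace CoxeterSystem

variable {B W : Type*} [Group W] {M : CoxeterMatrix B} (cs : CoxeterSystem M W)

/-- The support of `w`: the set of simple reflections occurring in a (equivalently, every)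
reduced expression of `w`. -/
def supp (w : W) : Set B :=
  {i | ∀ ω : List B, cs.wordProd ω = w → ω.length = cs.length w → i ∈ ω}

/-- The standard parabolic subgroup `W_J` generated by the simple reflections in `J`. -/
def parab (J : Set B) : Subgroup W := Subgroup.closure (cs.simple '' J)

/-- `w` is of minimal length in the coset `w W_J`; i.e. `w ∈ W^J`. -/
def IsMinCoset (w : W) (J : Set B) : Prop :=
  ∀ u ∈ cs.parab J, cs.length w ≤ cs.length (w * u)

/-- `I(J, w)`: the maximal subset `K ⊆ J` such that conjugation by `w` permutes the simple
reflections `{s_i : i ∈ K}` (realized as the union of all such `K`). -/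
def IJ (J : Set B) (w : W) : Set B :=
  ⋃₀ {K : Set B | K ⊆ J ∧ ∀ i ∈ K, ∃ j ∈ K, w * cs.simple i = cs.simple j * w}

/-- The Bruhat order, defined by the subword property. -/
def bruhatLE (u v : W) : Prop :=
  ∃ ω : List B, cs.wordProd ω = v ∧ ω.length = cs.length v ∧
    ∃ ω' : List B, ω'.Sublist ω ∧ cs.wordProd ω' = u

end CoxeterSystem


namespace CoxMin

open CoxeterSystem

/-- Gram matrix entries of the geometric representation. -/
noncomputable def kf {B : Type*} (M : CoxeterMatrix B) (i j : B) : ℝ :=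
  -Real.cos (Real.pi / (M i j : ℝ))

/-- The linear form `b(α_i, ·)`. -/
noncomputable def bf {B : Type*} (M : CoxeterMatrix B) (i : B) : (B →₀ ℝ) →ₗ[ℝ] ℝ :=
  Finsupp.linearCombination ℝ (kf M i)

/-- The simple root. -/
noncomputable def al {B : Type*} (i : B) : B →₀ ℝ := Finsupp.single i 1

/-- The simple reflection of the geometric representation. -/
noncomputable def sg {B : Type*} (M : CoxeterMatrix B) (i : B) : Module.End ℝ (B →₀ ℝ) :=
  LinearMap.id - (2 : ℝ) • (bf M i).smulRight (al i)

section
variable {B : Type*} (M : CoxeterMatrix B)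

lemma kf_self (i : B) : kf M i i = 1 := by simp [kf]

lemma kf_symm (i j : B) : kf M i j = kf M j i := by simp [kf, M.symmetric i j]

lemma kf_abs (i j : B) : |kf M i j| ≤ 1 := by
  rw [kf, abs_neg]; exact Real.abs_cos_le_one _

lemma bf_al (i j : B) : bf M i (al j) = kf M i j := by simp [bf, al]

lemma sg_apply (i : B) (v : B →₀ ℝ) : sg M i v = v - (2 * bf M i v) • al i := by
  simp [sg, smul_smul]

lemma sg_al (i j : B) : sg M i (al j) = al j - (2 * kf M i j) • al i := by
  rw [sg_apply, bf_al]

lemma sg_self (i : B) : sg M i (al i) = - al i := by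
  rw [sg_al, kf_self]; module

lemma sg_sg (i : B) (v : B →₀ ℝ) : sg M i (sg M i v) = v := by
  rw [sg_apply M i (sg M i v), sg_apply]
  simp only [map_sub, map_smul, bf_al, kf_self, smul_eq_mul]
  module

lemma sg_sq (i : B) : sg M i * sg M i = 1 := by
  refine LinearMap.ext fun v => ?_
  simp [sg_sg]

lemma kf_nonpos {i j : B} (h : i ≠ j) : kf M i j ≤ 0 := by
  rw [kf]
  have h1 : M i j ≠ 1 := by
    intro h2; exact M.off_diagonal i j h h2
  rw [neg_nonpos]
  apply Real.cos_nonneg_of_neg_pi_div_two_le_of_le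
  · have : 0 ≤ Real.pi / (M i j : ℝ) := by positivity
    have := Real.pi_pos; linarith
  · rcases Nat.eq_zero_or_pos (M i j) with h0 | h0
    · rw [h0]; simp; positivity
    · have : (2 : ℝ) ≤ (M i j : ℝ) := by
        have : 2 ≤ M i j := by omega
        exact_mod_cast this
      apply div_le_div_of_nonneg_left Real.pi_pos.le (by norm_num) this

lemma rot_al (s t : B) (th : ℝ) (h : kf M s t = - Real.cos th) (n : ℕ) :
    Real.sin th • ((sg M s * sg M t) ^ n) (al s) =
      Real.sin ((2 * n + 1) * th) • al s + Real.sin (2 * n * th) • al t ∧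
    Real.sin th • ((sg M s * sg M t) ^ n) (al t) =
      (- Real.sin (2 * n * th)) • al s - Real.sin ((2 * n - 1) * th) • al t := by
  have h' : kf M t s = - Real.cos th := by rw [kf_symm, h]
  have step : ∀ a b : ℝ, (sg M s * sg M t) (a • al s + b • al t) =
      (a * (4 * Real.cos th ^ 2 - 1) - 2 * Real.cos th * b) • al s
        + (2 * Real.cos th * a - b) • al t := by
    intro a b
    simp only [Module.End.mul_apply, map_add, map_smul, sg_al, kf_self, h, h', map_sub]
    module
  have id1 : ∀ x : ℝ, Real.sin (x + 2 * th) = 2 * Real.cos th * Real.sin (x + th) - Real.sin x := by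
    intro x
    have e1 : x + 2 * th = (x + th) + th := by ring
    have e2 : Real.sin x = Real.sin ((x + th) - th) := by ring_nf
    rw [e1, e2, Real.sin_add, Real.sin_sub]; ring
  induction n with
  | zero =>
    constructor
    · simp
    · simp
  | succ n ih =>
    obtain ⟨ih1, ih2⟩ := ih
    have a1 := id1 (2 * n * th)
    have a2 := id1 (2 * n * th + th)
    have a3 := id1 (2 * n * th - th)
    have a0 := id1 (2 * n * th - 2 * th)
    have e0 : 2 * (n:ℝ) * th - th + th = 2 * n * th := by ring
    have e3 : 2 * (n:ℝ) * th - th + 2 * th = 2 * n * th + th := by ring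
    have e2 : 2 * (n:ℝ) * th + th + th = 2 * n * th + 2 * th := by ring
    rw [e0, e3] at a3
    rw [e2] at a2
    have f1 : (2 * ((n + 1 : ℕ) : ℝ) + 1) * th = 2 * n * th + th + 2 * th := by push_cast; ring
    have f2 : 2 * ((n + 1 : ℕ) : ℝ) * th = 2 * n * th + 2 * th := by push_cast; ring
    have f3 : (2 * ((n + 1 : ℕ) : ℝ) - 1) * th = 2 * n * th + th := by push_cast; ring
    have g1 : (2 * (n : ℝ) + 1) * th = 2 * n * th + th := by ring
    have g3 : (2 * (n : ℝ) - 1) * th = 2 * n * th - th := by ring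
    rw [g1] at ih1
    rw [g3] at ih2
    rw [f1, f2, f3]
    constructor
    · rw [pow_succ', Module.End.mul_apply, ← map_smul, ih1, step]
      congr 2
      · rw [a2, a1]; ring
      · rw [a1]
    · have : (- Real.sin (2 * n * th)) • al s - Real.sin (2 * n * th - th) • al t =
        (- Real.sin (2 * n * th)) • al s + (-Real.sin (2 * n * th - th)) • (al t : B →₀ ℝ) := by
        module
      rw [pow_succ', Module.End.mul_apply, ← map_smul, ih2, this, step]
      rw [sub_eq_add_neg _ (_ • _), ← neg_smul]
      congr 2
      · rw [a1, a3]; ring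
      · rw [a3]; ring

lemma sg_liftable : M.IsLiftable (sg M) := by
  intro s t
  by_cases hst : s = t
  · subst hst; simp [sg_sq]
  rcases Nat.eq_zero_or_pos (M s t) with h0 | h0
  · rw [h0, pow_zero]
  have h2 : 2 ≤ M s t := by
    have := M.off_diagonal s t hst
    omega
  have h2' : (2 : ℝ) ≤ (M s t : ℝ) := by exact_mod_cast h2
  set th : ℝ := Real.pi / (M s t : ℝ) with hth
  have hth0 : 0 < th := by have := Real.pi_pos; positivity
  have hth1 : th < Real.pi := by
    rw [hth, div_lt_iff₀ (by linarith)]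
    nlinarith [Real.pi_pos]
  have hsin : 0 < Real.sin th := Real.sin_pos_of_pos_of_lt_pi hth0 hth1
  have hk : kf M s t = - Real.cos th := rfl
  have hk' : kf M t s = - Real.cos th := by rw [kf_symm, hk]
  have hm : (M s t : ℝ) * th = Real.pi := by
    rw [hth]; field_simp
  obtain ⟨r1, r2⟩ := rot_al M s t th hk (M s t)
  have s1 : Real.sin ((2 * (M s t : ℝ) + 1) * th) = Real.sin th := by
    have : (2 * (M s t : ℝ) + 1) * th = th + 2 * Real.pi := by rw [← hm]; ring
    rw [this, Real.sin_add_two_pi]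
  have s2 : Real.sin (2 * (M s t : ℝ) * th) = 0 := by
    have : 2 * (M s t : ℝ) * th = 2 * Real.pi := by rw [← hm]; ring
    rw [this, Real.sin_two_pi]
  have s3 : Real.sin ((2 * (M s t : ℝ) - 1) * th) = - Real.sin th := by
    have : (2 * (M s t : ℝ) - 1) * th = -th + 2 * Real.pi := by rw [← hm]; ring
    rw [this, Real.sin_add_two_pi, Real.sin_neg]
  rw [s1, s2] at r1
  rw [s2, s3] at r2
  have q1 : ((sg M s * sg M t) ^ (M s t)) (al s) = al s := by
    apply smul_right_injective _ hsin.ne'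
    simp only
    rw [r1]; module
  have q2 : ((sg M s * sg M t) ^ (M s t)) (al t) = al t := by
    apply smul_right_injective _ hsin.ne'
    simp only
    rw [r2]; module
  ext1 z
  apply LinearMap.ext_ring
  change ((sg M s * sg M t) ^ (M s t)) (al z) = al z
  -- decompose
  have hs2 : Real.sin th ^ 2 = 1 - Real.cos th ^ 2 := by rw [Real.sin_sq]
  set X := kf M s z
  set Y := kf M t z
  set a := (X + Real.cos th * Y) / Real.sin th ^ 2 with ha
  set b := (Y + Real.cos th * X) / Real.sin th ^ 2 with hb
  set z' : B →₀ ℝ := al z - a • al s - b • al t with hz'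
  have o1 : bf M s z' = 0 := by
    simp only [hz', map_sub, map_smul, bf_al, kf_self, hk, smul_eq_mul]
    rw [ha, hb]; field_simp
    rw [hs2]; ring
  have o2 : bf M t z' = 0 := by
    simp only [hz', map_sub, map_smul, bf_al, kf_self, hk', smul_eq_mul]
    rw [ha, hb]; field_simp
    rw [hs2]; ring
  have q3 : ∀ n : ℕ, ((sg M s * sg M t) ^ n) z' = z' := by
    intro n
    induction n with
    | zero => simp
    | succ n ih =>
      rw [pow_succ', Module.End.mul_apply, ih, Module.End.mul_apply, sg_apply M t, o2]
      simp [sg_apply, o1]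
  have e : al z = z' + a • al s + b • al t := by rw [hz']; module
  rw [e, map_add, map_add, map_smul, map_smul, q1, q2, q3]

/-- Chebyshev-type recursion. -/
noncomputable def qf (c : ℝ) : ℕ → ℝ
  | 0 => 0
  | 1 => 1
  | (k + 2) => 2 * c * qf c (k + 1) - qf c k

lemma qf_sin (th : ℝ) (k : ℕ) : qf (Real.cos th) k * Real.sin th = Real.sin (k * th) := by
  induction k using Nat.twoStepInduction with
  | zero => simp [qf]
  | one => simp [qf]
  | more n ih1 ih2 =>
    rw [qf, sub_mul, mul_assoc, ih2, ih1]
    push_cast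
    have e1 : ((n : ℝ) + 2) * th = (n * th + th) + th := by ring
    have e2 : Real.sin (n * th) = Real.sin ((n * th + th) - th) := by ring_nf
    have e3 : ((n : ℝ) + 1) * th = (n * th + th) := by ring
    rw [e1, e2, e3, Real.sin_add (n * th + th), Real.sin_sub (n * th + th)]; ring

lemma qf_one (k : ℕ) : qf 1 k = k := by
  induction k using Nat.twoStepInduction with
  | zero => simp [qf]
  | one => simp [qf]
  | more n ih1 ih2 => rw [qf, ih1, ih2]; push_cast; ring

lemma qf_nonneg {s t : B} (hst : s ≠ t) (k : ℕ) (hk : M s t ≠ 0 → k ≤ M s t) :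
    0 ≤ qf (- kf M s t) k := by
  by_cases h0 : M s t = 0
  · simp [kf, h0, qf_one]
  · have hk := hk h0
    have h2 : 2 ≤ M s t := by
      have := M.off_diagonal s t hst
      omega
    have h2' : (2 : ℝ) ≤ (M s t : ℝ) := by exact_mod_cast h2
    set th : ℝ := Real.pi / (M s t : ℝ) with hth
    have hth0 : 0 < th := by have := Real.pi_pos; positivity
    have hth1 : th < Real.pi := by
      rw [hth, div_lt_iff₀ (by linarith)]
      nlinarith [Real.pi_pos]
    have hsin : 0 < Real.sin th := Real.sin_pos_of_pos_of_lt_pi hth0 hth1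
    have e : - kf M s t = Real.cos th := by simp [kf, hth]
    have hm : (M s t : ℝ) * th = Real.pi := by
      rw [hth]; field_simp
    have hk' : (k : ℝ) ≤ M s t := by exact_mod_cast hk
    have := qf_sin th k
    have h3 : 0 ≤ Real.sin (k * th) := by
      apply Real.sin_nonneg_of_nonneg_of_le_pi (by positivity)
      rw [← hm]; gcongr
    rw [e]
    by_contra hneg
    push Not at hneg
    nlinarith

end

section
variable {B W : Type*} [Group W] {M : CoxeterMatrix B} (cs : CoxeterSystem M W)

/-- The geometric representation. -/
noncomputable def rho : W →* Module.End ℝ (B →₀ ℝ) := cs.lift ⟨sg M, sg_liftable M⟩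

lemma rho_simple (i : B) : rho cs (cs.simple i) = sg M i := by
  simp [rho]

lemma rho_mul (u v : W) (x : B →₀ ℝ) : rho cs (u * v) x = rho cs u (rho cs v x) := by
  simp

lemma rho_inv_self (u : W) (x : B →₀ ℝ) : rho cs u⁻¹ (rho cs u x) = x := by
  rw [← rho_mul]; simp

lemma rho_self_inv (u : W) (x : B →₀ ℝ) : rho cs u (rho cs u⁻¹ x) = x := by
  rw [← rho_mul]; simp

lemma rho_inj (u : W) : Function.Injective (rho cs u) :=
  Function.LeftInverse.injective (rho_inv_self cs u)

lemma al_ne (i : B) : (al i : B →₀ ℝ) ≠ 0 := by simp [al]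

/-- Alternating words acting on a simple root. -/
lemma alt_act {s t : B} (k : ℕ) :
    rho cs (cs.wordProd (alternatingWord s t k)) (al s) =
      if Even k then qf (-kf M s t) (k + 1) • al s + qf (-kf M s t) k • al t
      else qf (-kf M s t) k • al s + qf (-kf M s t) (k + 1) • al t := by
  induction k with
  | zero => simp [alternatingWord, qf]
  | succ k ih =>
    rw [alternatingWord_succ', wordProd_cons, rho_mul, ih]
    have hk := kf_symm M s t
    by_cases h : Even k
    · have h' : ¬ Even (k + 1) := by simp [h, parity_simps]
      simp only [h, h', if_true, if_false, rho_simple, map_add, map_smul, sg_al, kf_self,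
        ← hk, qf]
      module
    · have h' : Even (k + 1) := by simp [h, parity_simps]
      simp only [h, h', if_true, if_false, rho_simple, map_add, map_smul, sg_al, kf_self, qf]
      module

/-- Nonnegative coordinates. -/
def Pos (v : B →₀ ℝ) : Prop := ∀ i, 0 ≤ v i

lemma Pos.add {u v : B →₀ ℝ} (hu : Pos u) (hv : Pos v) : Pos (u + v) := by
  intro i; have := hu i; have := hv i; simp; linarith

lemma Pos.smul {v : B →₀ ℝ} (hv : Pos v) {c : ℝ} (hc : 0 ≤ c) : Pos (c • v) := by
  intro i; have := hv i; simp; positivity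

lemma pos_al (i : B) : Pos (al i : B →₀ ℝ) := by
  classical
  intro j; rw [al, Finsupp.single_apply]; split_ifs <;> norm_num

lemma Pos.antisymm {v : B →₀ ℝ} (hv : Pos v) (hv' : Pos (-v)) : v = 0 := by
  ext i; have := hv i; have := hv' i; simp at *; linarith

theorem pos_of_lt (n : ℕ) : ∀ (w : W) (s : B), cs.length w = n →
    cs.length w < cs.length (w * cs.simple s) → Pos (rho cs w (al s)) := by
  induction n using Nat.strong_induction_on with
  | _ n IH =>
  intro w s hwn hws
  by_cases hw1 : w = 1
  · subst hw1; simpa using pos_al s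
  obtain ⟨t, ht⟩ := cs.exists_rightDescent_of_ne_one hw1
  have ht' : cs.length (w * cs.simple t) < cs.length w := ht
  have hst : s ≠ t := by
    rintro rfl; omega
  let a : ℕ → W := fun k => cs.wordProd (alternatingWord s t k)
  have asucc : ∀ k, a (k + 1) = cs.simple (if Even k then t else s) * a k := by
    intro k
    simp only [a]
    rw [alternatingWord_succ', wordProd_cons]
  let P : ℕ → Prop := fun k => cs.length (w * (a k)⁻¹) + k = cs.length w
  have hP1 : P 1 := by
    have : a 1 = cs.simple t := by simp [a, alternatingWord]
    simp only [P, this, inv_simple]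
    rcases cs.length_mul_simple w t with h | h <;> omega
  have hbd : ∀ k, P k → k ≤ cs.length w := by
    intro k hk; simp only [P] at hk; omega
  classical
  have hw0 : 1 ≤ cs.length w := hbd 1 hP1
  set k := Nat.findGreatest P (cs.length w) with hk
  have hPk : P k := Nat.findGreatest_spec hw0 hP1
  have hk1 : 1 ≤ k := Nat.le_findGreatest hw0 hP1
  have hPk1 : ¬ P (k + 1) := by
    intro h
    have := Nat.le_findGreatest (hbd _ h) h
    omega
  set v := w * (a k)⁻¹ with hv
  have hPk' : cs.length v + k = cs.length w := hPk
  have hnext : cs.length v < cs.length (v * cs.simple (if Even k then t else s)) := by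
    have e : w * (a (k+1))⁻¹ = v * cs.simple (if Even k then t else s) := by
      rw [asucc, hv]; simp [mul_assoc]
    have : ¬ (cs.length (w * (a (k+1))⁻¹) + (k + 1) = cs.length w) := hPk1
    rw [e] at this
    rcases cs.length_mul_simple v (if Even k then t else s) with h | h <;> omega
  have hprev : cs.length v < cs.length (v * cs.simple (if Even k then s else t)) := by
    clear_value v k
    obtain ⟨j, rfl⟩ : ∃ j, k = j + 1 := ⟨k - 1, by omega⟩
    have e : v * cs.simple (if Even (j+1) then s else t) = w * (a j)⁻¹ := by
      rw [hv, asucc]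
      by_cases h : Even j
      · have h' : ¬ Even (j + 1) := by simp [h, parity_simps]
        simp [h, h', mul_assoc]
      · have h' : Even (j + 1) := by simp [h, parity_simps]
        simp [h, h', mul_assoc]
    rcases cs.length_mul_simple v (if Even (j+1) then s else t) with h | h
    · omega
    · exfalso
      rw [e] at h
      have h1 : cs.length w ≤ cs.length (w * (a j)⁻¹) + cs.length (a j) := by
        have := cs.length_mul_le (w * (a j)⁻¹) (a j)
        simpa using this
      have h2 : cs.length (a j) ≤ j := by
        have := cs.length_wordProd_le (alternatingWord s t j)
        simpa using this
      omega
  have hvs : cs.length v < cs.length (v * cs.simple s) := by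
    by_cases h : Even k
    · simpa [h] using hprev
    · simpa [h] using hnext
  have hvt : cs.length v < cs.length (v * cs.simple t) := by
    by_cases h : Even k
    · simpa [h] using hnext
    · simpa [h] using hprev
  have p1 := IH (cs.length v) (by omega) v s rfl hvs
  have p2 := IH (cs.length v) (by omega) v t rfl hvt
  have hkm : M s t ≠ 0 → k + 1 ≤ M s t := by
    intro h0
    by_contra hlt
    push Not at hlt
    have hr := cs.not_isReduced_alternatingWord t s (m := k + 1)
      (by rwa [M.symmetric]) (by rw [M.symmetric]; exact hlt)
    have h1 : cs.length (cs.wordProd (alternatingWord t s (k+1))) ≤ k := by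
      have := cs.length_wordProd_le (alternatingWord t s (k+1))
      rw [length_alternatingWord] at this
      rcases Nat.lt_or_ge k (cs.length (cs.wordProd (alternatingWord t s (k+1)))) with h | h
      · exact absurd (by rw [CoxeterSystem.IsReduced, length_alternatingWord]; omega) hr
      · exact h
    rw [alternatingWord_succ, wordProd_concat] at h1
    have e : w * cs.simple s = v * (a k * cs.simple s) := by rw [hv]; group
    have := cs.length_mul_le v (a k * cs.simple s)
    rw [← e] at this
    have h1' : cs.length (a k * cs.simple s) ≤ k := h1
    omega
  have hw : w = v * a k := by rw [hv]; group
  rw [hw, rho_mul]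
  have := alt_act cs (s := s) (t := t) k
  change rho cs (a k) (al s) = _ at this
  rw [this]
  have q1 := qf_nonneg M hst (k + 1) hkm
  have q0 := qf_nonneg M hst k (fun h => (Nat.le_succ k).trans (hkm h))
  split_ifs
  · rw [map_add, map_smul, map_smul]; exact (p1.smul q1).add (p2.smul q0)
  · rw [map_add, map_smul, map_smul]; exact (p1.smul q0).add (p2.smul q1)

end

end CoxMin


namespace CoxMin

open CoxeterSystem

section
variable {B W : Type*} [Group W] {M : CoxeterMatrix B} (cs : CoxeterSystem M W)

lemma rho_mul_simple_self (w : W) (i : B) :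
    rho cs (w * cs.simple i) (al i) = - rho cs w (al i) := by
  rw [rho_mul, rho_simple, sg_self, map_neg]

lemma neg_of_lt {w : W} {i : B} (h : cs.length (w * cs.simple i) < cs.length w) :
    Pos (-(rho cs w (al i))) := by
  rw [← rho_mul_simple_self]
  apply pos_of_lt cs _ _ _ rfl
  simpa using h

lemma rho_al_ne (w : W) (i : B) : rho cs w (al i) ≠ 0 := by
  intro h
  apply al_ne i
  apply rho_inj cs w
  rw [h, map_zero]

lemma pos_iff {w : W} {i : B} :
    Pos (rho cs w (al i)) ↔ cs.length (w * cs.simple i) = cs.length w + 1 := by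
  constructor
  · intro h
    rcases cs.length_mul_simple w i with h1 | h1
    · exact h1
    · exact absurd (h.antisymm (neg_of_lt cs (by omega))) (rho_al_ne cs w i)
  · intro h
    exact pos_of_lt cs _ _ _ rfl (by omega)

lemma neg_iff {w : W} {i : B} :
    Pos (-(rho cs w (al i))) ↔ cs.length (w * cs.simple i) + 1 = cs.length w := by
  constructor
  · intro h
    rcases cs.length_mul_simple w i with h1 | h1
    · exact absurd (((pos_iff cs).2 h1).antisymm h) (rho_al_ne cs w i)
    · exact h1
  · intro h
    exact neg_of_lt cs (by omega)

/-- Roots. -/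
def Rt : Set (B →₀ ℝ) := {β | ∃ (w : W) (i : B), β = rho cs w (al i)}

lemma rt_mk (w : W) (i : B) : rho cs w (al i) ∈ Rt cs := ⟨w, i, rfl⟩

lemma rt_al (i : B) : (al i : B →₀ ℝ) ∈ Rt cs := ⟨1, i, by simp⟩

lemma Rt.act {β : B →₀ ℝ} (h : β ∈ Rt cs) (w : W) : rho cs w β ∈ Rt cs := by
  obtain ⟨g, i, rfl⟩ := h
  exact ⟨w * g, i, by rw [rho_mul]⟩

lemma Rt.neg {β : B →₀ ℝ} (h : β ∈ Rt cs) : -β ∈ Rt cs := by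
  obtain ⟨g, i, rfl⟩ := h
  exact ⟨g * cs.simple i, i, by rw [rho_mul_simple_self]⟩

lemma Rt.ne {β : B →₀ ℝ} (h : β ∈ Rt cs) : β ≠ 0 := by
  obtain ⟨g, i, rfl⟩ := h
  exact rho_al_ne cs g i

lemma Rt.pos_or {β : B →₀ ℝ} (h : β ∈ Rt cs) : Pos β ∨ Pos (-β) := by
  obtain ⟨g, i, rfl⟩ := h
  rcases cs.length_mul_simple g i with h1 | h1
  · exact Or.inl ((pos_iff cs).2 h1)
  · exact Or.inr ((neg_iff cs).2 h1)

/-- The bilinear form. -/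
noncomputable def bb (M : CoxeterMatrix B) : (B →₀ ℝ) →ₗ[ℝ] (B →₀ ℝ) →ₗ[ℝ] ℝ :=
  Finsupp.linearCombination ℝ (bf M)


end

section
variable {B : Type*} (M : CoxeterMatrix B)

lemma bb_al (i : B) (v : B →₀ ℝ) : bb M (al i) v = bf M i v := by
  simp [bb, al]

lemma bb_al' (i : B) (v : B →₀ ℝ) : bb M v (al i) = bf M i v := by
  induction v using Finsupp.induction_linear with
  | zero => simp
  | add f g hf hg => simp [hf, hg]
  | single j r =>
    have : (Finsupp.single j r : B →₀ ℝ) = r • al j := by simp [al]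
    rw [this, map_smul, LinearMap.smul_apply, bb_al, bf_al, map_smul, bf_al, kf_symm]

lemma bb_sg (i : B) (u v : B →₀ ℝ) : bb M (sg M i u) (sg M i v) = bb M u v := by
  simp only [sg_apply, map_sub, map_smul, LinearMap.sub_apply, LinearMap.smul_apply, bb_al, bb_al',
    bf_al, kf_self, smul_eq_mul]
  ring

end

section
variable {B W : Type*} [Group W] {M : CoxeterMatrix B} (cs : CoxeterSystem M W)

lemma bb_rho (w : W) (u v : B →₀ ℝ) : bb M (rho cs w u) (rho cs w v) = bb M u v := by
  induction w using cs.simple_induction_left with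
  | one => simp
  | mul_simple_left w i ih => rw [rho_mul, rho_mul, rho_simple, bb_sg, ih]

lemma Rt.bb_self {β : B →₀ ℝ} (h : β ∈ Rt cs) : bb M β β = 1 := by
  obtain ⟨g, i, rfl⟩ := h
  rw [bb_rho, bb_al, bf_al, kf_self]

lemma sg_coord {i j : B} (h : j ≠ i) (v : B →₀ ℝ) : sg M i v j = v j := by
  rw [sg_apply]; simp [al, h.symm]

lemma eq_al {β : B →₀ ℝ} (h : β ∈ Rt cs) (hp : Pos β) {i : B} (hn : Pos (-(sg M i β))) :
    β = al i := by
  have h0 : ∀ j, j ≠ i → β j = 0 := by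
    intro j hj
    have := hp j
    have h2 := hn j
    rw [Finsupp.neg_apply, sg_coord hj] at h2
    linarith
  have e : β = β i • al i := by
    classical
    ext j
    by_cases hj : j = i
    · subst hj; simp [al]
    · simp [al, h0 j hj, hj]
  have h1 := Rt.bb_self cs h
  rw [e] at h1
  simp only [map_smul, LinearMap.smul_apply, bb_al, bf_al, kf_self, smul_eq_mul] at h1
  have := hp i
  have : β i = 1 := by nlinarith
  rw [e, this, one_smul]

lemma sg_pos {β : B →₀ ℝ} (h : β ∈ Rt cs) (hp : Pos β) {i : B} (hn : β ≠ al i) :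
    Pos (sg M i β) := by
  have := Rt.act cs h (cs.simple i)
  rw [rho_simple] at this
  rcases Rt.pos_or cs this with h1 | h1
  · exact h1
  · exact absurd (eq_al cs h hp h1) hn

lemma rho_faithful {w : W} (h : rho cs w = 1) : w = 1 := by
  by_contra hw
  obtain ⟨i, hi⟩ := cs.exists_rightDescent_of_ne_one hw
  have := neg_of_lt cs hi
  rw [h] at this
  exact al_ne i ((pos_al i).antisymm this)

lemma rho_refl (g : W) (i : B) (v : B →₀ ℝ) :
    rho cs (g * cs.simple i * g⁻¹) v =
      v - (2 * bb M (rho cs g (al i)) v) • rho cs g (al i) := by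
  rw [rho_mul, rho_mul, rho_simple, sg_apply, map_sub, map_smul, rho_self_inv, ← bb_al]
  rw [← bb_rho cs g (al i), rho_self_inv]

lemma refl_eq {g h : W} {i j : B} (e : rho cs g (al i) = rho cs h (al j)) :
    g * cs.simple i * g⁻¹ = h * cs.simple j * h⁻¹ := by
  rw [← mul_inv_eq_one]
  apply rho_faithful cs
  rw [map_mul]
  have : rho cs (g * cs.simple i * g⁻¹) = rho cs (h * cs.simple j * h⁻¹) := by
    refine LinearMap.ext fun v => ?_
    rw [rho_refl, rho_refl, e]
  rw [this, ← map_mul, mul_inv_cancel, map_one]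

lemma deletion (ω : List B) : ∀ (g : W) (i : B), Pos (rho cs g (al i)) →
    Pos (-(rho cs (cs.wordProd ω) (rho cs g (al i)))) →
    ∃ ω' : List B, ω'.Sublist ω ∧ ω'.length + 1 = ω.length ∧
      cs.wordProd ω' = cs.wordProd ω * (g * cs.simple i * g⁻¹) := by
  induction ω using List.reverseRecOn with
  | nil =>
    intro g i h1 h2
    exfalso
    rw [wordProd_nil, map_one] at h2
    exact rho_al_ne cs g i (h1.antisymm h2)
  | append_singleton ω s ih =>
    intro g i h1 h2
    by_cases e : rho cs g (al i) = al s
    · refine ⟨ω, by simp, by simp, ?_⟩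
      have : rho cs g (al i) = rho cs 1 (al s) := by simpa using e
      rw [refl_eq cs this]
      simp [wordProd_append]
    · have h3 := sg_pos cs (rt_mk cs g i) h1 e
      rw [← rho_simple cs, ← rho_mul] at h3
      obtain ⟨ω', a1, a2, a3⟩ := ih (cs.simple s * g) i h3 (by
        rw [wordProd_append, wordProd_singleton, rho_mul] at h2
        rwa [rho_mul])
      refine ⟨ω' ++ [s], ?_, by simp [a2], ?_⟩
      · exact List.Sublist.append a1 (List.Sublist.refl _)
      · rw [wordProd_append, a3, wordProd_append]
        simp [mul_assoc]

lemma refl_pos_root {t : W} (ht : cs.IsReflection t) :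
    ∃ g i, t = g * cs.simple i * g⁻¹ ∧ Pos (rho cs g (al i)) := by
  obtain ⟨g, i, rfl⟩ := ht
  rcases Rt.pos_or cs (rt_mk cs g i) with h | h
  · exact ⟨g, i, rfl, h⟩
  · refine ⟨g * cs.simple i, i, by simp [mul_assoc], ?_⟩
    rwa [rho_mul_simple_self]

lemma strong_exchange (ω : List B) {t : W} (ht : cs.IsReflection t)
    (hl : cs.length (cs.wordProd ω * t) < cs.length (cs.wordProd ω)) :
    ∃ ω' : List B, ω'.Sublist ω ∧ ω'.length + 1 = ω.length ∧
      cs.wordProd ω' = cs.wordProd ω * t := by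
  obtain ⟨g, i, rfl, hp⟩ := refl_pos_root cs ht
  set t := g * cs.simple i * g⁻¹ with htt
  have hr := Rt.act cs (rt_mk cs g i) (cs.wordProd ω)
  rcases Rt.pos_or cs hr with h | h
  · exfalso
    obtain ⟨ω₁, hω₁, e₁⟩ := cs.exists_isReduced (cs.wordProd ω * t)
    have tt : t * t = 1 := by rw [htt]; simp [mul_assoc]
    obtain ⟨ω', a1, a2, a3⟩ := deletion cs ω₁ g i hp (by
      rw [← e₁, rho_mul, htt, rho_mul, rho_mul, rho_simple, rho_inv_self, sg_self, map_neg,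
        map_neg, neg_neg]
      exact h)
    rw [← e₁, ← htt, mul_assoc, tt, mul_one] at a3
    have b1 := cs.length_wordProd_le ω'
    rw [a3] at b1
    have b2 : cs.length (cs.wordProd ω * t) = ω₁.length := by rw [e₁]; exact hω₁
    omega
  · exact deletion cs ω g i hp h

/-- One step of the Bruhat graph. -/
def RR (u v : W) : Prop := ∃ t, cs.IsReflection t ∧ v = u * t ∧ cs.length u < cs.length v

lemma lifting {x y : W} (s : B) (h : Relation.ReflTransGen (RR cs) x y) :
    Relation.ReflTransGen (RR cs) (x * cs.simple s) y ∨
    Relation.ReflTransGen (RR cs) (x * cs.simple s) (y * cs.simple s) := by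
  induction h with
  | refl => exact Or.inr .refl
  | @tail y y' hxy hyy' ih =>
    rcases ih with ih | ih
    · exact Or.inl (ih.tail hyy')
    · obtain ⟨t, ht, rfl, hl⟩ := hyy'
      have ht' : cs.IsReflection (cs.simple s * t * cs.simple s) := by
        have := ht.conj (cs.simple s)
        simpa using this
      have tt : t * t = 1 := ht.mul_self
      have e : y * t * cs.simple s = y * cs.simple s * (cs.simple s * t * cs.simple s) := by
        simp [mul_assoc]
      rcases Nat.lt_or_ge (cs.length (y * cs.simple s)) (cs.length (y * t * cs.simple s)) with h | h
      · exact Or.inr (ih.tail ⟨_, ht', e, h⟩)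
      · left
        have hne : cs.length (y * t * cs.simple s) ≠ cs.length (y * cs.simple s) := by
          rw [e]; exact ht'.length_mul_left_ne _
        have hl2 : cs.length (y * t * cs.simple s) < cs.length (y * cs.simple s) := by omega
        obtain ⟨ω, hω, rfl⟩ := cs.exists_isReduced y
        have := strong_exchange cs (ω ++ [s]) ht' (by
          rw [wordProd_append, wordProd_singleton, ← e]; exact hl2)
        obtain ⟨ω', a1, a2, a3⟩ := this
        rw [wordProd_append, wordProd_singleton, ← e] at a3
        -- the deleted letter is the last one
        rw [List.sublist_append_iff] at a1
        obtain ⟨l1, l2, rfl, b1, b2⟩ := a1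
        rcases List.sublist_singleton.1 b2 with rfl | rfl
        · have : l1 = ω := by
            apply b1.eq_of_length
            simp at a2; omega
          subst this
          rw [List.append_nil] at a3
          have : cs.wordProd l1 * cs.simple s = cs.wordProd l1 * t := by
            nth_rewrite 1 [a3]; simp
          rwa [this] at ih
        · exfalso
          rw [wordProd_append, wordProd_singleton] at a3
          have a3 := mul_right_cancel a3
          have c1 := cs.length_wordProd_le l1
          rw [a3] at c1
          have c2 : cs.length (cs.wordProd ω) = ω.length := hω
          simp at a2
          omega

lemma sub_iff (ω : List B) (u : W) (hω : cs.IsReduced ω) :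
    (∃ ω' : List B, ω'.Sublist ω ∧ cs.wordProd ω' = u) ↔
      Relation.ReflTransGen (RR cs) u (cs.wordProd ω) := by
  constructor
  · intro h
    induction ω using List.reverseRecOn generalizing u with
    | nil =>
      obtain ⟨ω', h1, rfl⟩ := h
      rw [List.sublist_nil.1 h1]
    | append_singleton ω s ih =>
      have hω0 : cs.IsReduced ω := by
        have := hω.take ω.length
        simpa using this
      have hstep : RR cs (cs.wordProd ω) (cs.wordProd (ω ++ [s])) := by
        refine ⟨cs.simple s, cs.isReflection_simple s, by simp [wordProd_append], ?_⟩
        have h1 : cs.length _ = _ := hω0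
        have h2 : cs.length _ = _ := hω
        rw [h1, h2]; simp
      obtain ⟨ω', h1, rfl⟩ := h
      rw [List.sublist_append_iff] at h1
      obtain ⟨l1, l2, rfl, b1, b2⟩ := h1
      have ih1 := ih (cs.wordProd l1) hω0 ⟨l1, b1, rfl⟩
      rcases List.sublist_singleton.1 b2 with rfl | rfl
      · rw [List.append_nil]; exact ih1.tail hstep
      · rw [wordProd_append, wordProd_singleton]
        rcases lifting cs s ih1 with h | h
        · exact h.tail hstep
        · rw [wordProd_append, wordProd_singleton]; exact h
  · intro h
    induction h using Relation.ReflTransGen.head_induction_on with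
    | refl => exact ⟨ω, List.Sublist.refl _, rfl⟩
    | @head a c hac hcb ih =>
      obtain ⟨ω', h1, h2⟩ := ih
      obtain ⟨t, ht, rfl, hl⟩ := hac
      have tt : t * t = 1 := ht.mul_self
      obtain ⟨ω'', a1, a2, a3⟩ := strong_exchange cs ω' ht (by
        rw [h2, mul_assoc, tt, mul_one]; exact hl)
      refine ⟨ω'', a1.trans h1, ?_⟩
      rw [a3, h2, mul_assoc, tt, mul_one]

theorem sub_indep {ω₁ ω₂ ω' : List B} (h1 : cs.IsReduced ω₁) (h2 : cs.IsReduced ω₂)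
    (e : cs.wordProd ω₁ = cs.wordProd ω₂) (hs : ω'.Sublist ω₁) :
    ∃ ω'' : List B, ω''.Sublist ω₂ ∧ cs.wordProd ω'' = cs.wordProd ω' := by
  rw [sub_iff cs ω₂ _ h2, ← e, ← sub_iff cs ω₁ _ h1]
  exact ⟨ω', hs, rfl⟩

/-- Inversions. -/
def Inv (w : W) : Set (B →₀ ℝ) := {β | β ∈ Rt cs ∧ Pos β ∧ Pos (-(rho cs w β))}

lemma inv_count (n : ℕ) : ∀ w : W, cs.length w = n → (Inv cs w).Finite ∧ (Inv cs w).ncard = n := by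
  induction n with
  | zero =>
    intro w hw
    rw [cs.length_eq_zero_iff] at hw
    subst hw
    have : Inv cs 1 = ∅ := by
      ext β
      simp only [Inv, map_one, Set.mem_ofPred_eq, Set.mem_empty_iff_false, iff_false]
      rintro ⟨h1, h2, h3⟩
      exact Rt.ne cs h1 (h2.antisymm h3)
    rw [this]; simp
  | succ n ih =>
    intro w hw
    have hw1 : w ≠ 1 := by rintro rfl; simp at hw
    obtain ⟨s, hs⟩ := cs.exists_rightDescent_of_ne_one hw1
    rw [cs.isRightDescent_iff] at hs
    obtain ⟨f, c⟩ := ih (w * cs.simple s) (by omega)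
    have key : Inv cs w = insert (al s) (sg M s '' Inv cs (w * cs.simple s)) := by
      ext β
      simp only [Inv, Set.mem_insert_iff, Set.mem_image, Set.mem_ofPred_eq, rho_mul, rho_simple]
      constructor
      · rintro ⟨h1, h2, h3⟩
        by_cases e : β = al s
        · exact Or.inl e
        · right
          refine ⟨sg M s β, ⟨?_, sg_pos cs h1 h2 e, ?_⟩, sg_sg M s β⟩
          · rw [← rho_simple cs]; exact Rt.act cs h1 _
          · rwa [sg_sg]
      · rintro (rfl | ⟨γ, ⟨h1, h2, h3⟩, rfl⟩)
        · exact ⟨rt_al cs _, pos_al _, (neg_iff cs).2 hs⟩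
        · refine ⟨?_, ?_, h3⟩
          · rw [← rho_simple cs]; exact Rt.act cs h1 _
          · apply sg_pos cs h1 h2
            rintro rfl
            rw [sg_self, map_neg, neg_neg] at h3
            exact rho_al_ne cs w s (h3.antisymm ((neg_iff cs).2 hs))
    have hinj : Function.Injective (sg M s) :=
      Function.LeftInverse.injective (g := sg M s) (sg_sg M s)
    rw [key]
    refine ⟨(f.image _).insert _, ?_⟩
    have f' := f.image (sg M s)
    rw [Set.ncard_insert_of_notMem (hs := f'), Set.ncard_image_of_injective _ hinj, c]
    · rintro ⟨γ, ⟨h1, h2, h3⟩, h4⟩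
      have : γ = - al s := by rw [← sg_sg M s γ, h4, sg_self]
      subst this
      exact al_ne s ((pos_al s).antisymm h2)

end

section
variable {B W B' W' : Type*} [Group W] [Group W'] {M : CoxeterMatrix B} {M' : CoxeterMatrix B'}
  (cs : CoxeterSystem M W) (cs' : CoxeterSystem M' W')

lemma embed_act (f : B → B') (hf : Function.Injective f) (hM : ∀ i j, M' (f i) (f j) = M i j)
    (Φ : W →* W') (hΦ : ∀ i, Φ (cs.simple i) = cs'.simple (f i)) (w : W) (v : B →₀ ℝ) :
    rho cs' (Φ w) (Finsupp.mapDomain f v) = Finsupp.mapDomain f (rho cs w v) := by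
  have hb : ∀ i v, bf M' (f i) (Finsupp.mapDomain f v) = bf M i v := by
    intro i v
    rw [bf, bf, Finsupp.linearCombination_mapDomain]
    congr 2
    ext j
    simp [kf, hM]
  have hs : ∀ i v, sg M' (f i) (Finsupp.mapDomain f v) = Finsupp.mapDomain f (sg M i v) := by
    intro i v
    rw [sg_apply, sg_apply, hb, sub_eq_add_neg, sub_eq_add_neg, Finsupp.mapDomain_add,
      ← neg_smul, ← neg_smul, Finsupp.mapDomain_smul, al, al, Finsupp.mapDomain_single]
  induction w using cs.simple_induction_left generalizing v with
  | one => simp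
  | mul_simple_left w i ih =>
    rw [map_mul, rho_mul, rho_mul, ih, hΦ, rho_simple, rho_simple, hs]

lemma embed_length (f : B → B') (hf : Function.Injective f) (hM : ∀ i j, M' (f i) (f j) = M i j)
    (Φ : W →* W') (hΦ : ∀ i, Φ (cs.simple i) = cs'.simple (f i)) (n : ℕ) :
    ∀ w : W, cs.length w = n → cs'.length (Φ w) = n := by
  induction n with
  | zero =>
    intro w hw
    rw [cs.length_eq_zero_iff] at hw
    subst hw; simp
  | succ n ih =>
    intro w hw
    have hw1 : w ≠ 1 := by rintro rfl; simp at hw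
    obtain ⟨s, hs⟩ := cs.exists_rightDescent_of_ne_one hw1
    rw [cs.isRightDescent_iff] at hs
    have h1 := ih (w * cs.simple s) (by omega)
    have h2 : Pos (rho cs (w * cs.simple s) (al s)) := by
      rw [pos_iff]; simp [hs]
    have h3 : Pos (rho cs' (Φ (w * cs.simple s)) (al (f s))) := by
      have e : (al (f s) : B' →₀ ℝ) = Finsupp.mapDomain f (al s) := by
        rw [al, al, Finsupp.mapDomain_single]
      rw [e, embed_act cs cs' f hf hM Φ hΦ]
      classical
      intro j
      by_cases hj : j ∈ Set.range f
      · obtain ⟨i, rfl⟩ := hj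
        rw [Finsupp.mapDomain_apply hf]; exact h2 i
      · rw [Finsupp.mapDomain_of_notMem_range _ _ hj]
    rw [pos_iff] at h3
    rw [map_mul, hΦ] at h1 h3
    simp only [simple_mul_simple_cancel_right] at h3
    rw [h3, h1]

end

end CoxMin


namespace CoxMin

open Filter Topology

/-! ### Negative binomial kernels -/

/-- negative binomial weights -/
noncomputable def nb (τ : ℝ) (k j : ℕ) : ℝ := (Nat.choose (k + j) k : ℝ) * τ ^ j

lemma nb_zero (τ : ℝ) (k : ℕ) : nb τ k 0 = 1 := by simp [nb]

lemma nb_zero_left (τ : ℝ) (j : ℕ) : nb τ 0 j = τ ^ j := by simp [nb]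

lemma nb_rec (τ : ℝ) (k j : ℕ) : nb τ (k + 1) (j + 1) = nb τ k (j + 1) + τ * nb τ (k + 1) j := by
  unfold nb
  have : (k + 1 + (j + 1)).choose (k + 1) = (k + (j + 1)).choose k + (k + 1 + j).choose (k + 1) := by
    have e1 : k + 1 + (j + 1) = (k + j + 1) + 1 := by ring
    have e2 : k + (j + 1) = k + j + 1 := by ring
    have e3 : k + 1 + j = k + j + 1 := by ring
    rw [e1, e2, e3, Nat.choose_succ_succ]
  rw [this]; push_cast; ring

lemma nb_nonneg {τ : ℝ} (h : 0 ≤ τ) (k j : ℕ) : 0 ≤ nb τ k j := by unfold nb; positivity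

lemma nb_ratio (τ : ℝ) (k j : ℕ) :
    nb τ k (j + 1) * (j + 1) = τ * (k + 1 + j) * nb τ k j := by
  unfold nb
  have h := Nat.choose_mul_succ_eq (k + j) k
  have e : k + j + 1 - k = j + 1 := by omega
  rw [e] at h
  have h' : ((k + j).choose k : ℝ) * (k + j + 1) = ((k + j + 1).choose k : ℝ) * (j + 1) := by
    exact_mod_cast h
  have e2 : k + (j + 1) = k + j + 1 := by ring
  rw [e2, pow_succ]
  linear_combination (-(τ ^ j * τ)) * h'

lemma nb_sum {τ : ℝ} (h0 : 0 < τ) (h1 : τ < 1) (k J : ℕ) :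
    (∑ j ∈ Finset.range J, nb τ k j) * (1 - τ) ^ (k + 1) ≤ 1 := by
  have h2 : 0 < 1 - τ := by linarith
  induction k with
  | zero =>
    simp only [nb_zero_left, zero_add, pow_one]
    have := geom_sum_mul_neg τ J
    rw [this]
    have := pow_pos h0 J
    linarith
  | succ k ih =>
    have key : (∑ j ∈ Finset.range J, nb τ (k+1) j) * (1 - τ) ≤ ∑ j ∈ Finset.range J, nb τ k j := by
      have h3 : ∀ J, (∑ j ∈ Finset.range (J+1), nb τ (k+1) j)
          = ∑ j ∈ Finset.range (J+1), nb τ k j + τ * ∑ j ∈ Finset.range J, nb τ (k+1) j := by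
        intro J
        rw [Finset.sum_range_succ', Finset.sum_range_succ' (fun j => nb τ k j), nb_zero, nb_zero,
          Finset.mul_sum]
        simp only [nb_rec, Finset.sum_add_distrib]
        ring
      cases J with
      | zero => simp
      | succ J =>
        have h4 := h3 J
        have h5 := Finset.sum_range_succ (fun j => nb τ (k+1) j) J
        have h6 := nb_nonneg h0.le (k+1) J
        have : τ * ∑ j ∈ Finset.range J, nb τ (k+1) j
          ≤ τ * ∑ j ∈ Finset.range (J+1), nb τ (k+1) j := by
          apply mul_le_mul_of_nonneg_left _ h0.le; linarith
        linarith
    calc (∑ j ∈ Finset.range J, nb τ (k+1) j) * (1 - τ) ^ (k + 1 + 1)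
        = ((∑ j ∈ Finset.range J, nb τ (k+1) j) * (1 - τ)) * (1 - τ) ^ (k + 1) := by ring
      _ ≤ (∑ j ∈ Finset.range J, nb τ k j) * (1 - τ) ^ (k + 1) := by gcongr
      _ ≤ 1 := ih

lemma nb_small {τ : ℝ} (h0 : 0 < τ) (h1 : τ < 1) (Q : ℕ) (hQ : 1 ≤ Q) :
    ∃ K : ℕ, ∀ k ≥ K, ∀ j, nb τ k j * (1 - τ) ^ (k + 1) * Q ≤ 2 := by
  have h2 : 0 < 1 - τ := by linarith
  obtain ⟨K, hK⟩ := exists_nat_gt ((4 * Q ^ 2 : ℝ) / τ)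
  refine ⟨K, fun k hk j => ?_⟩
  have hQ' : (1 : ℝ) ≤ Q := by exact_mod_cast hQ
  have hk' : (4 * Q ^ 2 : ℝ) < τ * k := by
    rw [div_lt_iff₀ h0] at hK
    have : (K : ℝ) ≤ k := by exact_mod_cast hk
    nlinarith
  set p : ℕ → ℝ := fun j => nb τ k j * (1 - τ) ^ (k + 1) with hp
  have hp0 : ∀ j, 0 ≤ p j := fun j => mul_nonneg (nb_nonneg h0.le k j) (by positivity)
  have hr : ∀ j : ℕ, p (j + 1) * (j + 1) = τ * (k + 1 + j) * p j := by
    intro j; simp only [hp]; linear_combination (1 - τ) ^ (k+1) * nb_ratio τ k j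
  have hsum : ∀ J, ∑ j ∈ Finset.range J, p j ≤ 1 := by
    intro J; simp only [hp]; rw [← Finset.sum_mul]; exact nb_sum h0 h1 k J
  change p j * Q ≤ 2
  set δ : ℝ := 1 / (2 * Q) with hδ
  have hδQ : δ * Q = 1 / 2 := by rw [hδ]; field_simp
  have hδ0 : 0 < δ := by positivity
  have hδ1 : δ ≤ 1 / 2 := by
    rw [hδ, div_le_div_iff₀ (by positivity) (by norm_num)]; linarith
  rcases le_or_gt ((1 - δ) * (j + Q + 1)) (τ * (k + 1 + j + Q)) with hA | hB
  · -- going right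
    have step : ∀ i : ℕ, i < Q → (1 - δ) * p (j + i) ≤ p (j + i + 1) := by
      intro i hi
      have hi' : (i : ℝ) ≤ Q := by exact_mod_cast hi.le
      have hji : (0:ℝ) < (j + i : ℕ) + 1 := by positivity
      have : (1 - δ) * ((j + i : ℕ) + 1) ≤ τ * (k + 1 + (j + i : ℕ)) := by
        push_cast
        rcases le_or_gt τ (1 - δ) with h | h
        · nlinarith
        · have : (0:ℝ) ≤ j + i + 1 := by positivity
          have : (0:ℝ) ≤ k := by positivity
          nlinarith
      have h3 := hr (j + i)
      have h4 := hp0 (j + i)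
      by_contra hneg
      push Not at hneg
      have : p (j+i+1) * ((j + i : ℕ) + 1) < (1 - δ) * p (j+i) * ((j+i : ℕ) + 1) :=
        mul_lt_mul_of_pos_right hneg hji
      nlinarith
    have ge : ∀ i : ℕ, i ≤ Q → (1 - i * δ) * p j ≤ p (j + i) := by
      intro i
      induction i with
      | zero => intro _; simp
      | succ i ih =>
        intro hi
        have h3 := ih (by omega)
        have h4 := step i (by omega)
        have h5 := hp0 j
        have hi' : (i : ℝ) ≤ Q := by exact_mod_cast (by omega : i ≤ Q)
        have e : j + (i + 1) = j + i + 1 := by ring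
        rw [e]; push_cast
        have : (1 - δ) * ((1 - i * δ) * p j) ≤ (1 - δ) * p (j + i) :=
          mul_le_mul_of_nonneg_left h3 (by linarith)
        have : 0 ≤ i * δ * δ * p j := by positivity
        nlinarith
    have hs := hsum (j + Q)
    have h6 : ∑ i ∈ Finset.range Q, p (j + i) ≤ 1 := by
      rw [Finset.sum_range_add] at hs
      have : 0 ≤ ∑ i ∈ Finset.range j, p i := Finset.sum_nonneg (fun i _ => hp0 i)
      linarith
    have h7 : ∑ i ∈ Finset.range Q, p j / 2 ≤ ∑ i ∈ Finset.range Q, p (j + i) := by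
      apply Finset.sum_le_sum
      intro i hi
      rw [Finset.mem_range] at hi
      have h3 := ge i hi.le
      have hi' : (i : ℝ) ≤ Q := by exact_mod_cast hi.le
      have : i * δ ≤ 1 / 2 := by rw [← hδQ, mul_comm δ]; gcongr
      have := hp0 j
      nlinarith
    simp at h7
    linarith
  · have hj : (4 * Q ^ 2 : ℝ) < j + Q + 1 := by
      have : (0:ℝ) ≤ j + Q := by positivity
      nlinarith
    have hjQ : Q ≤ j := by
      have : (Q : ℝ) < j + 1 := by nlinarith
      have : Q < j + 1 := by exact_mod_cast this
      omega
    have hδj : 2 * (Q:ℝ) ≤ δ * (j + Q + 1) := by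
      have : δ * (4 * Q ^ 2) = 2 * Q := by rw [hδ]; field_simp; norm_num
      nlinarith
    have ge : ∀ i : ℕ, i ≤ Q → p j ≤ p (j - i) := by
      intro i
      induction i with
      | zero => intro _; simp
      | succ i ih =>
        intro hi
        refine (ih (by omega)).trans ?_
        obtain ⟨m, hm⟩ : ∃ m, j = m + (i + 1) := ⟨j - (i + 1), by omega⟩
        have e1 : j - i = m + 1 := by omega
        have e2 : j - (i + 1) = m := by omega
        rw [e1, e2]
        have h3 := hr m
        have h4 := hp0 m
        have h5 := hp0 (m + 1)
        have hjr : (j : ℝ) = m + (i + 1) := by exact_mod_cast hm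
        have hi' : (i : ℝ) + 1 ≤ Q := by exact_mod_cast hi
        have : τ * (k + 1 + m) ≤ m + 1 := by
          have : (0:ℝ) ≤ i := by positivity
          rw [hjr] at hB hδj
          nlinarith
        have hm0 : (0:ℝ) < m + 1 := by positivity
        by_contra hneg
        push Not at hneg
        have := mul_lt_mul_of_pos_right hneg hm0
        nlinarith
    have hs := hsum (j + 1)
    have h6 : ∑ i ∈ Finset.range Q, p (j - i) ≤ 1 := by
      refine le_trans ?_ hs
      rw [← Finset.sum_range_reflect p (j + 1)]
      have : ∑ i ∈ Finset.range Q, p (j - i) = ∑ i ∈ Finset.range Q, p (j + 1 - 1 - i) := by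
        simp
      rw [this]
      apply Finset.sum_le_sum_of_subset_of_nonneg
      · intro i; simp only [Finset.mem_range]; omega
      · intro i _ _; exact hp0 _
    have h7 : ∑ i ∈ Finset.range Q, p j ≤ ∑ i ∈ Finset.range Q, p (j - i) := by
      apply Finset.sum_le_sum
      intro i hi
      rw [Finset.mem_range] at hi
      exact ge i hi.le
    simp at h7
    linarith

/-- iterated kernel on the integers -/
noncomputable def ker (τ : ℝ) : ℕ → ℤ → ℝ
  | 0, j => if j = 0 then 1 else 0
  | (k + 1), j => if 0 ≤ j then nb τ k j.toNat else 0

lemma ker_neg (τ : ℝ) (k : ℕ) {j : ℤ} (h : j < 0) : ker τ k j = 0 := by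
  cases k with
  | zero => simp [ker]; omega
  | succ k => simp [ker]; omega

lemma ker_rec (τ : ℝ) (k : ℕ) (j : ℤ) : ker τ (k + 1) j = ker τ k j + τ * ker τ (k + 1) (j - 1) := by
  rcases lt_trichotomy j 0 with h | h | h
  · rw [ker_neg τ _ h, ker_neg τ _ h, ker_neg τ _ (by omega)]; simp
  · subst h
    rw [ker_neg τ (k+1) (by norm_num : (0:ℤ) - 1 < 0)]
    cases k with
    | zero => simp [ker, nb]
    | succ k => simp [ker, nb]
  · obtain ⟨m, rfl⟩ : ∃ m : ℕ, j = m + 1 := ⟨(j - 1).toNat, by omega⟩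
    have e1 : ((m : ℤ) + 1).toNat = m + 1 := by omega
    have e2 : ((m : ℤ) + 1 - 1).toNat = m := by omega
    have e3 : (0:ℤ) ≤ (m:ℤ) + 1 := by omega
    have e4 : (0:ℤ) ≤ (m:ℤ) + 1 - 1 := by omega
    have e5 : ¬ ((m:ℤ) + 1 = 0) := by omega
    cases k with
    | zero =>
      simp only [ker, e1, e2, e3, e4, e5, if_true, if_false, nb_zero_left, pow_succ]; ring
    | succ k =>
      simp only [ker, e1, e2, e3, e4, if_true, nb_rec]

lemma posP {τ : ℝ} (h0 : 0 < τ) (Y b : ℤ → ℝ) (N0 : ℤ)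
    (hrec : ∀ n ≤ N0, Y n = b n + τ * Y (n - 1)) (hb : ∀ n ≤ N0, 0 ≤ b n)
    (ht : ∀ n, Tendsto (fun j : ℕ => τ ^ j * Y (n - j)) atTop (𝓝 0)) :
    ∀ n ≤ N0, 0 ≤ Y n := by
  intro n hn
  have key : ∀ j : ℕ, τ ^ j * Y (n - j) ≤ Y n := by
    intro j
    induction j with
    | zero => simp
    | succ j ih =>
      refine le_trans ?_ ih
      rw [hrec (n - j) (by omega)]
      have h1 := hb (n - j) (by omega)
      have h2 := pow_pos h0 j
      have e : n - ((j + 1 : ℕ) : ℤ) = n - j - 1 := by push_cast; ring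
      rw [e, pow_succ]
      nlinarith
  exact le_of_tendsto (ht n) (Eventually.of_forall key)

lemma seqP2 {τ : ℝ} (h0 : 0 < τ) (h1 : τ < 1) (y : ℕ → ℤ → ℝ)
    (hrec : ∀ k n, y (k + 1) n = y k n + τ * y (k + 1) (n - 1))
    (ht : ∀ k n, Tendsto (fun j : ℕ => τ ^ j * y k (n - j)) atTop (𝓝 0))
    (c : ℝ) (hc : 0 < c) (S : Finset ℤ) (hS : ∀ n, n ∉ S → c ≤ y 0 n) :
    ∃ K : ℕ, ∀ k ≥ K, ∀ n, 0 < y (k + 1) n := by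
  have h2 : 0 < 1 - τ := by linarith
  obtain ⟨G, hG0, hG⟩ : ∃ G : ℝ, 0 ≤ G ∧ ∀ n ∈ S, - G ≤ y 0 n := by
    refine ⟨∑ n ∈ S, |y 0 n|, Finset.sum_nonneg (fun _ _ => abs_nonneg _), fun n hn => ?_⟩
    have := Finset.single_le_sum (f := fun n => |y 0 n|) (fun _ _ => abs_nonneg _) hn
    have := neg_abs_le (y 0 n)
    linarith
  have main : ∀ k n, 0 ≤ y k n - (c * ((1 - τ)⁻¹) ^ k - (G + c) * ∑ m ∈ S, ker τ k (n - m)) := by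
    intro k
    induction k with
    | zero =>
      intro n
      have e : ∑ m ∈ S, ker τ 0 (n - m) = if n ∈ S then 1 else 0 := by
        rw [← Finset.sum_ite_eq S n (fun _ => (1:ℝ))]
        apply Finset.sum_congr rfl
        intro m _
        simp only [ker, sub_eq_zero]
      rw [e]
      by_cases hn : n ∈ S
      · have := hG n hn; simp [hn]; linarith
      · have := hS n hn; simp [hn]; linarith
    | succ k ih =>
      intro n
      refine posP h0 (fun n => y (k+1) n - (c * ((1 - τ)⁻¹) ^ (k+1)
          - (G + c) * ∑ m ∈ S, ker τ (k+1) (n - m)))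
        (fun n => y k n - (c * ((1 - τ)⁻¹) ^ k - (G + c) * ∑ m ∈ S, ker τ k (n - m))) n
        ?_ (fun n _ => ih n) ?_ n le_rfl
      · intro n _
        have e : ∑ m ∈ S, ker τ (k+1) (n - m) =
            ∑ m ∈ S, ker τ k (n - m) + τ * ∑ m ∈ S, ker τ (k+1) (n - 1 - m) := by
          rw [Finset.mul_sum, ← Finset.sum_add_distrib]
          apply Finset.sum_congr rfl
          intro m _
          rw [ker_rec]
          congr 3; ring
        rw [hrec k n, e]
        have e2 : ((1 - τ)⁻¹) ^ (k+1) * (1 - τ) = ((1 - τ)⁻¹) ^ k := by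
          rw [pow_succ]; field_simp
        linear_combination (c) * (-e2)
      · intro n
        have t1 := ht (k+1) n
        have t2 : Tendsto (fun j : ℕ => τ ^ j * (c * ((1 - τ)⁻¹) ^ (k+1))) atTop (𝓝 0) := by
          have := (tendsto_pow_atTop_nhds_zero_of_lt_one h0.le h1).mul_const
            (c * ((1 - τ)⁻¹) ^ (k+1))
          simpa using this
        have t3 : Tendsto (fun j : ℕ => τ ^ j * ((G + c) * ∑ m ∈ S, ker τ (k+1) (n - j - m)))
            atTop (𝓝 0) := by
          apply tendsto_const_nhds.congr'
          obtain ⟨L, hL⟩ : ∃ L : ℕ, ∀ m ∈ S, n - m < L := by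
            refine ⟨(∑ m ∈ S, |n - m|).toNat + 1, fun m hm => ?_⟩
            have := Finset.single_le_sum (f := fun m => |n - m|) (fun _ _ => abs_nonneg _) hm
            have := le_abs_self (n - m)
            omega
          filter_upwards [eventually_ge_atTop L] with j hj
          rw [Finset.sum_eq_zero]
          · simp
          · intro m hm
            apply ker_neg
            have := hL m hm
            omega
        have := (t1.sub t2).add t3
        simp only [sub_zero, add_zero] at this
        refine this.congr (fun j => ?_)
        ring
  -- choose K
  obtain ⟨Q, hQ⟩ := exists_nat_gt (2 * (G + c) * S.card / c)
  obtain ⟨K, hK⟩ := nb_small h0 h1 (Q + 1) (by omega)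
  refine ⟨K, fun k hk n => ?_⟩
  have hm := main (k + 1) n
  have e : ∀ j : ℤ, ker τ (k+1) j * (1 - τ) ^ (k+1) * (Q + 1 : ℝ) ≤ 2 := by
    intro j
    by_cases hj : 0 ≤ j
    · simp only [ker, hj, if_true]
      have := hK k hk j.toNat
      push_cast at this
      exact this
    · simp [ker, hj]
  have hs : (∑ m ∈ S, ker τ (k+1) (n - m)) * (1 - τ) ^ (k+1) * (Q + 1 : ℝ) ≤ 2 * S.card := by
    rw [Finset.sum_mul, Finset.sum_mul]
    have := Finset.sum_le_card_nsmul S _ 2 (fun m _ => e (n - m))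
    simpa [mul_comm] using this
  have hp : 0 < (1 - τ) ^ (k+1) := by positivity
  have hpi : ((1 - τ)⁻¹) ^ (k+1) * (1 - τ) ^ (k+1) = 1 := by
    rw [← mul_pow, inv_mul_cancel₀ h2.ne', one_pow]
  by_contra hneg
  push Not at hneg
  rw [div_lt_iff₀ hc] at hQ
  set Sg := ∑ m ∈ S, ker τ (k+1) (n - m)
  have h5 : c * ((1 - τ)⁻¹) ^ (k+1) ≤ (G + c) * Sg := by linarith
  have h6 : c ≤ (G + c) * (Sg * (1 - τ) ^ (k+1)) := by
    have := mul_le_mul_of_nonneg_right h5 hp.le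
    rw [mul_assoc, hpi, mul_one, mul_assoc] at this
    exact this
  have hQ0 : (0:ℝ) ≤ Q := by positivity
  have h7 : c * (Q + 1) ≤ (G + c) * (2 * S.card) := by
    calc c * (Q + 1) ≤ ((G + c) * (Sg * (1 - τ) ^ (k+1))) * (Q + 1) := by gcongr
      _ = (G + c) * (Sg * (1 - τ) ^ (k+1) * (Q + 1)) := by ring
      _ ≤ (G + c) * (2 * S.card) := by gcongr
  nlinarith

lemma seqP1 {τ R : ℝ} (h0 : 0 < τ) (h1 : τ < 1) (hR : 0 ≤ R) (hτR : τ * R < 1)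
    (y : ℕ → ℤ → ℝ)
    (hrec : ∀ k n, y (k + 1) n = y k n + τ * y (k + 1) (n - 1))
    (hbd : ∀ k n, ∃ C : ℝ, ∀ j : ℕ, |y k (n - j)| ≤ C * R ^ j)
    (c : ℝ) (hc : 0 < c) (M0 M1 : ℤ) (hM0 : ∀ n < M0, y 0 n ≤ - c) (hM1 : ∀ n > M1, c ≤ y 0 n) :
    ∃ k : ℕ, ∀ n, 0 ≤ y k n → 0 < y k (n + 1) := by
  have hlim : ∀ k n, Tendsto (fun j : ℕ => (j : ℝ) * (τ ^ j * y k (n - j))) atTop (𝓝 0) ∧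
      Tendsto (fun j : ℕ => (τ ^ j * y k (n - j))) atTop (𝓝 0) := by
    intro k n
    obtain ⟨C, hC⟩ := hbd k n
    have hr0 : 0 ≤ τ * R := by positivity
    have b : ∀ j : ℕ, |τ ^ j * y k (n - j)| ≤ C * (τ * R) ^ j := by
      intro j
      rw [abs_mul, abs_of_pos (pow_pos h0 j), mul_pow]
      have := mul_le_mul_of_nonneg_left (hC j) (pow_pos h0 j).le
      linarith
    constructor
    · apply squeeze_zero_norm (a := fun j : ℕ => C * (j * (τ * R) ^ j))
      · intro j
        rw [Real.norm_eq_abs, abs_mul, Nat.abs_cast]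
        have := mul_le_mul_of_nonneg_left (b j) (Nat.cast_nonneg (α := ℝ) j)
        linarith
      · have := (tendsto_self_mul_const_pow_of_lt_one hr0 hτR).const_mul C
        simpa using this
    · apply squeeze_zero_norm (a := fun j : ℕ => C * ((τ * R) ^ j))
      · intro j
        exact b j
      · have := (tendsto_pow_atTop_nhds_zero_of_lt_one hr0 hτR).const_mul C
        simpa using this
  let z : ℕ → ℤ → ℝ := fun k n =>
    ((n : ℝ) - M0) * y (k + 1) n - (k + ((n : ℝ) - M0)) * τ * y (k + 1) (n - 1)
  have z0 : ∀ n, z 0 n = ((n : ℝ) - M0) * y 0 n := by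
    intro n; simp only [z]; rw [hrec 0 n]; push_cast; ring
  have zrec : ∀ k n, z (k + 1) n = z k n + τ * z (k + 1) (n - 1) := by
    intro k n
    simp only [z]
    have r1 := hrec (k + 1) n
    have r2 := hrec (k + 1) (n - 1)
    push_cast
    linear_combination ((n : ℝ) - M0) * r1 - (k + ((n : ℝ) - M0)) * τ * r2
  have zt : ∀ k n, Tendsto (fun j : ℕ => τ ^ j * z k (n - j)) atTop (𝓝 0) := by
    intro k n
    obtain ⟨a1, a2⟩ := hlim (k + 1) n
    obtain ⟨b1, b2⟩ := hlim (k + 1) (n - 1)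
    have A := ((a2.const_mul ((n : ℝ) - M0)).sub a1).sub
      (((b2.const_mul ((k + ((n : ℝ) - M0)) * τ)).sub (b1.const_mul τ)))
    simp only [mul_zero, sub_zero] at A
    refine A.congr (fun j => ?_)
    simp only [z]
    have e : n - 1 - (j : ℤ) = n - j - 1 := by ring
    rw [e]; push_cast; ring
  obtain ⟨K, hK⟩ := seqP2 h0 h1 z zrec zt c hc (Finset.Icc M0 (max M0 M1)) (by
    intro n hn
    rw [z0]
    rw [Finset.mem_Icc, not_and_or] at hn
    rcases hn with hn | hn
    · have h3 := hM0 n (by omega)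
      have : (n : ℝ) + 1 ≤ M0 := by exact_mod_cast (by omega : n + 1 ≤ M0)
      nlinarith
    · push Not at hn
      rw [max_lt_iff] at hn
      have h3 := hM1 n hn.2
      have : (M0 : ℝ) + 1 ≤ n := by exact_mod_cast (by omega : M0 + 1 ≤ n)
      nlinarith)
  have hz := hK K le_rfl
  have hneg : ∀ k, ∀ n ≤ M0 - 1, y k n ≤ - c := by
    intro k
    induction k with
    | zero => intro n hn; exact hM0 n (by omega)
    | succ k ih =>
      have h3 := posP h0 (fun n => - y (k+1) n) (fun n => - y k n) (M0 - 1)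
        (by intro n _; rw [hrec]; ring)
        (by intro n hn; have := ih n hn; linarith)
        (by intro n; have := (hlim (k+1) n).2.neg; simpa using this)
      intro n hn
      have h4 := h3 (n - 1) (by omega)
      have h5 := ih n hn
      rw [hrec]
      nlinarith
  refine ⟨K + 1 + 1, fun n hn => ?_⟩
  have hnM : M0 ≤ n := by
    by_contra hlt
    have := hneg (K + 1 + 1) n (by omega)
    linarith
  have h3 := hz (n + 1)
  simp only [z] at h3
  have e : n + 1 - 1 = n := by ring
  rw [e] at h3
  have hn' : (M0 : ℝ) ≤ n := by exact_mod_cast hnM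
  push_cast at h3
  have h4 : 0 ≤ ((K:ℝ) + 1 + (n + 1 - M0)) * τ * y (K + 1 + 1) n := by
    apply mul_nonneg (mul_nonneg _ h0.le) hn
    have : (0:ℝ) ≤ K := by positivity
    linarith
  have h5 : 0 < ((n:ℝ) + 1 - M0) * y (K+1+1) (n+1) := by linarith
  exact (mul_pos_iff_of_pos_left (by linarith)).1 h5

end CoxMin


namespace CoxMin
open Filter Topology

set_option linter.unusedSectionVars false

/-- sign as a real number -/
noncomputable def sn (x : ℝ) : ℝ := if 0 < x then 1 else if x < 0 then -1 else 0

lemma sn_pos {x : ℝ} (h : 0 < x) : sn x = 1 := by simp [sn, h]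
lemma sn_neg {x : ℝ} (h : x < 0) : sn x = -1 := by simp [sn, h, not_lt.2 h.le]
lemma sn_zero : sn 0 = 0 := by simp [sn]
lemma sn_opp (x : ℝ) : sn (-x) = - sn x := by
  rcases lt_trichotomy x 0 with h | h | h
  · rw [sn_neg h, sn_pos (by linarith)]; norm_num
  · simp [h, sn_zero]
  · rw [sn_pos h, sn_neg (by linarith)]
lemma sn_mul (c x : ℝ) : sn (c * x) = sn c * sn x := by
  rcases lt_trichotomy x 0 with h | h | h <;> rcases lt_trichotomy c 0 with h' | h' | h'
  · rw [sn_neg h, sn_neg h', sn_pos (by nlinarith)]; norm_num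
  · simp [h', sn_zero]
  · rw [sn_neg h, sn_pos h', sn_neg (by nlinarith)]; norm_num
  · simp [h, sn_zero]
  · simp [h, sn_zero]
  · simp [h, sn_zero]
  · rw [sn_pos h, sn_neg h', sn_neg (by nlinarith)]; norm_num
  · simp [h', sn_zero]
  · rw [sn_pos h, sn_pos h', sn_pos (by nlinarith)]; norm_num

lemma sn_eventually {α : Type*} {l : Filter α} {f : α → ℝ} {x : ℝ} (hf : Tendsto f l (𝓝 x))
    (hx : x ≠ 0) : ∀ᶠ a in l, sn (f a) = sn x := by
  rcases lt_or_gt_of_ne hx with h | h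
  · filter_upwards [hf.eventually (gt_mem_nhds h)] with a ha
    rw [sn_neg ha, sn_neg h]
  · filter_upwards [hf.eventually (lt_mem_nhds h)] with a ha
    rw [sn_pos ha, sn_pos h]

section fin
variable {O : Type*} [Fintype O] [DecidableEq O] (σ : Equiv.Perm O)

/-- correlation of neighbouring signs -/
noncomputable def TT (a : O → ℝ) : ℝ := ∑ o, sn (a o) * sn (a (σ o))

/-- number of down crossings -/
noncomputable def up (a : O → ℝ) : ℕ := (Finset.univ.filter (fun o => 0 < a o ∧ a (σ o) < 0)).card

lemma up_TT (a : O → ℝ) (ha : ∀ o, a o ≠ 0) : 4 * (up σ a : ℝ) = Fintype.card O - TT σ a := by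
  classical
  have h1 : ∀ o, (if 0 < a o ∧ a (σ o) < 0 then (4:ℝ) else 0) =
      1 + sn (a o) - sn (a (σ o)) - sn (a o) * sn (a (σ o)) := by
    intro o
    rcases lt_or_gt_of_ne (ha o) with h | h <;> rcases lt_or_gt_of_ne (ha (σ o)) with h' | h'
    · rw [sn_neg h, sn_neg h', if_neg (by intro hh; linarith [hh.1])]; norm_num
    · rw [sn_neg h, sn_pos h', if_neg (by intro hh; linarith [hh.1])]; norm_num
    · rw [sn_pos h, sn_neg h', if_pos ⟨h, h'⟩]; norm_num
    · rw [sn_pos h, sn_pos h', if_neg (by intro hh; linarith [hh.2])]; norm_num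
  have h2 : ∑ o, (if 0 < a o ∧ a (σ o) < 0 then (4:ℝ) else 0) = 4 * (up σ a : ℝ) := by
    rw [← Finset.sum_filter, Finset.sum_const, up, nsmul_eq_mul, mul_comm]
  rw [← h2, Finset.sum_congr rfl (fun o _ => h1 o)]
  simp only [Finset.sum_sub_distrib, Finset.sum_add_distrib, TT]
  rw [Equiv.sum_comp σ (fun o => sn (a o))]
  simp

variable {σ}

lemma eig_adj (hσ : ∀ a b, ∃ n : ℕ, (σ ^ n) a = b) {μ : ℝ} {z : O → ℝ}
    (hz : ∀ o, z (σ o) + z (σ.symm o) = μ * z o) (h0 : z ≠ 0) (o : O) (ho : z o = 0) :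
    z (σ o) ≠ 0 := by
  intro h1
  apply h0
  have key : ∀ n : ℕ, z ((σ ^ n) o) = 0 ∧ z ((σ ^ (n+1)) o) = 0 := by
    intro n
    induction n with
    | zero => simpa using ⟨ho, h1⟩
    | succ n ih =>
      refine ⟨ih.2, ?_⟩
      have := hz ((σ ^ (n+1)) o)
      rw [ih.2] at this
      have e : σ.symm ((σ ^ (n+1)) o) = (σ ^ n) o := by
        rw [pow_succ']; simp
      rw [e, ih.1] at this
      rw [pow_succ', Equiv.Perm.mul_apply]
      linarith
  funext p
  obtain ⟨n, rfl⟩ := hσ o p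
  exact (key n).1

lemma TT_near (hσ : ∀ a b, ∃ n : ℕ, (σ ^ n) a = b) {μ : ℝ} {z : O → ℝ}
    (hz : ∀ o, z (σ o) + z (σ.symm o) = μ * z o) (h0 : z ≠ 0) (a : O → ℝ)
    (ha : ∀ o, z o ≠ 0 → sn (a o) = sn (z o)) : TT σ a = TT σ z := by
  let d : O → ℝ := fun o => sn (a o) - sn (z o)
  have hd : ∀ o, z o ≠ 0 → d o = 0 := fun o h => by simp [d, ha o h]
  have e1 : ∀ o, sn (a o) * sn (a (σ o)) =
      sn (z o) * sn (z (σ o)) + (sn (z o) * d (σ o) + d o * sn (z (σ o))) := by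
    intro o
    have hdd : d o * d (σ o) = 0 := by
      by_cases h : z o = 0
      · rw [hd _ (eig_adj hσ hz h0 o h), mul_zero]
      · rw [hd _ h, zero_mul]
    have e1 : sn (a o) = sn (z o) + d o := by simp [d]
    have e2 : sn (a (σ o)) = sn (z (σ o)) + d (σ o) := by simp [d]
    rw [e1, e2]
    linear_combination hdd
  unfold TT
  rw [Finset.sum_congr rfl (fun o _ => e1 o), Finset.sum_add_distrib, Finset.sum_add_distrib]
  have e2 : ∑ o, sn (z o) * d (σ o) = ∑ o, sn (z (σ.symm o)) * d o := by
    rw [← Equiv.sum_comp σ (fun o => sn (z (σ.symm o)) * d o)]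
    simp
  rw [e2, ← Finset.sum_add_distrib]
  rw [Finset.sum_eq_zero (s := Finset.univ) (f := fun o => sn (z (σ.symm o)) * d o + d o * sn (z (σ o)))]
  · simp
  · intro o _
    by_cases h : z o = 0
    · have := hz o
      rw [h, mul_zero] at this
      have e : z (σ o) = - z (σ.symm o) := by linarith
      rw [e, sn_opp]; ring
    · rw [hd o h]; ring

lemma TT_const (hσ : ∀ a b, ∃ n : ℕ, (σ ^ n) a = b) {μ : ℝ} {z z' : O → ℝ}
    (hz : ∀ o, z (σ o) + z (σ.symm o) = μ * z o) (h0 : z ≠ 0)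
    (hz' : ∀ o, z' (σ o) + z' (σ.symm o) = μ * z' o) (h0' : z' ≠ 0) : TT σ z = TT σ z' := by
  let f : ℝ → O → ℝ := fun s o => (1 - s) * z o + s * z' o
  by_cases hex : ∃ s, f s = 0
  · obtain ⟨s, hs⟩ := hex
    have hs0 : s ≠ 0 := by
      rintro rfl
      apply h0; funext o; simpa [f] using congrFun hs o
    have e : ∀ o, z' o = (-(1 - s) / s) * z o := by
      intro o
      have : (1 - s) * z o + s * z' o = 0 := congrFun hs o
      field_simp
      linarith
    have hc : (-(1 - s) / s) ≠ 0 := by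
      intro hc
      apply h0'; funext o; rw [e o, hc]; simp
    unfold TT
    apply Finset.sum_congr rfl
    intro o _
    rw [e, e, sn_mul, sn_mul]
    rcases lt_or_gt_of_ne hc with h | h
    · rw [sn_neg h]; ring
    · rw [sn_pos h]; ring
  · push Not at hex
    have hf : ∀ s o, f s (σ o) + f s (σ.symm o) = μ * f s o := by
      intro s o
      simp only [f]
      linear_combination (1 - s) * hz o + s * hz' o
    have hl : IsLocallyConstant (fun s => TT σ (f s)) := by
      rw [IsLocallyConstant.iff_eventually_eq]
      intro s
      have : ∀ o, ∀ᶠ s' in 𝓝 s, f s o ≠ 0 → sn (f s' o) = sn (f s o) := by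
        intro o
        by_cases h : f s o = 0
        · exact Eventually.of_forall (fun _ hh => absurd h hh)
        · have hc : Continuous (fun s' => f s' o) := by simp only [f]; fun_prop
          filter_upwards [sn_eventually (hc.tendsto s) h] with a ha _ using ha
      filter_upwards [Filter.eventually_all.2 this] with s' hs'
      exact TT_near hσ (hf s) (hex s) _ hs'
    have := hl.apply_eq_of_preconnectedSpace 0 1
    simpa [f] using this

/-- spectral data for the cycle -/
structure SpecData (σ : Equiv.Perm O) (e : O → O → ℝ) (μ : O → ℝ) : Prop where
  eig : ∀ i o, e i (σ o) + e i (σ.symm o) = μ i * e i o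
  orth : ∀ i j, ∑ p, e i p * e j p = if i = j then 1 else 0
  compl : ∀ (a : O → ℝ) o, a o = ∑ i, (∑ p, e i p * a p) * e i o

lemma exists_specData (σ : Equiv.Perm O) : ∃ e μ, SpecData σ e μ := by
  let A : Matrix O O ℝ := Matrix.of (fun i j => (if σ i = j then 1 else 0) + (if σ.symm i = j then 1 else 0))
  have hA : A.IsHermitian := by
    ext i j
    simp only [A, Matrix.conjTranspose_apply, Matrix.of_apply, star_trivial]
    rw [add_comm]
    congr 1
    · have : (σ i = j) ↔ (σ.symm j = i) := by rw [Equiv.symm_apply_eq, eq_comm]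
      simp [this]
    · have : (σ j = i) ↔ (σ.symm i = j) := by rw [Equiv.symm_apply_eq, eq_comm]
      simp [this]
  refine ⟨fun i o => hA.eigenvectorBasis i o, hA.eigenvalues, ?_, ?_, ?_⟩
  · intro i o
    have := congrFun (hA.mulVec_eigenvectorBasis i) o
    simp only [Matrix.mulVec, dotProduct, A, Matrix.of_apply, add_mul, Finset.sum_add_distrib, ite_mul, one_mul, zero_mul, Finset.sum_ite_eq, Finset.mem_univ, if_true, Pi.smul_apply, smul_eq_mul] at this
    exact this
  · intro i j
    have := orthonormal_iff_ite.1 hA.eigenvectorBasis.orthonormal i j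
    rw [← this, PiLp.inner_apply]
    simp [mul_comm]
  · intro a o
    have := hA.eigenvectorBasis.sum_repr' (WithLp.toLp 2 a)
    have h2 := congrArg (fun v : EuclideanSpace ℝ O => v o) this
    simp only [] at h2
    simp only [PiLp.inner_apply] at h2
    rw [WithLp.ofLp_sum] at h2
    simp only [Finset.sum_apply] at h2
    simp [mul_comm] at h2 ⊢
    exact h2.symm

lemma spec_pos {e : O → O → ℝ} {μ : O → ℝ} (sd : SpecData σ e μ) {τ : ℝ} (h0 : 0 < τ) (h1 : τ < 1)
    (i : O) : 0 < 1 + τ ^ 2 - τ * μ i := by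
  obtain ⟨o, -, ho⟩ := Finset.exists_max_image Finset.univ (fun o => |e i o|) ⟨i, Finset.mem_univ i⟩
  have hne : 0 < |e i o| := by
    by_contra hcon
    have h3 : ∀ p, e i p = 0 := fun p => by
      have := ho p (Finset.mem_univ p)
      have h4 := abs_nonneg (e i p)
      exact abs_eq_zero.1 (by linarith)
    have := sd.orth i i
    simp [h3] at this
  have h2 : μ i ≤ 2 := by
    have h3 : |μ i * e i o| ≤ 2 * |e i o| := by
      rw [← sd.eig i o]
      have a1 := ho (σ o) (Finset.mem_univ _)
      have a2 := ho (σ.symm o) (Finset.mem_univ _)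
      have := abs_add_le (e i (σ o)) (e i (σ.symm o))
      linarith
    rw [abs_mul] at h3
    have := le_of_mul_le_mul_right h3 hne
    exact (le_abs_self _).trans this
  nlinarith [mul_pos (sub_pos.2 h1) (sub_pos.2 h1), mul_le_mul_of_nonneg_left h2 h0.le]

lemma fin_conv {e : O → O → ℝ} {μ : O → ℝ} (sd : SpecData σ e μ) (hσ : ∀ a b, ∃ n : ℕ, (σ ^ n) a = b)
    {τ : ℝ} (h0 : 0 < τ) (h1 : τ < 1)
    (y : ℕ → O → ℝ)
    (hrec : ∀ k o, y k o = (1 + τ ^ 2) * y (k+1) o - τ * (y (k+1) (σ o) + y (k+1) (σ.symm o)))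
    (j : O) (hj : ∑ p, e j p * y 0 p ≠ 0)
    (hmin : ∀ i, ∑ p, e i p * y 0 p ≠ 0 → 1 + τ ^ 2 - τ * μ j ≤ 1 + τ ^ 2 - τ * μ i) :
    ∃ z : O → ℝ, z ≠ 0 ∧ (∀ o, z (σ o) + z (σ.symm o) = μ j * z o) ∧
      ∀ᶠ k in atTop, TT σ (y k) = TT σ z := by
  let c : ℕ → O → ℝ := fun k i => ∑ p, e i p * y k p
  let D : O → ℝ := fun i => 1 + τ ^ 2 - τ * μ i
  have hD : ∀ i, 0 < D i := spec_pos sd h0 h1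
  have hc : ∀ k i, c k i = D i * c (k+1) i := by
    intro k i
    have e1 : ∑ p, e i p * y (k+1) (σ p) = ∑ p, e i (σ.symm p) * y (k+1) p := by
      rw [← Equiv.sum_comp σ (fun p => e i (σ.symm p) * y (k+1) p)]; simp
    have e2 : ∑ p, e i p * y (k+1) (σ.symm p) = ∑ p, e i (σ p) * y (k+1) p := by
      rw [← Equiv.sum_comp σ (fun p => e i p * y (k+1) (σ.symm p))]; simp
    have e3 : ∑ p, e i (σ p) * y (k+1) p + ∑ p, e i (σ.symm p) * y (k+1) p = μ i * c (k+1) i := by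
      rw [← Finset.sum_add_distrib, Finset.mul_sum]
      apply Finset.sum_congr rfl
      intro p _
      rw [← add_mul, sd.eig]; ring
    have e4 : c k i = (1 + τ ^ 2) * c (k+1) i - τ * (∑ p, e i p * y (k+1) (σ p) + ∑ p, e i p * y (k+1) (σ.symm p)) := by
      simp only [c]
      rw [← Finset.sum_add_distrib, Finset.mul_sum, Finset.mul_sum, ← Finset.sum_sub_distrib]
      apply Finset.sum_congr rfl
      intro p _
      rw [hrec k p]; ring
    rw [e4, e1, e2]; simp only [D]; linear_combination (-τ) * e3
  have hck : ∀ k i, D j ^ k * c k i = (D j / D i) ^ k * c 0 i := by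
    intro k i
    induction k with
    | zero => simp
    | succ k ih =>
      have := hc k i
      have h3 := (hD i).ne'
      calc D j ^ (k+1) * c (k+1) i = (D j ^ k * c k i) * (D j / D i) := by
            rw [this, pow_succ]; field_simp
        _ = _ := by rw [ih, pow_succ]; ring
  let z : O → ℝ := fun o => ∑ i, (if D i = D j then c 0 i else 0) * e i o
  have hzc : ∀ i, ∑ p, e i p * z p = if D i = D j then c 0 i else 0 := by
    intro i
    simp only [z, Finset.mul_sum]
    rw [Finset.sum_comm]
    have : ∀ i', ∑ p, e i p * ((if D i' = D j then c 0 i' else 0) * e i' p) =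
        (if D i' = D j then c 0 i' else 0) * if i = i' then 1 else 0 := by
      intro i'
      rw [← sd.orth, Finset.mul_sum]
      apply Finset.sum_congr rfl
      intro p _; ring
    simp only [this, mul_ite, mul_one, mul_zero, Finset.sum_ite_eq, Finset.mem_univ, if_true]
  refine ⟨z, ?_, ?_, ?_⟩
  · intro hz
    have := hzc j
    simp [hz] at this
    exact hj this.symm
  · intro o
    simp only [z]
    rw [← Finset.sum_add_distrib, Finset.mul_sum]
    apply Finset.sum_congr rfl
    intro i _
    by_cases h : D i = D j
    · have : μ i = μ j := by
        have h5 : τ * μ i = τ * μ j := by simp only [D] at h; linarith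
        exact mul_left_cancel₀ h0.ne' h5
      rw [← mul_add, sd.eig, this]; ring
    · simp [h]
  · have hzz : z ≠ 0 := by
      intro hz
      have := hzc j
      simp [hz] at this
      exact hj this.symm
    have hze : ∀ o, z (σ o) + z (σ.symm o) = μ j * z o := by
      intro o
      simp only [z]
      rw [← Finset.sum_add_distrib, Finset.mul_sum]
      apply Finset.sum_congr rfl
      intro i _
      by_cases h : D i = D j
      · have : μ i = μ j := by
          have h5 : τ * μ i = τ * μ j := by simp only [D] at h; linarith
          exact mul_left_cancel₀ h0.ne' h5
        rw [← mul_add, sd.eig, this]; ring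
      · simp [h]
    have ht : ∀ o, Tendsto (fun k => D j ^ k * y k o) atTop (𝓝 (z o)) := by
      intro o
      have e1 : ∀ k, D j ^ k * y k o = ∑ i, (D j / D i) ^ k * c 0 i * e i o := by
        intro k
        rw [sd.compl (y k) o, Finset.mul_sum]
        apply Finset.sum_congr rfl
        intro i _
        rw [← hck k i]; ring
      simp only [e1]
      apply tendsto_finsetSum
      intro i _
      apply Tendsto.mul_const
      by_cases h : D i = D j
      · simp only [h, if_true]
        rw [div_self (hD j).ne']
        simp
      · simp only [h, if_false]
        by_cases h2 : c 0 i = 0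
        · simp [h2]
        · have h3 : D j < D i := lt_of_le_of_ne (hmin i h2) (Ne.symm h)
          have := (tendsto_pow_atTop_nhds_zero_of_lt_one (div_nonneg (hD j).le (hD i).le)
            ((div_lt_one (hD i)).2 h3)).mul_const (c 0 i)
          simpa using this
    have hev : ∀ o, ∀ᶠ k in atTop, z o ≠ 0 → sn (y k o) = sn (z o) := by
      intro o
      by_cases h : z o = 0
      · exact Eventually.of_forall (fun _ hh => absurd h hh)
      · filter_upwards [sn_eventually (ht o) h] with k hk _
        rw [sn_mul, sn_pos (pow_pos (hD j) k), one_mul] at hk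
        exact hk
    filter_upwards [Filter.eventually_all.2 hev] with k hk
    exact TT_near hσ hze hzz _ hk

lemma finOrbit {e : O → O → ℝ} {μ : O → ℝ} (sd : SpecData σ e μ) (hσ : ∀ a b, ∃ n : ℕ, (σ ^ n) a = b)
    {τ : ℝ} (h0 : 0 < τ) (h1 : τ < 1)
    (y y' : ℕ → O → ℝ)
    (hrec : ∀ k o, y k o = (1 + τ ^ 2) * y (k+1) o - τ * (y (k+1) (σ o) + y (k+1) (σ.symm o)))
    (hrec' : ∀ k o, y' k o = (1 + τ ^ 2) * y' (k+1) o - τ * (y' (k+1) (σ o) + y' (k+1) (σ.symm o)))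
    (hgen : ∀ i, ∑ p, e i p * y 0 p = 0 ↔ ∑ p, e i p * y' 0 p = 0)
    (hy : ∀ k o, y k o ≠ 0) (hy' : ∀ k o, y' k o ≠ 0) :
    ∃ k, up σ (y k) = up σ (y' k) := by
  by_cases hO : IsEmpty O
  · exact ⟨0, by simp [up, Finset.univ_eq_empty]⟩
  rw [not_isEmpty_iff] at hO
  obtain ⟨o⟩ := hO
  have hex : ∃ i, ∑ p, e i p * y 0 p ≠ 0 := by
    by_contra hcon
    push Not at hcon
    apply hy 0 o
    rw [sd.compl (y 0) o]
    simp [hcon]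
  obtain ⟨i, hi⟩ := hex
  obtain ⟨j, hj, hmin⟩ := Finset.exists_min_image
    (Finset.univ.filter (fun i => ∑ p, e i p * y 0 p ≠ 0)) (fun i => 1 + τ ^ 2 - τ * μ i) ⟨i, by simpa using hi⟩
  simp only [Finset.mem_filter, Finset.mem_univ, true_and] at hj hmin
  obtain ⟨z, hz0, hze, hz⟩ := fin_conv sd hσ h0 h1 y hrec j hj hmin
  obtain ⟨z', hz0', hze', hz'⟩ := fin_conv sd hσ h0 h1 y' hrec' j (fun h => hj ((hgen j).2 h))
    (fun i hi => hmin i (fun h => hi ((hgen i).1 h)))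
  obtain ⟨k, hk, hk'⟩ := (hz.and hz').exists
  refine ⟨k, ?_⟩
  have a1 := up_TT σ (y k) (hy k)
  have a2 := up_TT σ (y' k) (hy' k)
  rw [hk, TT_const hσ hze hz0 hze' hz0', ← hk'] at a1
  have : (up σ (y k) : ℝ) = up σ (y' k) := by linarith
  exact_mod_cast this

end fin
end CoxMin


namespace CoxMin
open CoxeterSystem
open Filter Topology
set_option linter.unusedSectionVars false

section PE
variable {B W : Type*} [Group W] {M : CoxeterMatrix B} (cs : CoxeterSystem M W) [Fintype B]

/-- the coordinate l1-norm -/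
noncomputable def nn (v : B →₀ ℝ) : ℝ := ∑ i, |v i|

lemma nn_nonneg (v : B →₀ ℝ) : 0 ≤ nn v := Finset.sum_nonneg (fun _ _ => abs_nonneg _)

lemma nn_neg (v : B →₀ ℝ) : nn (-v) = nn v := by simp [nn]

lemma expand (x : Module.Dual ℝ (B →₀ ℝ)) (v : B →₀ ℝ) : x v = ∑ i, v i * x (al i) := by
  classical
  have : v = ∑ i, v i • al i := by
    ext j; simp [al, Finsupp.finsetSum_apply, Finsupp.single_apply]
  conv_lhs => rw [this]
  simp [map_sum]

lemma dual_bound (x : Module.Dual ℝ (B →₀ ℝ)) : ∃ C : ℝ, 0 ≤ C ∧ ∀ v, |x v| ≤ C * nn v := by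
  refine ⟨∑ i, |x (al i)|, Finset.sum_nonneg (fun _ _ => abs_nonneg _), fun v => ?_⟩
  rw [expand x v, nn, Finset.mul_sum]
  refine (Finset.abs_sum_le_sum_abs _ _).trans ?_
  apply Finset.sum_le_sum
  intro i _
  rw [abs_mul, mul_comm]
  gcongr
  exact Finset.single_le_sum (f := fun i => |x (al i)|) (fun _ _ => abs_nonneg _) (Finset.mem_univ i)

lemma bf_bound (i : B) (v : B →₀ ℝ) : |bf M i v| ≤ nn v := by
  rw [expand (bf M i) v, nn]
  refine (Finset.abs_sum_le_sum_abs _ _).trans ?_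
  apply Finset.sum_le_sum
  intro j _
  rw [abs_mul, bf_al]
  exact mul_le_of_le_one_right (abs_nonneg _) (kf_abs M i j)

lemma nn_add (u v : B →₀ ℝ) : nn (u + v) ≤ nn u + nn v := by
  simp only [nn, ← Finset.sum_add_distrib]
  apply Finset.sum_le_sum
  intro i _
  simpa using abs_add_le (u i) (v i)

lemma nn_smul (c : ℝ) (v : B →₀ ℝ) : nn (c • v) = |c| * nn v := by
  simp [nn, abs_mul, Finset.mul_sum]

lemma nn_al (i : B) : nn (al i) = 1 := by
  classical
  simp only [nn, al, Finsupp.single_apply]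
  rw [Finset.sum_eq_single i]
  · simp
  · intro j _ hj; simp [hj.symm]
  · simp

lemma nn_sg (i : B) (v : B →₀ ℝ) : nn (sg M i v) ≤ 3 * nn v := by
  rw [sg_apply, sub_eq_add_neg]
  refine (nn_add _ _).trans ?_
  rw [nn_neg, nn_smul, nn_al, abs_mul]
  have := bf_bound (M := M) i v
  norm_num
  linarith

lemma nn_rho (n : ℕ) : ∀ (w : W) (v : B →₀ ℝ), cs.length w = n → nn (rho cs w v) ≤ 3 ^ n * nn v := by
  intro w v hw
  obtain ⟨ω, h1, rfl⟩ := cs.exists_isReduced w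
  have h2 : ω.length = n := by rw [← hw]; exact h1.symm
  subst h2
  clear hw h1
  induction ω with
  | nil => simp
  | cons i ω ih =>
    rw [cs.wordProd_cons, rho_mul, rho_simple]
    refine (nn_sg i _).trans ?_
    rw [List.length_cons, pow_succ]
    linarith

lemma nn_rho' (w : W) (v : B →₀ ℝ) : nn (rho cs w v) ≤ 3 ^ cs.length w * nn v :=
  nn_rho cs _ w v rfl

lemma Rt.one_le {β : B →₀ ℝ} (h : β ∈ Rt cs) : 1 ≤ nn β := by
  have h1 := Rt.bb_self cs h
  have h2 : |bb M β β| ≤ nn β * nn β := by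
    rw [expand (bb M β) β]
    refine (Finset.abs_sum_le_sum_abs _ _).trans ?_
    conv_rhs => rw [nn, Finset.sum_mul]
    apply Finset.sum_le_sum
    intro j _
    rw [abs_mul, bb_al']
    exact mul_le_mul_of_nonneg_left (bf_bound j β) (abs_nonneg _)
  rw [h1] at h2
  have := nn_nonneg β
  simp at h2
  nlinarith

/-- filter of almost all positive roots -/
def PF : Filter (B →₀ ℝ) := cofinite ⊓ 𝓟 {β | β ∈ Rt cs ∧ Pos β}

lemma ev_PF {p : (B →₀ ℝ) → Prop} : (∀ᶠ β in PF cs, p β) ↔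
    {β | β ∈ Rt cs ∧ Pos β ∧ ¬ p β}.Finite := by
  rw [PF, eventually_inf_principal, eventually_cofinite]
  have : {x | ¬(x ∈ {β | β ∈ Rt cs ∧ Pos β} → p x)} = {β | β ∈ Rt cs ∧ Pos β ∧ ¬ p β} := by
    ext x; simp [and_assoc]
  rw [this]

lemma ev_self : ∀ᶠ β in PF cs, β ∈ Rt cs ∧ Pos β := by
  rw [ev_PF]
  convert Set.finite_empty
  ext x; simp; tauto

lemma tendsto_rho (w : W) : Tendsto (rho cs w) (PF cs) (PF cs) := by
  refine tendsto_inf.2 ⟨?_, ?_⟩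
  · exact ((rho_inj cs w).tendsto_cofinite).mono_left inf_le_left
  · rw [tendsto_principal, ev_PF]
    refine ((inv_count cs _ w rfl).1).subset ?_
    rintro β ⟨h1, h2, h3⟩
    refine ⟨h1, h2, ?_⟩
    have := Rt.act cs h1 w
    rcases Rt.pos_or cs this with h | h
    · exact absurd ⟨this, h⟩ h3
    · exact h

/-- functionals dominating almost all positive roots -/
def XX (x : Module.Dual ℝ (B →₀ ℝ)) : Prop := ∃ c : ℝ, 0 < c ∧ ∀ᶠ β in PF cs, c * nn β ≤ x β

/-- closed chamber -/
def CC (x : Module.Dual ℝ (B →₀ ℝ)) (g : W) : Prop := ∀ i, 0 ≤ x (rho cs g (al i))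

/-- open chamber -/
def OC (x : Module.Dual ℝ (B →₀ ℝ)) (g : W) : Prop := ∀ i, 0 < x (rho cs g (al i))

lemma CC.le {x : Module.Dual ℝ (B →₀ ℝ)} {g : W} (h : CC cs x g) {γ : B →₀ ℝ} (hγ : Pos γ) :
    0 ≤ x (rho cs g γ) := by
  have := expand (x ∘ₗ rho cs g) γ
  rw [LinearMap.comp_apply] at this
  rw [this]
  exact Finset.sum_nonneg (fun i _ => mul_nonneg (hγ i) (h i))

lemma OC.cc {x : Module.Dual ℝ (B →₀ ℝ)} {g : W} (h : OC cs x g) : CC cs x g := fun i => (h i).le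

lemma OC.bound {x : Module.Dual ℝ (B →₀ ℝ)} {g : W} (h : OC cs x g) :
    ∃ c : ℝ, 0 < c ∧ ∀ γ, Pos γ → c * nn γ ≤ x (rho cs g γ) := by
  obtain ⟨c, hc, hci⟩ : ∃ c : ℝ, 0 < c ∧ ∀ i, c ≤ x (rho cs g (al i)) := by
    by_cases hB : IsEmpty B
    · exact ⟨1, one_pos, fun i => (hB.false i).elim⟩
    · rw [not_isEmpty_iff] at hB
      obtain ⟨j, hj⟩ := Finite.exists_min (fun i => x (rho cs g (al i)))
      exact ⟨_, h j, hj⟩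
  refine ⟨c, hc, fun γ hγ => ?_⟩
  have := expand (x ∘ₗ rho cs g) γ
  rw [LinearMap.comp_apply] at this
  rw [this, nn, Finset.mul_sum]
  apply Finset.sum_le_sum
  intro i _
  rw [abs_of_nonneg (hγ i), mul_comm]
  exact mul_le_mul_of_nonneg_left (hci i) (hγ i)

lemma OC.pos {x : Module.Dual ℝ (B →₀ ℝ)} {g : W} (h : OC cs x g) {γ : B →₀ ℝ} (hr : γ ∈ Rt cs)
    (hγ : Pos γ) : 0 < x (rho cs g γ) := by
  obtain ⟨c, hc, hb⟩ := OC.bound cs h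
  have := hb γ hγ
  have := Rt.one_le cs hr
  nlinarith

lemma OC.XX {x : Module.Dual ℝ (B →₀ ℝ)} {g : W} (h : OC cs x g) : XX cs x := by
  obtain ⟨c, hc, hb⟩ := OC.bound cs h
  refine ⟨c / 3 ^ cs.length g, by positivity, ?_⟩
  filter_upwards [(tendsto_rho cs g⁻¹).eventually (ev_self cs)] with β hβ
  have h1 := hb _ hβ.2
  rw [rho_self_inv] at h1
  have h2 := nn_rho' cs g (rho cs g⁻¹ β)
  rw [rho_self_inv] at h2
  refine le_trans ?_ h1
  rw [div_mul_eq_mul_div, div_le_iff₀ (by positivity)]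
  nlinarith

lemma exists_CC {x : Module.Dual ℝ (B →₀ ℝ)} (hx : XX cs x) : ∃ h, CC cs x h := by
  obtain ⟨c, hc, hx⟩ := hx
  have hfin : ∀ h : W, {γ | γ ∈ Rt cs ∧ Pos γ ∧ x (rho cs h γ) < 0}.Finite := by
    intro h
    have := (tendsto_rho cs h).eventually hx
    rw [ev_PF] at this
    refine this.subset ?_
    rintro γ ⟨h1, h2, h3⟩
    refine ⟨h1, h2, ?_⟩
    have := mul_nonneg hc.le (nn_nonneg (rho cs h γ))
    linarith
  have key : ∀ n : ℕ, ∀ h : W, {γ | γ ∈ Rt cs ∧ Pos γ ∧ x (rho cs h γ) < 0}.ncard = n →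
      ∃ h, CC cs x h := by
    intro n
    induction n using Nat.strong_induction_on with
    | _ n ih =>
      intro h hn
      by_cases hcc : CC cs x h
      · exact ⟨h, hcc⟩
      · unfold CC at hcc
        push Not at hcc
        obtain ⟨i, hi⟩ := hcc
        refine ih _ ?_ (h * cs.simple i) rfl
        rw [← hn]
        have himg : (sg M i) '' {γ | γ ∈ Rt cs ∧ Pos γ ∧ x (rho cs (h * cs.simple i) γ) < 0} ⊂
            {γ | γ ∈ Rt cs ∧ Pos γ ∧ x (rho cs h γ) < 0} := by
          refine ⟨?_, ?_⟩
          · rintro _ ⟨γ, ⟨h1, h2, h3⟩, rfl⟩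
            have hne : γ ≠ al i := by
              rintro rfl
              rw [rho_mul_simple_self, map_neg] at h3
              linarith
            refine ⟨?_, sg_pos cs h1 h2 hne, ?_⟩
            · rw [← rho_simple cs]; exact Rt.act cs h1 _
            · rw [rho_mul, rho_simple] at h3; exact h3
          · intro hsub
            obtain ⟨γ, ⟨h1, h2, h3⟩, h4⟩ := hsub ⟨rt_al cs i, pos_al i, hi⟩
            have : γ = - al i := by rw [← sg_sg M i γ, h4, sg_self]
            have h5 := h2 i
            rw [this] at h5
            simp [al] at h5
            linarith
        have := Set.ncard_lt_ncard himg (hfin h)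
        rwa [Set.ncard_image_of_injective] at this
        intro a b hab
        rw [← sg_sg M i a, hab, sg_sg]
  exact key _ 1 rfl

lemma XX.step {x y : Module.Dual ℝ (B →₀ ℝ)} (hx : XX cs x) (w : W) {τ : ℝ} (h0 : 0 < τ)
    (hτ : τ * 3 ^ cs.length w < 1) (hxy : ∀ v, y v = x v + τ * y (rho cs w v)) : XX cs y := by
  obtain ⟨c, hc, hx⟩ := hx
  obtain ⟨C, hC0, hC⟩ := dual_bound y
  set R : ℝ := 3 ^ cs.length w with hR
  have hR0 : 0 < R := by positivity
  have key : ∀ L : ℕ, ∀ᶠ β in PF cs, - ((τ * R) ^ L * C * nn β) ≤ y β := by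
    intro L
    induction L with
    | zero =>
      refine Eventually.of_forall (fun β => ?_)
      have := (abs_le.1 (hC β)).1
      simpa using this
    | succ L ih =>
      filter_upwards [hx, (tendsto_rho cs w).eventually ih] with β h1 h2
      rw [hxy β]
      have h3 := nn_rho' cs w β
      rw [← hR] at h3
      have h4 : 0 ≤ c * nn β := mul_nonneg hc.le (nn_nonneg β)
      have h5 : (τ * R) ^ L * C * nn (rho cs w β) ≤ (τ * R) ^ L * C * (R * nn β) := by gcongr
      have h6 : τ * (-((τ * R) ^ L * C * nn (rho cs w β))) ≤ τ * y (rho cs w β) := by gcongr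
      have h7 : τ * ((τ * R) ^ L * C * nn (rho cs w β)) ≤ τ * ((τ * R) ^ L * C * (R * nn β)) := by gcongr
      calc -((τ * R) ^ (L + 1) * C * nn β) = - (τ * ((τ * R) ^ L * C * (R * nn β))) := by ring
        _ ≤ _ := by linarith
  have ht := ((tendsto_pow_atTop_nhds_zero_of_lt_one (mul_pos h0 hR0).le hτ).mul_const C)
  rw [zero_mul] at ht
  obtain ⟨L, hL⟩ := (ht.eventually (gt_mem_nhds (half_pos hc))).exists
  refine ⟨c / 2, half_pos hc, ?_⟩
  filter_upwards [hx, (tendsto_rho cs w).eventually (key L)] with β h1 h2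
  rw [hxy β]
  have h3 := nn_rho' cs w β
  rw [← hR] at h3
  have hn := nn_nonneg β
  have h7 : τ * ((τ * R) ^ L * C * nn (rho cs w β)) ≤ τ * ((τ * R) ^ L * C * (R * nn β)) := by gcongr
  have h6 : τ * (-((τ * R) ^ L * C * nn (rho cs w β))) ≤ τ * y (rho cs w β) := by gcongr
  have h8 : (τ * R) * ((τ * R) ^ L * C * nn β) ≤ 1 * ((τ * R) ^ L * C * nn β) := by
    gcongr
  have h9 : (τ * R) ^ L * C * nn β ≤ c / 2 * nn β := by gcongr
  nlinarith

/-- hypothesis on a set of chambers -/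
def DD (w : W) (L : ℕ) (D : Set W) : Prop := ∀ g ∈ D, cs.length (g⁻¹ * w * g) ≤ L ∧
  ∀ i, g * cs.simple i ∉ D →
    Pos (rho cs (g⁻¹ * w * g) (al i)) ∧ Pos (rho cs (g⁻¹ * w⁻¹ * g) (al i))

lemma DD.inv {w : W} {L : ℕ} {D : Set W} (h : DD cs w L D) : DD cs w⁻¹ L D := by
  intro g hg
  obtain ⟨h1, h2⟩ := h g hg
  refine ⟨?_, fun i hi => ?_⟩
  · rw [← cs.length_inv]; simpa [mul_assoc] using h1
  · rw [inv_inv]; exact (h2 i hi).symm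

lemma one_step {w : W} {L : ℕ} {D : Set W} (hD : DD cs w L D) {x y : Module.Dual ℝ (B →₀ ℝ)}
    {τ : ℝ} (h0 : 0 < τ) (hτ : τ * 3 ^ L < 1) (hxy : ∀ v, y v = x v + τ * y (rho cs w v))
    {g0 h : W} (hg0 : g0 ∈ D) (hx : CC cs x g0) (hy : CC cs y h) : ∃ g ∈ D, CC cs y g := by
  classical
  have hex : ∃ n, ∃ g ∈ D, cs.length (g0⁻¹ * g) + cs.length (g⁻¹ * h) = cs.length (g0⁻¹ * h) ∧
      cs.length (g⁻¹ * h) = n := ⟨_, g0, hg0, by simp, rfl⟩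
  obtain ⟨g, hg, hbt, hn⟩ := Nat.find_spec hex
  have hmin := fun m (hm : m < Nat.find hex) => Nat.find_min hex hm
  rw [← hn] at hmin
  refine ⟨g, hg, ?_⟩
  by_contra hcon
  unfold CC at hcon
  push Not at hcon
  obtain ⟨i0, hi0⟩ := hcon
  haveI : Nonempty B := ⟨i0⟩
  obtain ⟨i, hi⟩ := Finite.exists_min (fun i => y (rho cs g (al i)))
  have hneg : y (rho cs g (al i)) < 0 := (hi i0).trans_lt hi0
  have hnp : Pos (-(rho cs (h⁻¹ * g) (al i))) := by
    rcases Rt.pos_or cs (rt_mk cs (h⁻¹ * g) i) with hh | hh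
    · have := CC.le cs hy hh
      rw [rho_mul, rho_self_inv] at this
      linarith
    · exact hh
  rw [neg_iff] at hnp
  have e1 : cs.length (h⁻¹ * g) = cs.length (g⁻¹ * h) := by rw [← cs.length_inv]; simp
  have e2 : cs.length (h⁻¹ * g * cs.simple i) = cs.length ((g * cs.simple i)⁻¹ * h) := by
    rw [← cs.length_inv]; simp [mul_assoc]
  rw [e1, e2] at hnp
  have e3 : cs.length (g0⁻¹ * h) ≤ cs.length (g0⁻¹ * (g * cs.simple i)) + cs.length ((g * cs.simple i)⁻¹ * h) := by
    have := cs.length_mul_le (g0⁻¹ * (g * cs.simple i)) ((g * cs.simple i)⁻¹ * h)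
    refine le_trans (le_of_eq ?_) this
    congr 1; group
  have hpos : Pos (rho cs (g0⁻¹ * g) (al i)) := by
    rw [pos_iff]
    rcases cs.length_mul_simple (g0⁻¹ * g) i with h3 | h3
    · exact h3
    · rw [mul_assoc] at h3; omega
  have h4 := (pos_iff cs).1 hpos
  rw [mul_assoc] at h4
  have hnD : g * cs.simple i ∉ D := by
    intro hmem
    exact hmin _ (by omega) ⟨g * cs.simple i, hmem, by omega, rfl⟩
  obtain ⟨hL, hDD⟩ := hD g hg
  have hp := (hDD i hnD).1
  have hxg : 0 ≤ x (rho cs g (al i)) := by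
    have := CC.le cs hx hpos
    rwa [rho_mul, rho_self_inv] at this
  have hrec := hxy (rho cs g (al i))
  set γ := rho cs (g⁻¹ * w * g) (al i) with hγ
  have e5 : rho cs w (rho cs g (al i)) = rho cs g γ := by
    rw [hγ, ← rho_mul, ← rho_mul]; congr 2; group
  rw [e5] at hrec
  have hnn : nn γ ≤ 3 ^ L := by
    have := nn_rho' cs (g⁻¹ * w * g) (al i)
    rw [nn_al, mul_one] at this
    exact this.trans (by gcongr; norm_num)
  have hlow : y (rho cs g (al i)) * nn γ ≤ y (rho cs g γ) := by
    have := expand (y ∘ₗ rho cs g) γ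
    rw [LinearMap.comp_apply] at this
    rw [this, nn, Finset.mul_sum]
    apply Finset.sum_le_sum
    intro j _
    rw [abs_of_nonneg (hp j), mul_comm]
    exact mul_le_mul_of_nonneg_left (hi j) (hp j)
  have h9 : y (rho cs g (al i)) * 3 ^ L ≤ y (rho cs g (al i)) * nn γ :=
    mul_le_mul_of_nonpos_left hnn hneg.le
  have h10 : τ * (y (rho cs g (al i)) * 3 ^ L) ≤ τ * y (rho cs g γ) := by gcongr; linarith
  nlinarith

end PE
end CoxMin


namespace CoxMin
open CoxeterSystem
open Filter Topology
set_option linter.unusedSectionVars false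

section PFsec
variable {B W : Type*} [Group W] {M : CoxeterMatrix B} (cs : CoxeterSystem M W) [Fintype B]

lemma exists_Q (w : W) {τ : ℝ} (h0 : 0 < τ) (hτ : τ * 3 ^ cs.length w < 1) :
    ∃ Q : Module.End ℝ (B →₀ ℝ), Function.Injective Q ∧ ∀ v, Q v = v + τ • Q (rho cs w v) := by
  let T : Module.End ℝ (B →₀ ℝ) := 1 - τ • rho cs w
  have hT : Function.Injective T := by
    rw [← LinearMap.ker_eq_bot, LinearMap.ker_eq_bot']
    intro v hv
    have h1 : v = τ • rho cs w v := by
      simpa [T, sub_eq_zero] using hv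
    have h2 : nn v ≤ τ * (3 ^ cs.length w * nn v) := by
      conv_lhs => rw [h1]
      rw [nn_smul, abs_of_pos h0]
      have := nn_rho' cs w v
      gcongr
    have h3 := nn_nonneg v
    have h4 : nn v = 0 := by nlinarith
    ext i
    have h5 := (Finset.sum_eq_zero_iff_of_nonneg (fun i _ => abs_nonneg (v i))).1 h4 i (Finset.mem_univ i)
    simpa using h5
  let E := LinearEquiv.ofInjectiveEndo T hT
  refine ⟨E.symm.toLinearMap, E.symm.injective, fun v => ?_⟩
  have h1 : E.symm (T v) = v := E.symm_apply_apply v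
  have h2 : T v = v - τ • rho cs w v := by simp [T]
  rw [h2, map_sub, map_smul] at h1
  simp only [LinearEquiv.coe_coe]
  rw [sub_eq_iff_eq_add] at h1
  exact h1

/-- flow data -/
structure FlowData (w : W) (τ : ℝ) (L : ℕ) (q : Bool → Module.End ℝ (B →₀ ℝ)) : Prop where
  h0 : 0 < τ
  hτ : τ * 3 ^ L < 1
  hw : cs.length w ≤ L
  hq1 : ∀ v, q true v = v + τ • q true (rho cs w v)
  hq2 : ∀ v, q false v = v + τ • q false (rho cs w⁻¹ v)
  inj : ∀ b, Function.Injective (q b)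

lemma exists_flowData (w : W) (L : ℕ) (hw : cs.length w ≤ L) : ∃ τ q, FlowData cs w τ L q ∧ τ < 1 := by
  have hτ : (((1:ℝ) / 3 ^ (L + 1))) * 3 ^ L < 1 := by
    rw [pow_succ]; field_simp; norm_num
  have hτ0 : (0:ℝ) < 1 / 3 ^ (L + 1) := by positivity
  have h3 : ∀ u : W, cs.length u ≤ L → ((1:ℝ) / 3 ^ (L + 1)) * 3 ^ cs.length u < 1 := by
    intro u hu
    refine lt_of_le_of_lt ?_ hτ
    gcongr
    norm_num
  obtain ⟨Q1, h1, h1'⟩ := exists_Q cs w hτ0 (h3 w hw)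
  obtain ⟨Q2, h2, h2'⟩ := exists_Q cs w⁻¹ hτ0 (h3 w⁻¹ (by rwa [cs.length_inv]))
  refine ⟨_, fun b => if b then Q1 else Q2, ⟨hτ0, hτ, hw, by simpa using h1', by simpa using h2', ?_⟩, ?_⟩
  · intro b; cases b
    · simpa using h2
    · simpa using h1
  · have : (1:ℝ) ≤ 3 ^ L := one_le_pow₀ (by norm_num)
    nlinarith

/-- crossings -/
def CR (w : W) (x : Module.Dual ℝ (B →₀ ℝ)) (S : Set (B →₀ ℝ)) : Set (B →₀ ℝ) :=
  {β | β ∈ S ∧ 0 < x β ∧ x (rho cs w β) < 0}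

lemma CR_OC {x : Module.Dual ℝ (B →₀ ℝ)} {g : W} (h : OC cs x g) (w : W) :
    (CR cs w x (Rt cs)).Finite ∧ (CR cs w x (Rt cs)).ncard = cs.length (g⁻¹ * w * g) := by
  have hpos : ∀ γ ∈ Rt cs, (0 < x (rho cs g γ) ↔ Pos γ) := by
    intro γ hγ
    refine ⟨fun h1 => ?_, fun h1 => OC.pos cs h hγ h1⟩
    rcases Rt.pos_or cs hγ with h2 | h2
    · exact h2
    · have := OC.pos cs h (Rt.neg cs hγ) h2
      rw [map_neg, map_neg] at this
      linarith
  have e : CR cs w x (Rt cs) = rho cs g '' Inv cs (g⁻¹ * w * g) := by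
    ext β
    constructor
    · rintro ⟨h1, h2, h3⟩
      refine ⟨rho cs g⁻¹ β, ⟨Rt.act cs h1 _, ?_, ?_⟩, rho_self_inv cs g β⟩
      · rw [← hpos _ (Rt.act cs h1 _), rho_self_inv]; exact h2
      · rw [← hpos _ (Rt.neg cs (Rt.act cs (Rt.act cs h1 _) _))]
        rw [map_neg, map_neg, ← rho_mul, ← rho_mul]
        have : g * (g⁻¹ * w * g) * g⁻¹ = w := by group
        rw [← mul_assoc] at this
        simp only [← mul_assoc] at this ⊢
        rw [this]; linarith
    · rintro ⟨γ, ⟨h1, h2, h3⟩, rfl⟩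
      refine ⟨Rt.act cs h1 _, (hpos γ h1).2 h2, ?_⟩
      rw [← hpos _ (Rt.neg cs (Rt.act cs h1 _)), map_neg, map_neg, ← rho_mul] at h3
      rw [← rho_mul]
      have : g * (g⁻¹ * w * g) = w * g := by group
      rw [this] at h3; linarith
  rw [e]
  obtain ⟨h1, h2⟩ := inv_count cs _ (g⁻¹ * w * g) rfl
  exact ⟨h1.image _, by rw [Set.ncard_image_of_injective _ (rho_inj cs g), h2]⟩

lemma vd {w : W} {x y : Module.Dual ℝ (B →₀ ℝ)} {τ : ℝ} (h0 : 0 < τ)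
    (hτ : τ * 3 ^ cs.length w < 1) (hxy : ∀ v, y v = x v + τ * y (rho cs w v))
    {S : Set (B →₀ ℝ)} (hS : ∀ β ∈ S, rho cs w β ∈ S) (hx : ∀ β ∈ S, x β ≠ 0)
    (hf : (CR cs w x S).Finite) : (CR cs w y S).ncard ≤ (CR cs w x S).ncard := by
  obtain ⟨C, hC0, hC⟩ := dual_bound y
  have hSm : ∀ β ∈ S, ∀ m : ℕ, rho cs (w ^ m) β ∈ S := by
    intro β hβ m
    induction m with
    | zero => simpa using hβ
    | succ m ih => rw [pow_succ', rho_mul]; exact hS _ ih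
  have hnx : ∀ (m : ℕ) β, y (rho cs (w ^ m) β) = x (rho cs (w ^ m) β) + τ * y (rho cs (w ^ (m+1)) β) := by
    intro m β
    rw [hxy, ← rho_mul, ← pow_succ']
  have key : ∀ β ∈ CR cs w y S, ∃ j : ℕ, rho cs (w ^ j) β ∈ CR cs w x S ∧
      ∀ m : ℕ, 1 ≤ m → m ≤ j → y (rho cs (w ^ m) β) < 0 := by
    rintro β ⟨hβ, h1, h2⟩
    have hneg : ∀ i : ℕ, (∀ m, 1 ≤ m → m ≤ i → 0 < x (rho cs (w ^ m) β)) →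
        y (rho cs (w ^ (i+1)) β) < 0 := by
      intro i
      induction i with
      | zero => intro _; simpa using h2
      | succ i ih =>
        intro hm
        have h3 := ih (fun m a b => hm m a (by omega))
        have h4 := hm (i+1) (by omega) le_rfl
        have h5 := hnx (i+1) β
        by_contra h6
        push Not at h6
        have := mul_nonneg h0.le h6
        linarith
    have hx0 : 0 < x β := by
      have := hxy β
      nlinarith
    have hex : ∃ i : ℕ, x (rho cs (w ^ (i+1)) β) < 0 := by
      by_contra hcon
      push Not at hcon
      have hc2 : ∀ m, 1 ≤ m → 0 < x (rho cs (w ^ m) β) := by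
        intro m hm
        have h3 := hcon (m-1)
        rw [Nat.sub_add_cancel hm] at h3
        exact lt_of_le_of_ne h3 (hx _ (hSm β hβ m)).symm
      have h4 : ∀ j : ℕ, τ ^ j * y (rho cs (w ^ (j+1)) β) ≤ y (rho cs w β) := by
        intro j
        induction j with
        | zero => simp
        | succ j ih =>
          refine le_trans ?_ ih
          rw [hnx (j+1) β, pow_succ]
          have := hc2 (j+1) (by omega)
          have := mul_pos (pow_pos h0 j) this
          nlinarith
      have h5 : ∀ j : ℕ, -(C * nn (rho cs w β)) * (τ * 3 ^ cs.length w) ^ j ≤ y (rho cs w β) := by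
        intro j
        refine le_trans ?_ (h4 j)
        have h6 : nn (rho cs (w ^ (j+1)) β) ≤ (3 ^ cs.length w) ^ j * nn (rho cs w β) := by
          clear h4
          induction j with
          | zero => simp
          | succ j ih =>
            rw [pow_succ', rho_mul]
            refine (nn_rho' cs w _).trans ?_
            rw [pow_succ' ((3:ℝ) ^ cs.length w), mul_assoc]
            gcongr
        have h7 := (abs_le.1 (hC (rho cs (w ^ (j+1)) β))).1
        have h8 : -(C * ((3 ^ cs.length w) ^ j * nn (rho cs w β))) ≤ y (rho cs (w ^ (j+1)) β) := by
          refine le_trans ?_ h7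
          have := mul_le_mul_of_nonneg_left h6 hC0
          linarith
        have := mul_le_mul_of_nonneg_left h8 (pow_pos h0 j).le
        rw [mul_pow]
        linarith
      have ht := (tendsto_pow_atTop_nhds_zero_of_lt_one (by positivity) hτ).const_mul (-(C * nn (rho cs w β)))
      rw [mul_zero] at ht
      have := le_of_tendsto ht (Eventually.of_forall h5)
      linarith
    classical
    refine ⟨Nat.find hex, ⟨hSm β hβ _, ?_, ?_⟩, ?_⟩
    · rcases Nat.eq_zero_or_pos (Nat.find hex) with h3 | h3
      · rw [h3]; simpa using hx0
      · have h4 := Nat.find_min hex (m := Nat.find hex - 1) (by omega)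
        rw [Nat.sub_add_cancel h3] at h4
        exact lt_of_le_of_ne (not_lt.1 h4) (hx _ (hSm β hβ _)).symm
    · rw [← rho_mul, ← pow_succ']
      exact Nat.find_spec hex
    · intro m hm1 hm2
      have := hneg (m-1) (by
        intro m' a b
        have h4 := Nat.find_min hex (m := m' - 1) (by omega)
        rw [Nat.sub_add_cancel a] at h4
        exact lt_of_le_of_ne (not_lt.1 h4) (hx _ (hSm β hβ _)).symm)
      rwa [Nat.sub_add_cancel hm1] at this
  choose! j hj1 hj2 using key
  refine Set.ncard_le_ncard_of_injOn (fun β => rho cs (w ^ (j β)) β) (fun β hβ => hj1 β hβ) ?_ hf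
  have aux : ∀ β ∈ CR cs w y S, ∀ β' ∈ CR cs w y S, j β ≤ j β' →
      rho cs (w ^ (j β)) β = rho cs (w ^ (j β')) β' → β = β' := by
    intro β hβ β' hβ' hle e
    have e2 : j β' = j β + (j β' - j β) := by omega
    rw [e2, pow_add, rho_mul] at e
    have e3 := rho_inj cs _ e
    rcases Nat.eq_zero_or_pos (j β' - j β) with h3 | h3
    · rw [h3] at e3; simpa using e3
    · have := hj2 β' hβ' (j β' - j β) h3 (by omega)
      rw [← e3] at this
      have := hβ.2.1
      linarith
  intro β hβ β' hβ' e
  rcases le_total (j β) (j β') with h | h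
  · exact aux β hβ β' hβ' h e
  · exact (aux β' hβ' β hβ h e.symm).symm

/-- `S` is a union of `w`-orbits of roots -/
def Stab (w : W) (S : Set (B →₀ ℝ)) : Prop := S ⊆ Rt cs ∧ ∀ β, β ∈ S ↔ rho cs w β ∈ S

lemma Stab.inv {w : W} {S : Set (B →₀ ℝ)} (h : Stab cs w S) : Stab cs w⁻¹ S :=
  ⟨h.1, fun β => by rw [h.2 (rho cs w⁻¹ β), rho_self_inv]⟩

lemma Stab.diff {w : W} {S : Set (B →₀ ℝ)} (h : Stab cs w S) : Stab cs w (Rt cs \ S) := by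
  refine ⟨Set.sdiff_subset, fun β => ?_⟩
  have h1 : β ∈ Rt cs ↔ rho cs w β ∈ Rt cs :=
    ⟨fun h => Rt.act cs h w, fun h => by
      have := Rt.act cs h w⁻¹
      rwa [rho_inv_self] at this⟩
  simp only [Set.mem_sdiff, h1, h.2 β]

lemma CR_flip {w : W} {S : Set (B →₀ ℝ)} (h : Stab cs w S) (x : Module.Dual ℝ (B →₀ ℝ)) :
    CR cs w⁻¹ (-x) S = rho cs w '' CR cs w x S := by
  ext β
  constructor
  · rintro ⟨h1, h2, h3⟩
    simp only [LinearMap.neg_apply] at h2 h3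
    refine ⟨rho cs w⁻¹ β, ⟨((Stab.inv cs h).2 β).1 h1, by linarith, ?_⟩, rho_self_inv cs w β⟩
    rw [rho_self_inv]; linarith
  · rintro ⟨γ, ⟨h1, h2, h3⟩, rfl⟩
    refine ⟨(h.2 γ).1 h1, by simpa using h3, by simpa [rho_inv_self] using h2⟩

lemma CR_flip_ncard {w : W} {S : Set (B →₀ ℝ)} (h : Stab cs w S) (x : Module.Dual ℝ (B →₀ ℝ)) :
    (CR cs w⁻¹ (-x) S).ncard = (CR cs w x S).ncard := by
  rw [CR_flip cs h, Set.ncard_image_of_injective _ (rho_inj cs w)]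

variable {cs}
variable {w : W} {τ : ℝ} {L : ℕ} {q : Bool → Module.End ℝ (B →₀ ℝ)}

variable (cs q) in
/-- genericity -/
def Gen (x : Module.Dual ℝ (B →₀ ℝ)) : Prop :=
  ∀ l : List Bool, ∀ β ∈ Rt cs, x ((l.map q).prod β) ≠ 0

lemma Gen.ne {x : Module.Dual ℝ (B →₀ ℝ)} (h : Gen cs q x) {β : B →₀ ℝ} (hβ : β ∈ Rt cs) : x β ≠ 0 := by
  simpa using h [] β hβ

lemma Gen.step {x : Module.Dual ℝ (B →₀ ℝ)} (h : Gen cs q x) (b : Bool) : Gen cs q (x ∘ₗ q b) := by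
  intro l β hβ
  simpa using h (b :: l) β hβ

variable (cs q) in
/-- good functional -/
def Good (D : Set W) (x : Module.Dual ℝ (B →₀ ℝ)) : Prop :=
  Gen cs q x ∧ XX cs x ∧ ∃ g ∈ D, OC cs x g

lemma FlowData.tw (fd : FlowData cs w τ L q) : τ * 3 ^ cs.length w < 1 := by
  refine lt_of_le_of_lt ?_ fd.hτ
  have := fd.h0
  have := fd.hw
  gcongr
  norm_num

lemma Good.step (fd : FlowData cs w τ L q) {D : Set W} (hD : DD cs w L D)
    {x : Module.Dual ℝ (B →₀ ℝ)} (h : Good cs q D x) (b : Bool) : Good cs q D (x ∘ₗ q b) := by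
  obtain ⟨hg, hx, g, hgD, hoc⟩ := h
  have key : ∀ u : W, DD cs u L D → cs.length u = cs.length w →
      (∀ v, (x ∘ₗ q b) v = x v + τ * (x ∘ₗ q b) (rho cs u v)) → Good cs q D (x ∘ₗ q b) := by
    intro u hu hl hxy
    have hXX : XX cs (x ∘ₗ q b) := XX.step cs hx u fd.h0 (by rw [hl]; exact fd.tw) hxy
    obtain ⟨h, hh⟩ := exists_CC cs hXX
    obtain ⟨g', hg', hcc⟩ := one_step cs hu fd.h0 fd.hτ hxy hgD (OC.cc cs hoc) hh
    refine ⟨hg.step b, hXX, g', hg', fun i => ?_⟩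
    exact lt_of_le_of_ne (hcc i) ((hg.step b).ne (rt_mk cs g' i)).symm
  cases b
  · refine key w⁻¹ (DD.inv cs hD) (cs.length_inv w) (fun v => ?_)
    simp only [LinearMap.comp_apply]
    conv_lhs => rw [fd.hq2 v]
    simp
  · refine key w hD rfl (fun v => ?_)
    simp only [LinearMap.comp_apply]
    conv_lhs => rw [fd.hq1 v]
    simp

lemma CR_subset {x : Module.Dual ℝ (B →₀ ℝ)} {S : Set (B →₀ ℝ)} (hS : S ⊆ Rt cs) :
    CR cs w x S ⊆ CR cs w x (Rt cs) := fun _ h => ⟨hS h.1, h.2⟩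

lemma vd_step (fd : FlowData cs w τ L q) {D : Set W}
    {x : Module.Dual ℝ (B →₀ ℝ)} (h : Good cs q D x) (b : Bool) {S : Set (B →₀ ℝ)} (hS : Stab cs w S) :
    (CR cs w (x ∘ₗ q b) S).ncard ≤ (CR cs w x S).ncard := by
  obtain ⟨hg, hx, g, hgD, hoc⟩ := h
  have hfin : (CR cs w x S).Finite := (CR_OC cs hoc w).1.subset (CR_subset hS.1)
  cases b
  · rw [← CR_flip_ncard cs hS x, ← CR_flip_ncard cs hS (x ∘ₗ q false)]
    refine vd cs (w := w⁻¹) fd.h0 (by rw [cs.length_inv]; exact fd.tw) (fun v => ?_)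
      (fun β hβ => ((Stab.inv cs hS).2 β).1 hβ) (fun β hβ => ?_) ?_
    · simp only [LinearMap.comp_apply, LinearMap.neg_apply]
      conv_lhs => rw [fd.hq2 v]
      simp; ring
    · simpa using hg.ne (hS.1 hβ)
    · rw [CR_flip cs hS]; exact hfin.image _
  · refine vd cs fd.h0 fd.tw (fun v => ?_) (fun β hβ => (hS.2 β).1 hβ) (fun β hβ => hg.ne (hS.1 hβ)) hfin
    simp only [LinearMap.comp_apply]
    conv_lhs => rw [fd.hq1 v]
    simp

lemma CR_split {x : Module.Dual ℝ (B →₀ ℝ)} {S : Set (B →₀ ℝ)} (hS : S ⊆ Rt cs)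
    (hf : (CR cs w x (Rt cs)).Finite) :
    (CR cs w x (Rt cs)).ncard = (CR cs w x S).ncard + (CR cs w x (Rt cs \ S)).ncard := by
  rw [← Set.ncard_union_eq ?_ (hf.subset (CR_subset hS)) (hf.subset (CR_subset Set.sdiff_subset))]
  · congr 1
    ext β
    constructor
    · rintro ⟨h1, h2⟩
      by_cases h : β ∈ S
      · exact Or.inl ⟨h, h2⟩
      · exact Or.inr ⟨⟨h1, h⟩, h2⟩
    · rintro (⟨h1, h2⟩ | ⟨h1, h2⟩)
      · exact ⟨hS h1, h2⟩
      · exact ⟨h1.1, h2⟩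
  · rw [Set.disjoint_left]
    rintro β ⟨h1, _⟩ ⟨h2, _⟩
    exact h2.2 h1

lemma eq_step (fd : FlowData cs w τ L q) {D : Set W} (hD : DD cs w L D) {n : ℕ}
    (hn : ∀ g ∈ D, cs.length (g⁻¹ * w * g) = n)
    {x : Module.Dual ℝ (B →₀ ℝ)} (h : Good cs q D x) (b : Bool) {S : Set (B →₀ ℝ)} (hS : Stab cs w S) :
    (CR cs w (x ∘ₗ q b) S).ncard = (CR cs w x S).ncard := by
  have h1 := vd_step fd h b hS
  have h2 := vd_step fd h b (Stab.diff cs hS)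
  obtain ⟨_, _, g', hgD', hoc'⟩ := h.step fd hD b
  obtain ⟨hg, hx, g, hgD, hoc⟩ := h
  obtain ⟨a1, a2⟩ := CR_OC cs hoc w
  obtain ⟨b1, b2⟩ := CR_OC cs hoc' w
  rw [hn g hgD, CR_split hS.1 a1] at a2
  rw [hn g' hgD', CR_split hS.1 b1] at b2
  omega

end PFsec
end CoxMin


namespace CoxMin
open CoxeterSystem
open Filter Topology
set_option linter.unusedSectionVars false

lemma int_ends (P : ℤ → Prop) (hf : {n | ¬ (P n ↔ P (n - 1))}.Finite) :
    ∃ M0 M1 : ℤ, (∀ n ≤ M0, (P n ↔ P M0)) ∧ (∀ n ≥ M1, (P n ↔ P M1)) := by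
  obtain ⟨U, hU⟩ := hf.bddAbove
  obtain ⟨V, hV⟩ := hf.bddBelow
  refine ⟨V - 1, U, fun n hn => ?_, fun n hn => ?_⟩
  · induction n, hn using Int.le_induction_down with
    | base => rfl
    | pred n hn ih =>
      rw [← ih]
      by_contra hcon
      have : n ∈ {n | ¬ (P n ↔ P (n - 1))} := fun h => hcon h.symm
      have := hV this
      omega
  · induction n, hn using Int.le_induction with
    | base => rfl
    | succ n hn ih =>
      rw [← ih]
      by_contra hcon
      have : n + 1 ∈ {n | ¬ (P n ↔ P (n - 1))} := by
        intro h
        apply hcon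
        rwa [add_sub_cancel_right] at h
      have := hU this
      omega

section PGsec
variable {B W : Type*} [Group W] {M : CoxeterMatrix B} (cs : CoxeterSystem M W) [Fintype B]

/-- orbit of `w` -/
def orb (w : W) (β : B →₀ ℝ) : Set (B →₀ ℝ) := Set.range (fun n : ℤ => rho cs (w ^ (-n)) β)

lemma orb_b (w : W) (β : B →₀ ℝ) (n : ℤ) :
    rho cs w (rho cs (w ^ (-n)) β) = rho cs (w ^ (-(n-1))) β := by
  rw [← rho_mul]; congr 2
  rw [← zpow_one_add]; congr 1; ring

lemma orb_self (w : W) (β : B →₀ ℝ) : β ∈ orb cs w β := ⟨0, by simp⟩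

lemma orb_stab (w : W) {β : B →₀ ℝ} (hβ : β ∈ Rt cs) : Stab cs w (orb cs w β) := by
  refine ⟨?_, fun γ => ⟨?_, ?_⟩⟩
  · rintro _ ⟨n, rfl⟩; exact Rt.act cs hβ _
  · rintro ⟨n, rfl⟩; exact ⟨n - 1, (orb_b cs w β n).symm⟩
  · rintro ⟨n, hn⟩
    refine ⟨n + 1, rho_inj cs w ?_⟩
    simp only at hn ⊢
    rw [orb_b, add_sub_cancel_right, hn]

lemma orb_eq {w : W} {β γ : B →₀ ℝ} (h : γ ∈ orb cs w β) : orb cs w γ = orb cs w β := by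
  obtain ⟨n, rfl⟩ := h
  ext δ
  constructor
  · rintro ⟨m, rfl⟩
    refine ⟨n + m, ?_⟩
    simp only [← rho_mul]; congr 2; rw [← zpow_add]; congr 1; ring
  · rintro ⟨m, rfl⟩
    refine ⟨m - n, ?_⟩
    simp only [← rho_mul]; congr 2; rw [← zpow_add]; congr 1; ring

lemma pos_ends (w : W) {β : B →₀ ℝ} (hβ : β ∈ Rt cs)
    (hinj : Function.Injective (fun n : ℤ => rho cs (w ^ (-n)) β)) :
    {n : ℤ | ¬ (Pos (rho cs (w ^ (-n)) β) ↔ Pos (rho cs (w ^ (-(n-1))) β))}.Finite := by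
  have hI := (inv_count cs _ w rfl).1
  have h1 := hI.preimage (f := fun n : ℤ => rho cs (w ^ (-n)) β) hinj.injOn
  have h2 := hI.preimage (f := fun n : ℤ => -rho cs (w ^ (-n)) β) (fun a _ b _ h => hinj (neg_injective h))
  refine (h1.union h2).subset ?_
  intro n hn
  have hr1 := Rt.act cs hβ (w ^ (-n))
  have hr2 := Rt.act cs hβ (w ^ (-(n-1)))
  rcases Rt.pos_or cs hr1 with a | a <;> rcases Rt.pos_or cs hr2 with b | b
  · exact absurd (iff_of_true a b) hn
  · left; exact ⟨hr1, a, by rw [orb_b]; exact b⟩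
  · right; exact ⟨Rt.neg cs hr1, a, by rw [map_neg, orb_b, neg_neg]; exact b⟩
  · refine absurd (iff_of_false ?_ ?_) hn
    · intro h; exact Rt.ne cs hr1 (h.antisymm a)
    · intro h; exact Rt.ne cs hr2 (h.antisymm b)

lemma x_ends (w : W) {β : B →₀ ℝ} (hβ : β ∈ Rt cs)
    (hinj : Function.Injective (fun n : ℤ => rho cs (w ^ (-n)) β))
    {P0 P1 : ℤ} (h0 : ∀ n ≤ P0, (Pos (rho cs (w ^ (-n)) β) ↔ Pos (rho cs (w ^ (-P0)) β)))
    (h1 : ∀ n ≥ P1, (Pos (rho cs (w ^ (-n)) β) ↔ Pos (rho cs (w ^ (-P1)) β)))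
    {x : Module.Dual ℝ (B →₀ ℝ)} (hx : XX cs x) :
    ∃ c : ℝ, 0 < c ∧ ∃ M0 M1 : ℤ,
      (∀ n < M0, (Pos (rho cs (w ^ (-P0)) β) → c ≤ x (rho cs (w ^ (-n)) β)) ∧
        (¬ Pos (rho cs (w ^ (-P0)) β) → x (rho cs (w ^ (-n)) β) ≤ -c)) ∧
      (∀ n > M1, (Pos (rho cs (w ^ (-P1)) β) → c ≤ x (rho cs (w ^ (-n)) β)) ∧
        (¬ Pos (rho cs (w ^ (-P1)) β) → x (rho cs (w ^ (-n)) β) ≤ -c)) := by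
  obtain ⟨c, hc, hx⟩ := hx
  rw [ev_PF] at hx
  have a1 := hx.preimage (f := fun n : ℤ => rho cs (w ^ (-n)) β) hinj.injOn
  have a2 := hx.preimage (f := fun n : ℤ => -rho cs (w ^ (-n)) β) (fun a _ b _ h => hinj (neg_injective h))
  have a3 := a1.union a2
  obtain ⟨U, hU⟩ := a3.bddAbove
  obtain ⟨V, hV⟩ := a3.bddBelow
  have key : ∀ n : ℤ, (n < V ∨ n > U) → (Pos (rho cs (w ^ (-n)) β) → c ≤ x (rho cs (w ^ (-n)) β)) ∧
        (¬ Pos (rho cs (w ^ (-n)) β) → x (rho cs (w ^ (-n)) β) ≤ -c) := by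
    intro n hn
    have hr := Rt.act cs hβ (w ^ (-n))
    have hone := Rt.one_le cs hr
    constructor
    · intro hp
      by_contra hcon
      have hmem : n ∈ (fun n : ℤ => rho cs (w ^ (-n)) β) ⁻¹' {β | β ∈ Rt cs ∧ Pos β ∧ ¬ c * nn β ≤ x β} :=
        ⟨hr, hp, fun h => hcon (by nlinarith)⟩
      have := hV (Or.inl hmem)
      have := hU (Or.inl hmem)
      omega
    · intro hp
      have hp' : Pos (-(rho cs (w ^ (-n)) β)) := (Rt.pos_or cs hr).resolve_left hp
      by_contra hcon
      have hmem : n ∈ (fun n : ℤ => - rho cs (w ^ (-n)) β) ⁻¹' {β | β ∈ Rt cs ∧ Pos β ∧ ¬ c * nn β ≤ x β} :=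
        ⟨Rt.neg cs hr, hp', fun h => hcon (by rw [nn_neg, map_neg] at h; nlinarith)⟩
      have := hV (Or.inr hmem)
      have := hU (Or.inr hmem)
      omega
  refine ⟨c, hc, min V P0, max U P1, fun n hn => ?_, fun n hn => ?_⟩
  · rw [← h0 n (by omega)]; exact key n (by omega)
  · rw [← h1 n (by omega)]; exact key n (by omega)

lemma nn_pow (w : W) (β : B →₀ ℝ) (n : ℤ) (j : ℕ) :
    nn (rho cs (w ^ (-(n - j))) β) ≤ nn (rho cs (w ^ (-n)) β) * (3 ^ cs.length w) ^ j := by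
  induction j with
  | zero => simp
  | succ j ih =>
    have e : n - ((j + 1 : ℕ) : ℤ) = n - j - 1 := by push_cast; ring
    rw [e, ← orb_b]
    refine (nn_rho' cs w _).trans ?_
    rw [pow_succ]
    have : (0:ℝ) ≤ 3 ^ cs.length w := by positivity
    nlinarith

lemma CR_orb_ncard (w : W) {β : B →₀ ℝ} 
    (hinj : Function.Injective (fun n : ℤ => rho cs (w ^ (-n)) β)) (x : Module.Dual ℝ (B →₀ ℝ)) :
    (CR cs w x (orb cs w β)).ncard =
      {n : ℤ | 0 < x (rho cs (w ^ (-n)) β) ∧ x (rho cs (w ^ (-(n-1))) β) < 0}.ncard := by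
  rw [← Set.ncard_image_of_injective _ hinj]
  congr 1
  ext γ
  constructor
  · rintro ⟨⟨n, rfl⟩, h2, h3⟩
    exact ⟨n, ⟨h2, by rw [← orb_b]; exact h3⟩, rfl⟩
  · rintro ⟨n, ⟨h2, h3⟩, rfl⟩
    exact ⟨⟨n, rfl⟩, h2, by simp only [orb_b]; exact h3⟩

variable {cs}
variable {w : W} {τ : ℝ} {L : ℕ} {q : Bool → Module.End ℝ (B →₀ ℝ)}

lemma inf_orbit (fd : FlowData cs w τ L q) (hτ1 : τ < 1) {β : B →₀ ℝ} (hβ : β ∈ Rt cs)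
    (hinj : Function.Injective (fun n : ℤ => rho cs (w ^ (-n)) β)) :
    ∃ e : ℕ, ∀ (D : Set W) (n : ℕ) (x : Module.Dual ℝ (B →₀ ℝ)), DD cs w L D →
      (∀ g ∈ D, cs.length (g⁻¹ * w * g) = n) → Good cs q D x →
      (CR cs w x (orb cs w β)).ncard = e := by
  obtain ⟨P0, P1, hP0, hP1⟩ := int_ends _ (pos_ends cs w hβ hinj)
  -- generic facts about a good functional
  have facts : ∀ (D : Set W) (n : ℕ) (x : Module.Dual ℝ (B →₀ ℝ)), DD cs w L D →
      (∀ g ∈ D, cs.length (g⁻¹ * w * g) = n) → Good cs q D x →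
      ∃ X : ℕ → Module.Dual ℝ (B →₀ ℝ), X 0 = x ∧ (∀ k, Good cs q D (X k)) ∧
        (∀ k, (CR cs w x (orb cs w β)).ncard = (CR cs w (X k) (orb cs w β)).ncard) ∧
        (∀ k (n : ℤ), X (k+1) (rho cs (w ^ (-n)) β) = X k (rho cs (w ^ (-n)) β) +
          τ * X (k+1) (rho cs (w ^ (-(n-1))) β)) ∧
        (∀ k (n : ℤ), ∃ C : ℝ, ∀ j : ℕ, |X k (rho cs (w ^ (-(n-j))) β)| ≤ C * (3 ^ cs.length w) ^ j) ∧
        (∀ k (n : ℤ), Tendsto (fun j : ℕ => τ ^ j * X k (rho cs (w ^ (-(n-j))) β)) atTop (𝓝 0)) := by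
    intro D n x hD hn hx
    let X : ℕ → Module.Dual ℝ (B →₀ ℝ) := fun k => (fun z => z ∘ₗ q true)^[k] x
    have hX : ∀ k, X (k+1) = X k ∘ₗ q true := fun k => Function.iterate_succ_apply' _ _ _
    have hG : ∀ k, Good cs q D (X k) := by
      intro k
      induction k with
      | zero => exact hx
      | succ k ih => rw [hX]; exact ih.step fd hD true
    have hb : ∀ k (n : ℤ), ∃ C : ℝ, ∀ j : ℕ, |X k (rho cs (w ^ (-(n-j))) β)| ≤ C * (3 ^ cs.length w) ^ j := by
      intro k n
      obtain ⟨C, hC0, hC⟩ := dual_bound (X k)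
      refine ⟨C * nn (rho cs (w ^ (-n)) β), fun j => (hC _).trans ?_⟩
      have := mul_le_mul_of_nonneg_left (nn_pow cs w β n j) hC0
      linarith
    refine ⟨X, rfl, hG, ?_, ?_, hb, ?_⟩
    · intro k
      induction k with
      | zero => rfl
      | succ k ih => rw [ih, hX, eq_step fd hD hn (hG k) true (orb_stab cs w hβ)]
    · intro k n
      rw [← orb_b, hX]
      simp only [LinearMap.comp_apply]
      conv_lhs => rw [fd.hq1]
      simp
    · intro k n
      obtain ⟨C, hC⟩ := hb k n
      have h0 := fd.h0
      apply squeeze_zero_norm (a := fun j : ℕ => C * (τ * 3 ^ cs.length w) ^ j)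
      · intro j
        rw [Real.norm_eq_abs, abs_mul, abs_of_pos (pow_pos h0 j), mul_pow]
        have := mul_le_mul_of_nonneg_left (hC j) (pow_pos h0 j).le
        linarith
      · have := (tendsto_pow_atTop_nhds_zero_of_lt_one (by positivity) fd.tw).const_mul C
        simpa using this
  have hR : (0:ℝ) ≤ 3 ^ cs.length w := by positivity
  by_cases hp0 : Pos (rho cs (w ^ (-P0)) β) <;> by_cases hp1 : Pos (rho cs (w ^ (-P1)) β)
  · refine ⟨0, fun D n x hD hn hx => ?_⟩
    obtain ⟨X, hX0, hG, hN, hrec, hb, ht⟩ := facts D n x hD hn hx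
    obtain ⟨c, hc, M0, M1, hM0, hM1⟩ := x_ends cs w hβ hinj hP0 hP1 hx.2.1
    obtain ⟨K, hK⟩ := seqP2 fd.h0 hτ1 (fun k n => X k (rho cs (w ^ (-n)) β)) hrec ht c hc
      (Finset.Icc M0 M1) (by
        intro n hn
        rw [Finset.mem_Icc, not_and_or] at hn
        rw [hX0]
        rcases hn with hn | hn
        · exact (hM0 n (by omega)).1 hp0
        · exact (hM1 n (by omega)).1 hp1)
    rw [hN (K+1), CR_orb_ncard cs w hinj]
    convert Set.ncard_empty ℤ
    ext n
    simp only [Set.mem_ofPred_eq, Set.mem_empty_iff_false, iff_false]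
    rintro ⟨_, h⟩
    have := hK K le_rfl (n-1)
    linarith
  · refine ⟨0, fun D n x hD hn hx => ?_⟩
    obtain ⟨X, hX0, hG, hN, hrec, hb, ht⟩ := facts D n x hD hn hx
    obtain ⟨c, hc, M0, M1, hM0, hM1⟩ := x_ends cs w hβ hinj hP0 hP1 hx.2.1
    obtain ⟨k, hk⟩ := seqP1 fd.h0 hτ1 hR fd.tw (fun k n => - X k (rho cs (w ^ (-n)) β))
      (fun k n => by rw [hrec k n]; ring) (by simpa using hb) c hc M0 M1
      (fun n hn => by rw [hX0]; have := (hM0 n hn).1 hp0; linarith)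
      (fun n hn => by rw [hX0]; have := (hM1 n hn).2 hp1; linarith)
    rw [hN k, CR_orb_ncard cs w hinj]
    convert Set.ncard_empty ℤ
    ext n
    simp only [Set.mem_ofPred_eq, Set.mem_empty_iff_false, iff_false]
    rintro ⟨h1, h2⟩
    have := hk (n-1) (by linarith)
    rw [sub_add_cancel] at this
    linarith
  · refine ⟨1, fun D n x hD hn hx => ?_⟩
    obtain ⟨X, hX0, hG, hN, hrec, hb, ht⟩ := facts D n x hD hn hx
    obtain ⟨c, hc, M0, M1, hM0, hM1⟩ := x_ends cs w hβ hinj hP0 hP1 hx.2.1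
    obtain ⟨k, hk⟩ := seqP1 fd.h0 hτ1 hR fd.tw (fun k n => X k (rho cs (w ^ (-n)) β))
      (fun k n => by rw [hrec k n]) hb c hc M0 M1
      (fun n hn => by rw [hX0]; exact (hM0 n hn).2 hp0)
      (fun n hn => by rw [hX0]; exact (hM1 n hn).1 hp1)
    rw [hN k, CR_orb_ncard cs w hinj, Set.ncard_eq_one]
    obtain ⟨c', hc', M0', M1', hM0', hM1'⟩ := x_ends cs w hβ hinj hP0 hP1 (hG k).2.1
    have hex : ∃ n : ℤ, 0 < X k (rho cs (w ^ (-n)) β) ∧ X k (rho cs (w ^ (-(n-1))) β) < 0 := by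
      by_contra hcon
      push Not at hcon
      have : ∀ n ≥ M0' - 1, X k (rho cs (w ^ (-n)) β) < 0 := by
        intro n hn
        induction n, hn using Int.le_induction with
        | base => have := (hM0' (M0'-1) (by omega)).2 hp0; linarith
        | succ n hn ih =>
          by_contra h3
          have h4 : 0 < X k (rho cs (w ^ (-(n+1))) β) :=
            lt_of_le_of_ne (not_lt.1 h3) ((hG k).1.ne (Rt.act cs hβ _)).symm
          have := hcon (n+1) h4
          rw [add_sub_cancel_right] at this
          linarith
      have h5 := this (max (M0' - 1) (M1' + 1)) (le_max_left _ _)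
      have h6 := (hM1' (max (M0' - 1) (M1' + 1)) (by omega)).1 hp1
      linarith
    have huniq : ∀ n m : ℤ, n < m → 0 < X k (rho cs (w ^ (-n)) β) → X k (rho cs (w ^ (-(m-1))) β) < 0 → False := by
      intro n m hnm h1 h2
      have : ∀ m ≥ n, 0 < X k (rho cs (w ^ (-m)) β) := by
        intro m hm
        induction m, hm using Int.le_induction with
        | base => exact h1
        | succ m hm ih => exact hk m ih.le
      have := this (m-1) (by omega)
      linarith
    obtain ⟨n, hn⟩ := hex
    refine ⟨n, ?_⟩
    ext m
    simp only [Set.mem_ofPred_eq, Set.mem_singleton_iff]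
    constructor
    · intro hm
      rcases lt_trichotomy n m with h | h | h
      · exact (huniq n m h hn.1 hm.2).elim
      · exact h.symm
      · exact (huniq m n h hm.1 hn.2).elim
    · rintro rfl; exact hn
  · refine ⟨0, fun D n x hD hn hx => ?_⟩
    obtain ⟨X, hX0, hG, hN, hrec, hb, ht⟩ := facts D n x hD hn hx
    obtain ⟨c, hc, M0, M1, hM0, hM1⟩ := x_ends cs w hβ hinj hP0 hP1 hx.2.1
    obtain ⟨K, hK⟩ := seqP2 fd.h0 hτ1 (fun k n => - X k (rho cs (w ^ (-n)) β))
      (fun k n => by rw [hrec k n]; ring)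
      (fun k n => by have := (ht k n).neg; simpa using this) c hc
      (Finset.Icc M0 M1) (by
        intro n hn
        rw [Finset.mem_Icc, not_and_or] at hn
        rw [hX0]
        rcases hn with hn | hn
        · have := (hM0 n (by omega)).2 hp0; linarith
        · have := (hM1 n (by omega)).2 hp1; linarith)
    rw [hN (K+1), CR_orb_ncard cs w hinj]
    convert Set.ncard_empty ℤ
    ext n
    simp only [Set.mem_ofPred_eq, Set.mem_empty_iff_false, iff_false]
    rintro ⟨h, _⟩
    have := hK K le_rfl n
    linarith

end PGsec
end CoxMin


namespace CoxMin
open CoxeterSystem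
open Filter Topology
set_option linter.unusedSectionVars false

section PHsec
variable {B W : Type*} [Group W] {M : CoxeterMatrix B} {cs : CoxeterSystem M W} [Fintype B]
variable {w : W} {τ : ℝ} {L : ℕ} {q : Bool → Module.End ℝ (B →₀ ℝ)}

lemma orb_finite {β : B →₀ ℝ}
    (hinj : ¬ Function.Injective (fun n : ℤ => rho cs (w ^ (-n)) β)) : (orb cs w β).Finite := by
  have hex : ∃ d : ℤ, 0 < d ∧ rho cs (w ^ d) β = β := by
    simp only [Function.Injective] at hinj
    push Not at hinj
    obtain ⟨a, b, hab, hne⟩ := hinj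
    have key : ∀ a b : ℤ, rho cs (w ^ (-a)) β = rho cs (w ^ (-b)) β → rho cs (w ^ (b - a)) β = β := by
      intro a b h
      have := congrArg (rho cs (w ^ b)) h
      rw [← rho_mul, ← rho_mul, ← zpow_add, ← zpow_add] at this
      simpa [sub_eq_add_neg] using this
    rcases lt_or_gt_of_ne hne with h | h
    · exact ⟨b - a, by omega, key a b hab⟩
    · exact ⟨a - b, by omega, key b a hab.symm⟩
  obtain ⟨d, hd, hfix⟩ := hex
  have hfix' : ∀ k : ℕ, rho cs (w ^ (d * k)) β = β := by
    intro k
    induction k with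
    | zero => simp
    | succ k ih =>
      have : d * ((k + 1 : ℕ) : ℤ) = d * k + d := by push_cast; ring
      rw [this, zpow_add, rho_mul, hfix, ih]
  have hfix2 : ∀ k : ℤ, rho cs (w ^ (d * k)) β = β := by
    intro k
    obtain ⟨m, rfl | rfl⟩ := k.eq_nat_or_neg
    · exact hfix' m
    · have := congrArg (rho cs (w ^ (d * -(m:ℤ)))) (hfix' m)
      rw [← rho_mul, ← zpow_add] at this
      rw [← this]; simp
  refine ((Set.finite_Ico (0:ℤ) d).image (fun n => rho cs (w ^ n) β)).subset ?_
  rintro _ ⟨n, rfl⟩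
  refine ⟨(-n) % d, ⟨Int.emod_nonneg _ hd.ne', Int.emod_lt_of_pos _ hd⟩, ?_⟩
  simp only
  conv_rhs => rw [← Int.emod_add_mul_ediv (-n) d, zpow_add, rho_mul, hfix2]

lemma fin_orbit (fd : FlowData cs w τ L q) (hτ1 : τ < 1) {β : B →₀ ℝ} (hβ : β ∈ Rt cs)
    (hinj : ¬ Function.Injective (fun n : ℤ => rho cs (w ^ (-n)) β)) :
    ∃ Z : Set (B →₀ ℝ), Z.Countable ∧ ∀ (D D' : Set W) (n n' : ℕ) (x x' : Module.Dual ℝ (B →₀ ℝ)),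
      DD cs w L D → DD cs w L D' →
      (∀ g ∈ D, cs.length (g⁻¹ * w * g) = n) → (∀ g ∈ D', cs.length (g⁻¹ * w * g) = n') →
      Good cs q D x → Good cs q D' x' →
      (∀ z ∈ Z, z ≠ 0 → x z ≠ 0) → (∀ z ∈ Z, z ≠ 0 → x' z ≠ 0) →
      (CR cs w x (orb cs w β)).ncard = (CR cs w x' (orb cs w β)).ncard := by
  classical
  have hfin := orb_finite hinj
  have hst := orb_stab cs w hβ
  have hst' := hst.inv
  have : Fintype (orb cs w β) := hfin.fintype
  let σ : Equiv.Perm (orb cs w β) :=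
    { toFun := fun o => ⟨rho cs w o, (hst.2 _).1 o.2⟩
      invFun := fun o => ⟨rho cs w⁻¹ o, (hst'.2 _).1 o.2⟩
      left_inv := fun o => Subtype.ext (rho_inv_self cs w _)
      right_inv := fun o => Subtype.ext (rho_self_inv cs w _) }
  have hσ1 : ∀ o, ((σ o : orb cs w β) : B →₀ ℝ) = rho cs w o := fun o => rfl
  have hσ2 : ∀ o, ((σ.symm o : orb cs w β) : B →₀ ℝ) = rho cs w⁻¹ o := fun o => rfl
  have hσz : ∀ (n : ℕ) o, (((σ ^ n) o : orb cs w β) : B →₀ ℝ) = rho cs (w ^ n) o := by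
    intro n o
    induction n with
    | zero => simp
    | succ n ih => rw [pow_succ', Equiv.Perm.mul_apply, hσ1, ih, ← rho_mul, ← pow_succ']
  have hσz' : ∀ (n : ℕ) o, (((σ⁻¹ ^ n) o : orb cs w β) : B →₀ ℝ) = rho cs (w⁻¹ ^ n) o := by
    intro n o
    induction n with
    | zero => simp
    | succ n ih =>
      rw [pow_succ', Equiv.Perm.mul_apply]
      have := hσ2 ((σ⁻¹ ^ n) o)
      rw [ih, ← rho_mul, ← pow_succ'] at this
      exact this
  have htr : ∀ a b, ∃ n : ℕ, (σ ^ n) a = b := by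
    intro a b
    have hb : (b : B →₀ ℝ) ∈ orb cs w a := by rw [orb_eq cs a.2]; exact b.2
    obtain ⟨n, hn⟩ := hb
    have : ∃ n : ℤ, (σ ^ n) a = b := by
      refine ⟨-n, Subtype.ext ?_⟩
      rw [← hn]
      obtain ⟨m, hm | hm⟩ := (-n).eq_nat_or_neg
      · simp only [hm, zpow_natCast]; exact hσz m a
      · simp only [hm, zpow_neg, zpow_natCast, ← inv_pow]; exact hσz' m a
    obtain ⟨n, hn⟩ := this
    have h2 : σ ^ n ∈ Submonoid.powers σ := mem_powers_iff_mem_zpowers.2 ⟨n, rfl⟩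
    obtain ⟨m, hm⟩ := h2
    exact ⟨m, by simp only at hm; rw [hm]; exact hn⟩
  obtain ⟨e, μ, sd⟩ := exists_specData σ
  refine ⟨Set.range (fun i => ∑ p, e i p • (p : B →₀ ℝ)), (Set.finite_range _).countable, ?_⟩
  -- facts
  have facts : ∀ (D : Set W) (n : ℕ) (x : Module.Dual ℝ (B →₀ ℝ)), DD cs w L D →
      (∀ g ∈ D, cs.length (g⁻¹ * w * g) = n) → Good cs q D x →
      ∃ X : ℕ → Module.Dual ℝ (B →₀ ℝ), X 0 = x ∧ (∀ k, Good cs q D (X k)) ∧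
        (∀ k, (CR cs w x (orb cs w β)).ncard = (CR cs w (X k) (orb cs w β)).ncard) ∧
        (∀ k v, X k v = (1 + τ ^ 2) * X (k+1) v - τ * (X (k+1) (rho cs w v) + X (k+1) (rho cs w⁻¹ v))) := by
    intro D n x hD hn hx
    let X : ℕ → Module.Dual ℝ (B →₀ ℝ) := fun k => (fun z => (z ∘ₗ q true) ∘ₗ q false)^[k] x
    have hX : ∀ k, X (k+1) = (X k ∘ₗ q true) ∘ₗ q false := fun k => Function.iterate_succ_apply' _ _ _
    have hG : ∀ k, Good cs q D (X k) := by
      intro k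
      induction k with
      | zero => exact hx
      | succ k ih => rw [hX]; exact (ih.step fd hD true).step fd hD false
    refine ⟨X, rfl, hG, ?_, ?_⟩
    · intro k
      induction k with
      | zero => rfl
      | succ k ih =>
        rw [ih, hX, eq_step fd hD hn ((hG k).step fd hD true) false hst, eq_step fd hD hn (hG k) true hst]
    · intro k v
      have e1 : ∀ v, (X k ∘ₗ q true) v = X k v + τ * (X k ∘ₗ q true) (rho cs w v) := by
        intro v
        conv_lhs => rw [LinearMap.comp_apply, fd.hq1]
        simp
      have e2 : ∀ v, X (k+1) v = (X k ∘ₗ q true) v + τ * X (k+1) (rho cs w⁻¹ v) := by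
        intro v
        rw [hX]
        conv_lhs => rw [LinearMap.comp_apply, fd.hq2]
        simp
      have a1 := e1 v
      have a2 := e2 v
      have a3 := e2 (rho cs w v)
      rw [rho_inv_self] at a3
      linear_combination a1 - a1 - a1 - a2 + τ * a3 
  have hup : ∀ z : Module.Dual ℝ (B →₀ ℝ), (CR cs w z (orb cs w β)).ncard = up σ (fun o => z o) := by
    intro z
    rw [up, ← Set.ncard_coe_finset, ← Set.ncard_image_of_injective _ Subtype.val_injective]
    congr 1
    ext γ
    simp only [CR, Set.mem_image, Finset.coe_filter, Finset.mem_univ, true_and, Set.mem_ofPred_eq]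
    constructor
    · rintro ⟨h1, h2, h3⟩; exact ⟨⟨γ, h1⟩, ⟨h2, h3⟩, rfl⟩
    · rintro ⟨o, ⟨h2, h3⟩, rfl⟩; exact ⟨o.2, h2, h3⟩
  intro D D' n n' x x' hD hD' hn hn' hx hx' hz hz'
  obtain ⟨X, hX0, hG, hN, hrec⟩ := facts D n x hD hn hx
  obtain ⟨X', hX0', hG', hN', hrec'⟩ := facts D' n' x' hD' hn' hx'
  have hsum : ∀ (z : Module.Dual ℝ (B →₀ ℝ)) i, ∑ p, e i p * z p = z (∑ p, e i p • (p : B →₀ ℝ)) := by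
    intro z i; simp
  obtain ⟨k, hk⟩ := finOrbit sd htr fd.h0 hτ1 (fun k (o : orb cs w β) => X k o) (fun k (o : orb cs w β) => X' k o)
    (fun k o => hrec k o) (fun k o => hrec' k o) (by
      intro i
      simp only [hsum, hX0, hX0']
      by_cases h : (∑ p, e i p • (p : B →₀ ℝ)) = 0
      · simp only [h, map_zero]
      · exact iff_of_false (hz _ ⟨i, rfl⟩ h) (hz' _ ⟨i, rfl⟩ h))
    (fun k o => (hG k).1.ne (hst.1 o.2)) (fun k o => (hG' k).1.ne (hst.1 o.2))
  rw [hN k, hN' k, hup, hup]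
  exact hk

lemma any_orbit (fd : FlowData cs w τ L q) (hτ1 : τ < 1) {β : B →₀ ℝ} (hβ : β ∈ Rt cs) :
    ∃ Z : Set (B →₀ ℝ), Z.Countable ∧ ∀ (D D' : Set W) (n n' : ℕ) (x x' : Module.Dual ℝ (B →₀ ℝ)),
      DD cs w L D → DD cs w L D' →
      (∀ g ∈ D, cs.length (g⁻¹ * w * g) = n) → (∀ g ∈ D', cs.length (g⁻¹ * w * g) = n') →
      Good cs q D x → Good cs q D' x' →
      (∀ z ∈ Z, z ≠ 0 → x z ≠ 0) → (∀ z ∈ Z, z ≠ 0 → x' z ≠ 0) →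
      (CR cs w x (orb cs w β)).ncard = (CR cs w x' (orb cs w β)).ncard := by
  by_cases hinj : Function.Injective (fun n : ℤ => rho cs (w ^ (-n)) β)
  · obtain ⟨e, he⟩ := inf_orbit fd hτ1 hβ hinj
    refine ⟨∅, Set.countable_empty, fun D D' n n' x x' hD hD' hn hn' hx hx' _ _ => ?_⟩
    rw [he D n x hD hn hx, he D' n' x' hD' hn' hx']
  · exact fin_orbit fd hτ1 hβ hinj

lemma sum_orbits {x x' : Module.Dual ℝ (B →₀ ℝ)} (hf : (CR cs w x (Rt cs)).Finite)
    (hf' : (CR cs w x' (Rt cs)).Finite)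
    (h : ∀ β ∈ Rt cs, (CR cs w x (orb cs w β)).ncard = (CR cs w x' (orb cs w β)).ncard) :
    (CR cs w x (Rt cs)).ncard = (CR cs w x' (Rt cs)).ncard := by
  classical
  have fib : ∀ (z : Module.Dual ℝ (B →₀ ℝ)) (hz : (CR cs w z (Rt cs)).Finite), ∀ β ∈ Rt cs,
      (hz.toFinset.filter (fun γ => orb cs w γ = orb cs w β)).card = (CR cs w z (orb cs w β)).ncard := by
    intro z hz β hβ
    rw [← Set.ncard_coe_finset]
    congr 1
    ext γ
    simp only [Finset.coe_filter, Set.Finite.mem_toFinset, Set.mem_ofPred_eq]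
    constructor
    · rintro ⟨h1, h2⟩; exact ⟨h2 ▸ orb_self cs w γ, h1.2⟩
    · intro h1; exact ⟨CR_subset (orb_stab cs w hβ).1 h1, orb_eq cs h1.1⟩
  let T := (hf.toFinset ∪ hf'.toFinset).image (orb cs w)
  rw [Set.ncard_eq_toFinset_card _ hf, Set.ncard_eq_toFinset_card _ hf',
    Finset.card_eq_sum_card_fiberwise (f := orb cs w) (t := T)
      (fun γ hγ => by simp only [T, Finset.coe_image]; exact ⟨γ, by simp at hγ; simp [hγ], rfl⟩),
    Finset.card_eq_sum_card_fiberwise (f := orb cs w) (t := T)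
      (fun γ hγ => by simp only [T, Finset.coe_image]; exact ⟨γ, by simp at hγ; simp [hγ], rfl⟩)]
  refine Finset.sum_congr rfl fun S hS => ?_
  obtain ⟨β, hβ, rfl⟩ := Finset.mem_image.1 hS
  have hβR : β ∈ Rt cs := by
    rcases Finset.mem_union.1 hβ with h | h
    · exact ((Set.Finite.mem_toFinset _).1 h).1
    · exact ((Set.Finite.mem_toFinset _).1 h).1
  rw [fib x hf β hβR, fib x' hf' β hβR, h β hβR]

end PHsec
end CoxMin


namespace CoxMin
open CoxeterSystem
open Filter Topology
set_option linter.unusedSectionVars false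

lemma exists_generic {B : Type*} [Fintype B] {Z : Set (B →₀ ℝ)} (hZ : Z.Countable) :
    ∃ a : B → ℝ, (∀ i, 0 < a i) ∧ ∀ v ∈ Z, v ≠ 0 → ∑ i, v i * a i ≠ 0 := by
  classical
  let f := Fintype.equivFin B
  let p : (B →₀ ℝ) → Polynomial ℝ := fun v => ∑ i, Polynomial.monomial (f i : ℕ) (v i)
  have hp : ∀ v, v ≠ 0 → p v ≠ 0 := by
    intro v hv h
    apply hv
    ext i
    have := congrArg (fun r => Polynomial.coeff r (f i : ℕ)) h
    simp only [p, Polynomial.finsetSum_coeff, Polynomial.coeff_monomial, Polynomial.coeff_zero] at this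
    rw [Finset.sum_eq_single i] at this
    · simpa using this
    · intro j _ hj
      rw [if_neg]
      intro h; exact hj (f.injective (Fin.ext h))
    · simp
  have hev : ∀ v t, (p v).eval t = ∑ i, v i * t ^ (f i : ℕ) := by
    intro v t; simp [p, Polynomial.eval_finsetSum]
  have hc : (⋃ v ∈ Z \ {0}, {t | (p v).IsRoot t}).Countable := by
    refine Set.Countable.biUnion (hZ.mono Set.sdiff_subset) fun v hv => ?_
    exact (Polynomial.finite_setOfPred_isRoot (hp v (by simpa using hv.2))).countable
  have : ¬ (Set.Ioi (0:ℝ) ⊆ ⋃ v ∈ Z \ {0}, {t | (p v).IsRoot t}) := by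
    intro h
    have h2 := hc.mono h
    have := Cardinal.mk_Ioi_real 0
    rw [← Set.countable_coe_iff, ← Cardinal.mk_le_aleph0_iff, this] at h2
    exact absurd h2 (not_le.2 Cardinal.aleph0_lt_continuum)
  obtain ⟨t, ht, hn⟩ := Set.not_subset.1 this
  refine ⟨fun i => t ^ (f i : ℕ), fun i => pow_pos ht _, fun v hv hv0 h => hn ?_⟩
  simp only [Set.mem_iUnion]
  exact ⟨v, ⟨hv, by simpa using hv0⟩, by rw [Set.mem_ofPred_eq, Polynomial.IsRoot, hev]; exact h⟩

section PIsec
variable {B W : Type*} [Group W] {M : CoxeterMatrix B} (cs : CoxeterSystem M W) [Fintype B]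

lemma exists_generic_OC {Z : Set (B →₀ ℝ)} (hZ : Z.Countable) (g : W) :
    ∃ x : Module.Dual ℝ (B →₀ ℝ), OC cs x g ∧ ∀ v ∈ Z, v ≠ 0 → x v ≠ 0 := by
  obtain ⟨a, ha, ha2⟩ := exists_generic (hZ.image (rho cs g⁻¹))
  refine ⟨(Finsupp.linearCombination ℝ a) ∘ₗ rho cs g⁻¹, fun i => ?_, fun v hv hv0 => ?_⟩
  · rw [LinearMap.comp_apply, rho_inv_self, al]
    simpa using ha i
  · have := ha2 _ ⟨v, hv, rfl⟩ (fun h => hv0 (rho_inj cs g⁻¹ (by rw [h, map_zero])))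
    rw [LinearMap.comp_apply, Finsupp.linearCombination_apply, Finsupp.sum_fintype _ _ (by simp)]
    simpa using this

lemma W_countable {B W : Type*} [Group W] {M : CoxeterMatrix B} (cs : CoxeterSystem M W) [Fintype B] :
    Countable W := by
  have : Function.Surjective cs.wordProd := cs.wordProd_surjective
  exact this.countable

lemma Rt_countable : (Rt cs).Countable := by
  have := W_countable cs
  have : Rt cs = Set.range (fun p : W × B => rho cs p.1 (al p.2)) := by
    ext β
    constructor
    · rintro ⟨w, i, rfl⟩; exact ⟨(w, i), rfl⟩
    · rintro ⟨p, rfl⟩; exact ⟨p.1, p.2, rfl⟩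
  rw [this]
  exact Set.countable_range _

/-- two good sets have the same conjugate length -/
lemma same_length {w : W} {L n n' : ℕ} {D D' : Set W} (hw : cs.length w ≤ L)
    (hD : DD cs w L D) (hD' : DD cs w L D')
    (hn : ∀ g ∈ D, cs.length (g⁻¹ * w * g) = n) (hn' : ∀ g ∈ D', cs.length (g⁻¹ * w * g) = n')
    (hne : D.Nonempty) (hne' : D'.Nonempty) : n = n' := by
  obtain ⟨τ, q, fd, hτ1⟩ := exists_flowData cs w L hw
  choose Z hZc hZ using fun β : Rt cs => any_orbit fd hτ1 β.2
  have := (Rt_countable cs).to_subtype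
  let Z1 : Set (B →₀ ℝ) := ⋃ β, Z β
  let Z2 : Set (B →₀ ℝ) := Set.range (fun p : List Bool × Rt cs => (p.1.map q).prod p.2)
  have hc : (Z1 ∪ Z2).Countable := (Set.countable_iUnion hZc).union (Set.countable_range _)
  have hqinj : ∀ l : List Bool, Function.Injective (l.map q).prod := by
    intro l
    induction l with
    | nil => intro a b h; simpa using h
    | cons b l ih => simpa [Module.End.mul_eq_comp] using (fd.inj b).comp ih
  have good : ∀ D : Set W, D.Nonempty → ∃ x, Good cs q D x ∧ (∀ z ∈ Z1, z ≠ 0 → x z ≠ 0) ∧ ∃ g ∈ D, OC cs x g := by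
    rintro D ⟨g, hg⟩
    obtain ⟨x, hx, hx2⟩ := exists_generic_OC cs hc g
    refine ⟨x, ⟨?_, OC.XX cs hx, g, hg, hx⟩, fun z hz => hx2 z (Or.inl hz), g, hg, hx⟩
    intro l β hβ
    refine hx2 _ (Or.inr ⟨(l, ⟨β, hβ⟩), rfl⟩) ?_
    intro h
    exact Rt.ne cs hβ (hqinj l (by rw [h, map_zero]))
  obtain ⟨x, hx, hxz, g, hg, hoc⟩ := good D hne
  obtain ⟨x', hx', hxz', g', hg', hoc'⟩ := good D' hne'
  have h1 := CR_OC cs hoc w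
  have h2 := CR_OC cs hoc' w
  rw [hn g hg] at h1
  rw [hn' g' hg'] at h2
  rw [← h1.2, ← h2.2]
  refine sum_orbits h1.1 h2.1 fun β hβ => ?_
  exact hZ ⟨β, hβ⟩ D D' n n' x x' hD hD' hn hn' hx hx'
    (fun z hz => hxz z (Set.mem_iUnion.2 ⟨_, hz⟩)) (fun z hz => hxz' z (Set.mem_iUnion.2 ⟨_, hz⟩))

end PIsec
end CoxMin


namespace CoxMin
open CoxeterSystem
set_option linter.unusedSectionVars false

section PJsec
variable {B W : Type*} [Group W] {M : CoxeterMatrix B} (cs : CoxeterSystem M W)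

/-- Bruhat-minimality in the conjugacy orbit under `P` -/
def Bm (P : Subgroup W) (v : W) : Prop :=
  ∀ ω, CoxeterSystem.IsReduced cs ω → cs.wordProd ω = v → ∀ ω' : List B, ω'.Sublist ω →
    (∃ g ∈ P, cs.wordProd ω' = g * v * g⁻¹) → cs.wordProd ω' = v

lemma Bm_of_one {P : Subgroup W} {ω : List B} (hω : CoxeterSystem.IsReduced cs ω)
    (h : ∀ ω' : List B, ω'.Sublist ω →
    (∃ g ∈ P, cs.wordProd ω' = g * cs.wordProd ω * g⁻¹) → cs.wordProd ω' = cs.wordProd ω) :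
    Bm cs P (cs.wordProd ω) := by
  intro ω1 h1 e ω' hs hc
  obtain ⟨ω'', hs', e'⟩ := sub_indep cs h1 hω e hs
  rw [← e'] at hc ⊢
  exact h ω'' hs' hc

lemma Bm_of_min {P : Subgroup W} {v : W} (h : ∀ g ∈ P, cs.length v ≤ cs.length (g * v * g⁻¹)) :
    Bm cs P v := by
  rintro ω h1 rfl ω' hs ⟨g, hg, e⟩
  have h2 := h g hg
  rw [← e] at h2
  have h3 := cs.length_wordProd_le ω'
  have h4 : cs.length (cs.wordProd ω) = ω.length := h1
  rw [hs.eq_of_length_le (by omega)]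

lemma Bm_inv {v : W} {P : Subgroup W} (h : Bm cs P v) : Bm cs P v⁻¹ := by
  intro ω h1 e ω' hs ⟨g, hg, hc⟩
  have := h ω.reverse ((cs.isReduced_reverse_iff ω).2 h1) (by rw [wordProd_reverse, e, inv_inv]) ω'.reverse
    (List.reverse_sublist.2 hs) ⟨g, hg, by rw [wordProd_reverse, hc]; group⟩
  rw [wordProd_reverse] at this
  rw [← this, inv_inv]

lemma Bm_step1 {c : W} {i : B} (h : Bm cs ⊤ c) (hi : cs.length (c * cs.simple i) + 1 = cs.length c) :
    cs.length (cs.simple i * c * cs.simple i) = cs.length c ∧ Bm cs ⊤ (cs.simple i * c * cs.simple i) := by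
  obtain ⟨ω, hω, he⟩ := cs.exists_isReduced (c * cs.simple i)
  have hc : c = cs.wordProd (ω ++ [i]) := by
    rw [wordProd_append, ← he]; simp
  have hωl : ω.length + 1 = cs.length c := by rw [← hi, he]; rw [show cs.length (cs.wordProd ω) = ω.length from hω]
  have hred : CoxeterSystem.IsReduced cs (ω ++ [i]) := by
    show cs.length _ = _
    rw [← hc]; simp [hωl]
  have hd : cs.simple i * c * cs.simple i = cs.wordProd (i :: ω) := by
    rw [wordProd_cons, ← he, mul_assoc]
  rcases cs.length_simple_mul (c * cs.simple i) i with h1 | h1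
  · have hl : cs.length (cs.simple i * c * cs.simple i) = cs.length c := by rw [mul_assoc]; omega
    refine ⟨hl, ?_⟩
    have hred2 : CoxeterSystem.IsReduced cs (i :: ω) := by
      show cs.length _ = _
      rw [← hd, hl]; simp [hωl]
    rw [hd]
    refine Bm_of_one cs hred2 fun ω' hs hg => ?_
    rw [← hd] at hg ⊢
    obtain ⟨g, -, hg⟩ := hg
    cases hs with
    | cons _ hs =>
      exfalso
      have := h _ hred hc.symm ω' (hs.trans (List.sublist_append_left _ _)) ⟨g * cs.simple i, trivial, by
        rw [hg]; simp [mul_assoc]⟩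
      have h5 := cs.length_wordProd_le ω'
      have := hs.length_le
      rw [‹cs.wordProd ω' = c›] at h5
      omega
    | cons_cons _ hs =>
      rename_i l
      rw [wordProd_cons] at hg ⊢
      have := h _ hred hc.symm (l ++ [i]) (hs.append (List.Sublist.refl _)) ⟨cs.simple i * g * cs.simple i, trivial, by
        have e2 : cs.wordProd l = cs.simple i * (g * (cs.simple i * c * cs.simple i) * g⁻¹) := by
          rw [← hg]; simp
        rw [wordProd_append, e2]; simp [mul_assoc]⟩
      rw [← this]
      simp [wordProd_append, mul_assoc]
  · exfalso
    obtain ⟨φ, hφ, he'⟩ := cs.exists_isReduced (cs.simple i * (c * cs.simple i))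
    have hφl : φ.length + 2 = cs.length c := by
      have : cs.length (cs.wordProd φ) = φ.length := hφ
      rw [← he'] at this; omega
    have hc2 : c = cs.wordProd (i :: (φ ++ [i])) := by
      rw [wordProd_cons, wordProd_append, ← he']; simp [mul_assoc]
    have hred2 : CoxeterSystem.IsReduced cs (i :: (φ ++ [i])) := by
      show cs.length _ = _
      rw [← hc2]; simp; omega
    have := h _ hred2 hc2.symm φ ((List.sublist_append_left _ _).cons _) ⟨cs.simple i, trivial, by
      rw [← he']; simp [mul_assoc]⟩
    rw [← he'] at this
    rw [this] at h1
    omega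

lemma Bm_step {c : W} {i : B} (h : Bm cs ⊤ c) :
    (cs.length (c * cs.simple i) = cs.length c + 1 ∧ cs.length (c⁻¹ * cs.simple i) = cs.length c⁻¹ + 1) ∨
    (cs.length (cs.simple i * c * cs.simple i) = cs.length c ∧ Bm cs ⊤ (cs.simple i * c * cs.simple i)) := by
  rcases cs.length_mul_simple c i with h1 | h1
  · rcases cs.length_mul_simple c⁻¹ i with h2 | h2
    · exact Or.inl ⟨h1, h2⟩
    · right
      have := Bm_step1 cs (Bm_inv cs h) h2
      have e : cs.simple i * c * cs.simple i = (cs.simple i * c⁻¹ * cs.simple i)⁻¹ := by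
        simp [mul_assoc]
      rw [e]
      refine ⟨by rw [length_inv, this.1, length_inv], Bm_inv cs this.2⟩
  · exact Or.inr (Bm_step1 cs h h1)

lemma DD_Bm [Fintype B] (w : W) (L n : ℕ) (hn : n ≤ L) :
    DD cs w L {g | cs.length (g⁻¹ * w * g) = n ∧ Bm cs ⊤ (g⁻¹ * w * g)} := by
  rintro g ⟨h1, h2⟩
  refine ⟨by omega, fun i hi => ?_⟩
  have e : cs.simple i * (g⁻¹ * w * g) * cs.simple i = (g * cs.simple i)⁻¹ * w * (g * cs.simple i) := by
    simp [mul_assoc]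
  have e2 : (g⁻¹ * w * g)⁻¹ = g⁻¹ * w⁻¹ * g := by group
  rcases Bm_step cs (i := i) h2 with h | h
  · rw [pos_iff, pos_iff, ← e2]; exact h
  · exfalso; apply hi
    rw [e, h1] at h; exact h

theorem abs_thm [Fintype B] {v : W} (h : Bm cs ⊤ v) (g : W) : cs.length v ≤ cs.length (g * v * g⁻¹) := by
  classical
  have hex : ∃ n, ∃ g : W, cs.length (g⁻¹ * v * g) = n := ⟨_, 1, rfl⟩
  obtain ⟨g0, hg0⟩ := Nat.find_spec hex
  have hm : ∀ g : W, Nat.find hex ≤ cs.length (g⁻¹ * v * g) := fun g => Nat.find_min' hex ⟨g, rfl⟩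
  generalize Nat.find hex = m at *
  have hmv : m ≤ cs.length v := by simpa using hm 1
  have := same_length cs (w := v) (L := cs.length v) le_rfl (DD_Bm cs v _ (cs.length v) le_rfl) (DD_Bm cs v _ m hmv)
    (fun g hg => hg.1) (fun g hg => hg.1) ⟨1, by simpa using h⟩ ⟨g0, hg0, Bm_of_min cs (fun k _ => by
      rw [hg0]
      have := hm (g0 * k⁻¹)
      simpa [mul_assoc] using this)⟩
  rw [this]
  simpa using hm g⁻¹

end PJsec
end CoxMin


namespace CoxMin
open CoxeterSystem
set_option linter.unusedSectionVars false

section PKsec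
variable {B W : Type*} [Group W] {M : CoxeterMatrix B} (cs : CoxeterSystem M W)

open Classical in
/-- Extended Coxeter matrix: one new node, commuting with `J` and free from the others. -/
noncomputable def MX (M : CoxeterMatrix B) (J : Set B) : CoxeterMatrix (Option B) where
  M := fun a b => match a, b with
    | some i, some j => M i j
    | none, none => 1
    | none, some j => if j ∈ J then 2 else 0
    | some j, none => if j ∈ J then 2 else 0
  isSymm := by
    ext a b
    rcases a with _ | a <;> rcases b with _ | b
    · rfl
    · rfl
    · rfl
    · exact M.symmetric b a
  diagonal := by
    intro a
    rcases a with _ | a <;> simp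
  off_diagonal := by
    intro a b h
    rcases a with _ | a <;> rcases b with _ | b
    · exact absurd rfl h
    · simp only; split_ifs <;> simp
    · simp only; split_ifs <;> simp
    · exact M.off_diagonal a b (fun e => h (by rw [e]))

variable {J : Set B} {W' : Type*} [Group W'] (cs' : CoxeterSystem (MX M J) W')

lemma MX_some (i j : B) : MX M J (some i) (some j) = M i j := rfl

lemma MX_none : MX M J none none = 1 := rfl

open Classical in
lemma MX_J {j : B} (h : j ∈ J) : MX M J none (some j) = 2 := by
  show (if j ∈ J then 2 else 0) = 2
  rw [if_pos h]

open Classical in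
lemma MX_nJ {j : B} (h : j ∉ J) : MX M J none (some j) = 0 := by
  show (if j ∈ J then 2 else 0) = 0
  rw [if_neg h]

lemma liftX {G : Type*} [Group G] (φ : W →* G) (a : G) (ha : a * a = 1)
    (hc : ∀ j ∈ J, a * φ (cs.simple j) = φ (cs.simple j) * a) :
    ∃ F : W' →* G, (∀ i, F (cs'.simple (some i)) = φ (cs.simple i)) ∧ F (cs'.simple none) = a := by
  have hl : (MX M J).IsLiftable (fun o : Option B => o.elim a (fun i => φ (cs.simple i))) := by
    have key : ∀ j, (a * φ (cs.simple j)) ^ MX M J none (some j) = 1 := by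
      intro j
      by_cases hj : j ∈ J
      · rw [MX_J hj, (show Commute a (φ (cs.simple j)) from hc j hj).mul_pow, sq, ha, ← map_pow]
        simp
      · rw [MX_nJ hj, pow_zero]
    rintro (_ | i) (_ | j)
    · simp [MX_none, ha]
    · exact key j
    · have h1 := key i
      have h2 := (MX M J).symmetric none (some i)
      rw [← h2]
      show (φ (cs.simple i) * a) ^ (MX M J none (some i)) = 1
      have h3 : a⁻¹ * (a * φ (cs.simple i)) ^ MX M J none (some i) * a = a⁻¹ * 1 * a := by rw [h1]
      have h4 : φ (cs.simple i) * a = a⁻¹ * (a * φ (cs.simple i)) * a := by group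
      have h5 : ∀ (x : G) (n : ℕ), (a⁻¹ * x * a) ^ n = a⁻¹ * x ^ n * a := by
        intro x n
        have := conj_pow (i := n) (a := a⁻¹) (b := x)
        simpa using this
      rw [h4, h5, h3]; group
    · simp only [Option.elim, MX_some]
      rw [← map_mul, ← map_pow, cs.simple_mul_simple_pow, map_one]
  refine ⟨cs'.lift ⟨_, hl⟩, fun i => ?_, ?_⟩
  · rw [cs'.lift_apply_simple hl]; rfl
  · rw [cs'.lift_apply_simple hl]; rfl

lemma exists_Psi : ∃ Ψ : W →* W', ∀ i, Ψ (cs.simple i) = cs'.simple (some i) := by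
  have hl : M.IsLiftable (fun i => cs'.simple (some i)) := fun i j => cs'.simple_mul_simple_pow (some i) (some j)
  exact ⟨cs.lift ⟨_, hl⟩, fun i => cs.lift_apply_simple hl i⟩

/-- permutation action of `W` on finitely supported functions on the coset space -/
noncomputable def alp (P : Subgroup W) : W →* Equiv.Perm ((W ⧸ P) →₀ ZMod 2) where
  toFun g :=
    { toFun := fun f => f.mapDomain (g • ·)
      invFun := fun f => f.mapDomain (g⁻¹ • ·)
      left_inv := fun f => by
        show (f.mapDomain _).mapDomain _ = f
        rw [← Finsupp.mapDomain_comp]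
        convert Finsupp.mapDomain_id
        ext x; simp
      right_inv := fun f => by
        show (f.mapDomain _).mapDomain _ = f
        rw [← Finsupp.mapDomain_comp]
        convert Finsupp.mapDomain_id
        ext x; simp }
  map_one' := by
    ext1 f
    show f.mapDomain _ = f
    convert Finsupp.mapDomain_id
    simp
  map_mul' g h := by
    ext1 f
    show f.mapDomain _ = (f.mapDomain _).mapDomain _
    rw [← Finsupp.mapDomain_comp]
    congr 1
    ext x; simp [mul_smul]

lemma alp_apply (P : Subgroup W) (g : W) (f : (W ⧸ P) →₀ ZMod 2) :
    alp P g f = f.mapDomain (g • ·) := rfl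

lemma conjX {Ψ : W →* W'} (hΨ : ∀ i, Ψ (cs.simple i) = cs'.simple (some i)) {u v : W} {z : W'}
    (h : z * (Ψ u * cs'.simple none) = Ψ v * cs'.simple none * z) :
    ∃ p ∈ Subgroup.closure (cs.simple '' J), v = p * u * p⁻¹ := by
  set P := Subgroup.closure (cs.simple '' J) with hP
  obtain ⟨π, hπ1, hπ2⟩ := liftX cs cs' (MonoidHom.id W) 1 (by simp) (by simp)
  let e : (W ⧸ P) →₀ ZMod 2 := Finsupp.single (QuotientGroup.mk 1) 1
  have hee : e + e = 0 := by
    rw [← Finsupp.single_add]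
    have : (1 + 1 : ZMod 2) = 0 := by decide
    rw [this, Finsupp.single_zero]
  have hje : ∀ j ∈ J, alp P (cs.simple j) e = e := by
    intro j hj
    rw [alp_apply, Finsupp.mapDomain_single]
    congr 1
    show (QuotientGroup.mk (cs.simple j * 1) : W ⧸ P) = _
    rw [QuotientGroup.eq]
    have : cs.simple j ∈ P := Subgroup.subset_closure ⟨j, hj, rfl⟩
    simpa using this
  have halp : ∀ g f f', alp P g (f + f') = alp P g f + alp P g f' := by
    intro g f f'; simp only [alp_apply]; exact Finsupp.mapDomain_add
  have halp0 : ∀ g, alp P g 0 = 0 := by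
    intro g; simp only [alp_apply]; exact Finsupp.mapDomain_zero
  obtain ⟨θ, hθ1, hθ2⟩ := liftX cs cs' (alp P) (Equiv.addRight e) (by
      ext1 f; simp [add_assoc, hee]) (by
      intro j hj
      ext1 f
      simp only [Equiv.Perm.mul_apply, Equiv.coe_addRight]
      rw [halp, hje j hj])
  have haff : ∀ z f, θ z f = alp P (π z) f + θ z 0 := by
    intro z
    induction z using cs'.simple_induction with
    | simple i =>
      intro f
      rcases i with _ | i
      · rw [hθ2, hπ2]; simp
      · rw [hθ1, hπ1]; simp [halp0]
    | one => intro f; simp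
    | mul z1 z2 h1 h2 =>
      intro f
      rw [map_mul, map_mul, map_mul, Equiv.Perm.mul_apply, Equiv.Perm.mul_apply, Equiv.Perm.mul_apply,
        h2 f, h1 (_ + _), halp, h1 (θ z2 0), add_assoc]
  have hπΨ : ∀ g, π (Ψ g) = g := by
    have : π.comp Ψ = MonoidHom.id W := cs.ext_simple (fun i => by simp [hΨ, hπ1])
    intro g; exact DFunLike.congr_fun this g
  have hθΨ : ∀ g, θ (Ψ g) = alp P g := by
    have : θ.comp Ψ = alp P := cs.ext_simple (fun i => by simp [hΨ, hθ1])
    intro g; exact DFunLike.congr_fun this g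
  have hh : π z * u = v * π z := by
    have := congrArg π h
    simpa [hπΨ, hπ2] using this
  have hc := congrArg (fun y => θ y 0) h
  simp only [map_mul, Equiv.Perm.mul_apply, hθΨ, hθ2, Equiv.coe_addRight, zero_add] at hc
  rw [haff z, ← Equiv.Perm.mul_apply, ← map_mul, hh, halp] at hc
  -- push forward to the quotient by the group generated by `v`
  let ψ : W ⧸ P → MulAction.orbitRel.Quotient (Subgroup.zpowers v) (W ⧸ P) := Quotient.mk _
  have hψ : ∀ x : W ⧸ P, ψ (v • x) = ψ x := by
    intro x
    apply Quotient.sound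
    exact ⟨⟨v, Subgroup.mem_zpowers v⟩, rfl⟩
  have hpush : ∀ f : (W ⧸ P) →₀ ZMod 2, (alp P v f).mapDomain ψ = f.mapDomain ψ := by
    intro f
    rw [alp_apply, ← Finsupp.mapDomain_comp]
    congr 1
    ext x; exact hψ x
  have hc2 := congrArg (Finsupp.mapDomain ψ) hc
  rw [Finsupp.mapDomain_add, Finsupp.mapDomain_add, hpush, hpush, map_mul, Equiv.Perm.mul_apply, hpush,
    add_comm, add_left_cancel_iff, alp_apply, Finsupp.mapDomain_single, Finsupp.mapDomain_single,
    Finsupp.mapDomain_single] at hc2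
  have hq : ψ (π z • (QuotientGroup.mk 1 : W ⧸ P)) = ψ (QuotientGroup.mk 1) :=
    Finsupp.single_left_injective (by decide : (1 : ZMod 2) ≠ 0) hc2
  obtain ⟨⟨_, n, rfl⟩, hn⟩ := Quotient.exact hq
  have hn' : (QuotientGroup.mk (v ^ n * 1) : W ⧸ P) = QuotientGroup.mk (π z * 1) := hn
  rw [QuotientGroup.eq, mul_one, mul_one] at hn'
  refine ⟨_, hn', ?_⟩
  have e1 : (v ^ n)⁻¹ * π z * u = (v ^ n)⁻¹ * (v * π z) := by rw [mul_assoc, hh]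
  rw [e1]
  have e2 : (v ^ n)⁻¹ * v = v * (v ^ n)⁻¹ := by
    rw [← zpow_neg, ← zpow_add_one, ← zpow_one_add, add_comm]
  rw [← mul_assoc, e2]
  group

lemma none_coord {Ψ : W →* W'} (hΨ : ∀ i, Ψ (cs.simple i) = cs'.simple (some i)) (v : W) :
    ∀ x : Option B →₀ ℝ, rho cs' (Ψ v) x none = x none := by
  induction v using cs.simple_induction with
  | simple i => intro x; rw [hΨ, rho_simple, sg_coord (by simp)]
  | one => intro x; simp
  | mul a b ha hb => intro x; rw [map_mul, rho_mul, ha, hb]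

lemma length_X {Ψ : W →* W'} (hΨ : ∀ i, Ψ (cs.simple i) = cs'.simple (some i)) (v : W) :
    cs'.length (Ψ v * cs'.simple none) = cs.length v + 1 := by
  have h1 := embed_length cs cs' some (Option.some_injective _) (fun i j => MX_some i j) Ψ hΨ _ v rfl
  rw [← h1, ← pos_iff]
  refine (Rt.pos_or cs' (rt_mk cs' (Ψ v) none)).resolve_right fun h => ?_
  have := h none
  rw [Finsupp.neg_apply, none_coord cs cs' hΨ] at this
  simp [al] at this
  linarith

lemma Psi_word {Ψ : W →* W'} (hΨ : ∀ i, Ψ (cs.simple i) = cs'.simple (some i)) (l : List B) :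
    cs'.wordProd (l.map some) = Ψ (cs.wordProd l) := by
  induction l with
  | nil => simp
  | cons i l ih => rw [List.map_cons, wordProd_cons, wordProd_cons, map_mul, ih, hΨ]

theorem step1 [Fintype B] {v : W} (h : Bm cs (Subgroup.closure (cs.simple '' J)) v) {q : W}
    (hq : q ∈ Subgroup.closure (cs.simple '' J)) : cs.length v ≤ cs.length (q * v * q⁻¹) := by
  let cs' := (MX M J).toCoxeterSystem
  obtain ⟨Ψ, hΨ⟩ := exists_Psi cs cs'
  obtain ⟨ω, hω, rfl⟩ := cs.exists_isReduced v
  have hpr : cs'.wordProd (ω.map some ++ [none]) = Ψ (cs.wordProd ω) * cs'.simple none := by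
    rw [wordProd_append, Psi_word cs cs' hΨ]; simp
  have hred : CoxeterSystem.IsReduced cs' (ω.map some ++ [none]) := by
    show cs'.length _ = _
    rw [hpr, length_X cs cs' hΨ, show cs.length (cs.wordProd ω) = ω.length from hω]; simp
  obtain ⟨ε, hε1, hε2⟩ := liftX (G := Multiplicative (ZMod 2)) cs cs' 1 (Multiplicative.ofAdd 1) (by decide) (by simp)
  have hεΨ : ∀ g, ε (Ψ g) = 1 := by
    have : ε.comp Ψ = 1 := cs.ext_simple (fun i => by simp [hΨ, hε1])
    intro g; exact DFunLike.congr_fun this g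
  have hB : Bm cs' ⊤ (cs'.wordProd (ω.map some ++ [none])) := by
    refine Bm_of_one cs' hred ?_
    rintro ω' hs ⟨z, -, hz⟩
    obtain ⟨l1, l2, rfl, h1, h2⟩ := List.sublist_append_iff.1 hs
    obtain ⟨l, hl, rfl⟩ := List.sublist_map_iff.1 h1
    rw [hpr] at hz ⊢
    rw [wordProd_append, Psi_word cs cs' hΨ] at hz ⊢
    have hl2 : l2 = [] ∨ l2 = [none] := by
      cases h2 with
      | cons _ h => left; exact List.sublist_nil.1 h
      | cons_cons _ h => right; rw [List.sublist_nil.1 h]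
    rcases hl2 with rfl | rfl
    · exfalso
      have := congrArg ε hz
      simp [hεΨ, hε2] at this
      exact absurd this (by decide)
    · rw [wordProd_singleton] at hz ⊢
      obtain ⟨p, hp, hpe⟩ := conjX cs cs' hΨ (u := cs.wordProd l) (v := cs.wordProd ω) (z := z⁻¹) (by
        rw [hz]; group)
      rw [h ω hω rfl l hl ⟨p⁻¹, inv_mem hp, by rw [hpe]; group⟩]
  have hcomm : Ψ q * cs'.simple none = cs'.simple none * Ψ q := by
    induction hq using Subgroup.closure_induction with
    | mem x hx =>
      obtain ⟨j, hj, rfl⟩ := hx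
      have h1 := cs'.simple_mul_simple_pow none (some j)
      rw [MX_J hj, sq] at h1
      rw [hΨ]
      have h2 := eq_inv_of_mul_eq_one_left h1
      rw [h2]; simp
    | one => simp
    | mul x y _ _ hx hy => rw [map_mul, mul_assoc, hy, ← mul_assoc, hx, mul_assoc]
    | inv x _ hx =>
      rw [map_inv]
      exact (show Commute (Ψ x) (cs'.simple none) from hx).inv_left
  have e : Ψ q * (Ψ (cs.wordProd ω) * cs'.simple none) * (Ψ q)⁻¹
      = Ψ (q * cs.wordProd ω * q⁻¹) * cs'.simple none := by
    have h2 : (Ψ q)⁻¹ * cs'.simple none = cs'.simple none * (Ψ q)⁻¹ :=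
      (show Commute (Ψ q) (cs'.simple none) from hcomm).inv_left
    rw [map_mul, map_mul, map_inv, mul_assoc _ (Ψ q)⁻¹, h2]
    group
  have := abs_thm cs' hB (Ψ q)
  rw [hpr, e, length_X cs cs' hΨ, length_X cs cs' hΨ] at this
  omega

end PKsec
end CoxMin


namespace CoxMin
open CoxeterSystem
set_option linter.unusedSectionVars false

section PLsec
variable {B W : Type*} [Group W] {M : CoxeterMatrix B} (cs : CoxeterSystem M W)

/-- restriction of a Coxeter matrix -/
def MR (M : CoxeterMatrix B) (I : Set B) : CoxeterMatrix I where
  M := fun a b => M a b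
  isSymm := by
    ext a b
    exact M.symmetric b a
  diagonal := fun a => M.diagonal a
  off_diagonal := fun a b h => M.off_diagonal a b (fun e => h (Subtype.ext e))

lemma closure_word {J : Set B} {q : W} (hq : q ∈ Subgroup.closure (cs.simple '' J)) :
    ∃ l : List B, (∀ i ∈ l, i ∈ J) ∧ cs.wordProd l = q := by
  induction hq using Subgroup.closure_induction with
  | mem x hx =>
    obtain ⟨j, hj, rfl⟩ := hx
    exact ⟨[j], by simpa using hj, by simp⟩
  | one => exact ⟨[], by simp, by simp⟩
  | mul x y _ _ hx hy =>
    obtain ⟨l, h1, rfl⟩ := hx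
    obtain ⟨l', h2, rfl⟩ := hy
    refine ⟨l ++ l', ?_, wordProd_append _ _ _⟩
    intro i hi
    rcases List.mem_append.1 hi with h | h
    · exact h1 i h
    · exact h2 i h
  | inv x _ hx =>
    obtain ⟨l, h1, rfl⟩ := hx
    exact ⟨l.reverse, by simpa using h1, wordProd_reverse _ _⟩

lemma word_closure {J : Set B} {l : List B} (h : ∀ i ∈ l, i ∈ J) :
    cs.wordProd l ∈ Subgroup.closure (cs.simple '' J) := by
  induction l with
  | nil => simp [one_mem]
  | cons i l ih =>
    rw [wordProd_cons]
    exact mul_mem (Subgroup.subset_closure ⟨i, h i (by simp), rfl⟩) (ih (fun j hj => h j (by simp [hj])))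

theorem step2 {J : Set B} {v : W} (h : Bm cs (Subgroup.closure (cs.simple '' J)) v) {q : W}
    (hq : q ∈ Subgroup.closure (cs.simple '' J)) : cs.length v ≤ cs.length (q * v * q⁻¹) := by
  obtain ⟨ω, hω, rfl⟩ := cs.exists_isReduced v
  obtain ⟨l, hl, rfl⟩ := closure_word cs hq
  obtain ⟨I, hI, hIω, hIl⟩ : ∃ I : Set B, I.Finite ∧ (∀ i ∈ ω, i ∈ I) ∧ ∀ i ∈ l, i ∈ I :=
    ⟨{i | i ∈ ω} ∪ {i | i ∈ l}, (List.finite_toSet ω).union (List.finite_toSet l),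
      fun i hi => Or.inl hi, fun i hi => Or.inr hi⟩
  have : Fintype I := hI.fintype
  obtain ⟨ω0, hω0⟩ : ∃ ω0 : List I, ω0.map Subtype.val = ω :=
    ⟨ω.attachWith (· ∈ I) hIω, List.attachWith_map_subtype_val _⟩
  obtain ⟨l0, hl0⟩ : ∃ l0 : List I, l0.map Subtype.val = l :=
    ⟨l.attachWith (· ∈ I) hIl, List.attachWith_map_subtype_val _⟩
  let cI := (MR M I).toCoxeterSystem
  have hlf : (MR M I).IsLiftable (fun i => cs.simple i.1) := fun i j => cs.simple_mul_simple_pow i.1 j.1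
  obtain ⟨Φ, hΦ⟩ : ∃ Φ : (MR M I).Group →* W, ∀ i : I, Φ (cI.simple i) = cs.simple i.1 :=
    ⟨cI.lift ⟨_, hlf⟩, fun i => cI.lift_apply_simple hlf i⟩
  have hword : ∀ m : List I, Φ (cI.wordProd m) = cs.wordProd (m.map Subtype.val) := by
    intro m
    induction m with
    | nil => simp
    | cons i m ih => rw [List.map_cons, wordProd_cons, wordProd_cons, map_mul, ih, hΦ]
  have hlen : ∀ x, cs.length (Φ x) = cI.length x := fun x =>
    embed_length cI cs Subtype.val Subtype.val_injective (fun i j => rfl) Φ hΦ _ x rfl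
  have hinj : Function.Injective Φ := by
    rw [injective_iff_map_eq_one]
    intro x hx
    have := hlen x
    rw [hx, length_one] at this
    exact cI.length_eq_zero_iff.1 this.symm
  subst hω0
  subst hl0
  rw [← hword, ← hword, ← map_inv, ← map_mul, ← map_mul, hlen, hlen]
  refine step1 (J := Subtype.val ⁻¹' J) cI ?_ (word_closure cI (fun i hi => hl i.1 (List.mem_map_of_mem hi)))
  have hred : CoxeterSystem.IsReduced cI ω0 := by
    show cI.length _ = _
    rw [← hlen, hword, show cs.length (cs.wordProd (ω0.map Subtype.val)) = _ from hω, List.length_map]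
  refine Bm_of_one cI hred ?_
  rintro ω' hs ⟨g, hg, he⟩
  obtain ⟨m, hm, rfl⟩ := closure_word cI hg
  apply hinj
  rw [hword, hword]
  refine h _ hω rfl _ (hs.map _) ⟨Φ (cI.wordProd m), ?_, ?_⟩
  · rw [hword]
    refine word_closure cs ?_
    intro i hi
    obtain ⟨j, hj, rfl⟩ := List.mem_map.1 hi
    exact hm j hj
  · rw [← hword, ← hword, he]; simp

end PLsec
end CoxMin

/-- Let `W_J` be a standard parabolic subgroup (for a finite `J`) acting on the
Coxeter group by conjugation, `O` a `W_J`-conjugacy orbit and `v ∈ O`. Then `v` is minimal in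
`O` for the (restricted) Bruhat order if and only if `v` has minimal length in `O`. -/
theorem statement11 {B W : Type*} [Group W] {M : CoxeterMatrix B} (cs : CoxeterSystem M W)
    (J : Set B) (hJ : J.Finite) (w v : W)
    (hv : ∃ p ∈ cs.parab J, v = p * w * p⁻¹) :
    (∀ u : W, (∃ p ∈ cs.parab J, u = p * w * p⁻¹) → cs.bruhatLE u v → u = v) ↔
      (∀ u : W, (∃ p ∈ cs.parab J, u = p * w * p⁻¹) → cs.length v ≤ cs.length u) := by
  have hcl : cs.parab J = Subgroup.closure (cs.simple '' J) := rfl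
  obtain ⟨p0, hp0, hpv⟩ := hv
  have horb : ∀ u : W, (∃ p ∈ cs.parab J, u = p * w * p⁻¹) ↔ ∃ p ∈ cs.parab J, u = p * v * p⁻¹ := by
    intro u
    constructor
    · rintro ⟨p, hp, rfl⟩
      exact ⟨p * p0⁻¹, mul_mem hp (inv_mem hp0), by rw [hpv]; group⟩
    · rintro ⟨p, hp, rfl⟩
      exact ⟨p * p0, mul_mem hp hp0, by rw [hpv]; group⟩
  simp only [horb]
  constructor
  · rintro h u ⟨p, hp, rfl⟩
    refine CoxMin.step2 cs (J := J) ?_ hp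
    intro ω hω he ω' hs hg
    refine h _ hg ⟨ω, he, ?_, ω', hs, rfl⟩
    rw [← he]
    exact Eq.symm hω
  · rintro h u hu ⟨ω, he, hl, ω', hs, rfl⟩
    have hB : CoxMin.Bm cs (cs.parab J) v := CoxMin.Bm_of_min cs (fun g hg => h _ ⟨g, hg, rfl⟩)
    refine hB ω ?_ he ω' hs hu
    show cs.length (cs.wordProd ω) = ω.length
    rw [he, hl]
end

section
/- Let W̃ = W ⋉ Y be the extended affine Weyl group of a reduced irreducible root system, and for w ∈ W̃^S (minimal length in wW) of the form x ε^{−λ} with λ dominant and x ∈ W^{I(λ)}, define I(S, x ε^{−λ}) = max{K ⊆ S : conjugation by x ε^{−λ} permutes {s_i : i ∈ K}}. Then I(S, x ε^{−λ}) = I(I(λ), x), the maximal subset K of I(λ) = {i : ⟨λ, α_i⟩ = 0} such that conjugation by x permutes {s_i : i ∈ K}. -/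
open scoped Classical

/-- A datum packaging a reduced crystallographic root system, its Weyl group `W`,
a choice of positive roots, simple roots indexed by `S`, simple reflections, and
the Coxeter length function (characterized by counting inversions). -/
structure WeylDatum (S V W : Type*) [Fintype S] [AddCommGroup V] [Module ℝ V] [Group W] where
  /-- the action of `W` on the ambient space of the roots -/
  act : W →* V ≃ₗ[ℝ] V
  /-- the simple roots -/
  simple : S → V
  /-- the simple coroots, viewed as linear functionals -/
  coroot : S → Module.Dual ℝ V
  /-- the simple reflections -/
  refl : S → W
  /-- the positive roots -/
  pos : Set V
  /-- the set of all roots -/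
  roots : Set V
  /-- the length function of `W` -/
  len : W → ℕ
  pos_subset : pos ⊆ roots
  roots_eq : roots = pos ∪ ((fun a => -a) '' pos)
  pos_neg_disj : ∀ a ∈ pos, -a ∉ pos
  reduced : ∀ a ∈ roots, (2 : ℝ) • a ∉ roots
  simple_mem_pos : ∀ i, simple i ∈ pos
  coroot_self : ∀ i, coroot i (simple i) = 2
  act_refl : ∀ i x, act (refl i) x = x - coroot i x • simple i
  act_roots : ∀ w, ∀ a ∈ roots, act w a ∈ roots
  gen : Subgroup.closure (Set.range refl) = ⊤
  pos_finite : pos.Finite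
  crys : ∀ a ∈ pos, ∃ c : S → ℕ, a = ∑ i, (c i : ℝ) • simple i
  len_eq : ∀ w, len w = Nat.card {a : V // a ∈ pos ∧ act w a ∉ pos}

namespace WeylDatum

variable {S V W : Type*} [Fintype S] [AddCommGroup V] [Module ℝ V] [Group W]
variable (d : WeylDatum S V W)

/-- The action of `W` on coweights (linear functionals): `(w • χ) α = χ (w⁻¹ α)`. -/
def dualAct (w : W) (χ : Module.Dual ℝ V) : Module.Dual ℝ V :=
  χ ∘ₗ (d.act w⁻¹).toLinearMap

/-- A coweight is dominant if it pairs nonnegatively with every simple root. -/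
def Dominant (χ : Module.Dual ℝ V) : Prop := ∀ i, 0 ≤ χ (d.simple i)

/-- `I(χ) = {i ∈ S : ⟨χ, αᵢ⟩ = 0}`. -/
def ISet (χ : Module.Dual ℝ V) : Set S := {i | χ (d.simple i) = 0}

/-- The standard parabolic subgroup `W_K` generated by the simple reflections in `K`. -/
def parab (K : Set S) : Subgroup W := Subgroup.closure (d.refl '' K)

/-- `w` is of minimal length in the coset `w W_K`; i.e. `w ∈ W^K`. -/
def IsMinCoset (w : W) (K : Set S) : Prop := ∀ u ∈ d.parab K, d.len w ≤ d.len (w * u)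

end WeylDatum

namespace WeylDatum

variable {S V W : Type*} [Fintype S] [AddCommGroup V] [Module ℝ V] [Group W]
variable (d : WeylDatum S V W)

/-- Elements of the extended affine Weyl group `W̃ = W ⋉ Y` are written as pairs
`(w, χ)`, standing for `w ε^χ`, where `χ` is a coweight (linear functional). -/
abbrev Aff (d : WeylDatum S V W) := W × Module.Dual ℝ V

/-- Multiplication in `W̃ = W ⋉ Y`: `(w ε^χ)(w' ε^{χ'}) = (w w') ε^{w'⁻¹ χ + χ'}`. -/
def mulA (a b : d.Aff) : d.Aff :=
  (a.1 * b.1, d.dualAct b.1⁻¹ a.2 + b.2)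

/-- The simple reflection `s_i` of the finite Weyl group, viewed inside `W̃`. -/
def srefl (i : S) : d.Aff := (d.refl i, 0)

/-- The length function on `W̃`:
`ℓ(w ε^χ) = Σ_{α∈Φ⁺, wα∈Φ⁺} |⟨χ, α⟩| + Σ_{α∈Φ⁺, wα∈Φ⁻} |⟨χ, α⟩ + 1|`. -/
noncomputable def lenA (a : d.Aff) : ℝ :=
  ∑ α ∈ d.pos_finite.toFinset,
    if d.act a.1 α ∈ d.pos then |a.2 α| else |a.2 α + 1|

/-- Conjugation of an element of `W̃` by an element `u` of the finite Weyl group `W`. -/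
def conjA (u : W) (a : d.Aff) : d.Aff := d.mulA (d.mulA ((u : W), 0) a) ((u⁻¹ : W), 0)

end WeylDatum

namespace WeylDatum

variable {S V W : Type*} [Fintype S] [AddCommGroup V] [Module ℝ V] [Group W]
variable (d : WeylDatum S V W)

/-- `I(S, g)` for `g ∈ W̃`: the maximal subset `K ⊆ S` such that conjugation by `g`
permutes the simple reflections `{s_i : i ∈ K}` (realized as the union of all such `K`). -/
def ISetAff (g : d.Aff) : Set S :=
  ⋃₀ {K : Set S | ∀ i ∈ K, ∃ j ∈ K, d.mulA g (d.srefl i) = d.mulA (d.srefl j) g}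

/-- `I(J, x)` for `x ∈ W`: the maximal subset `K ⊆ J` such that conjugation by `x`
permutes the simple reflections `{s_i : i ∈ K}` (realized as the union of all such `K`). -/
def ISetFin (J : Set S) (x : W) : Set S :=
  ⋃₀ {K : Set S | K ⊆ J ∧ ∀ i ∈ K, ∃ j ∈ K, x * d.refl i = d.refl j * x}

end WeylDatum

/-- The intertwining relation in `W ⋉ Y` splits into the finite one and `i ∈ I(λ)`. -/
theorem intertwine_iff {S V W : Type*} [Fintype S] [AddCommGroup V] [Module ℝ V] [Group W]
    (d : WeylDatum S V W) (lam : Module.Dual ℝ V) (x : W) (i j : S) :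
    d.mulA (d.mulA ((x : W), 0) (1, -lam)) (d.srefl i)
        = d.mulA (d.srefl j) (d.mulA ((x : W), 0) (1, -lam)) ↔
      i ∈ d.ISet lam ∧ x * d.refl i = d.refl j * x := by
  have key : lam ∘ₗ (d.act (d.refl i)).toLinearMap = lam ↔ lam (d.simple i) = 0 := by
    constructor
    · intro h
      have h1 := LinearMap.congr_fun h (d.simple i)
      simp [d.act_refl, d.coroot_self] at h1
      exact h1
    · intro h
      ext v
      simp [d.act_refl, h]
  simp only [WeylDatum.mulA, WeylDatum.srefl, WeylDatum.dualAct, WeylDatum.ISet,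
    Set.mem_setOf_eq, Prod.mk.injEq, mul_one, inv_inv, LinearMap.zero_comp, zero_add, add_zero,
    LinearMap.neg_comp, neg_inj, key]
  exact and_comm

/-- For `λ` dominant and `x ∈ W^{I(λ)}`, one has
`I(S, x ε^{−λ}) = I(I(λ), x)`. -/
theorem statement14 {S V W : Type*} [Fintype S] [AddCommGroup V] [Module ℝ V] [Group W]
    [Finite W] (d : WeylDatum S V W)
    (lam : Module.Dual ℝ V) (hdom : d.Dominant lam)
    (x : W) (hx : d.IsMinCoset x (d.ISet lam)) :
    d.ISetAff (d.mulA ((x : W), 0) (1, -lam)) = d.ISetFin (d.ISet lam) x := by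
  unfold WeylDatum.ISetAff WeylDatum.ISetFin
  congr 1
  ext K
  simp only [Set.mem_setOf_eq, intertwine_iff]
  constructor
  · intro h
    refine ⟨fun i hi => ?_, fun i hi => ?_⟩
    · obtain ⟨j, _, h1, _⟩ := h i hi
      exact h1
    · obtain ⟨j, hj, _, h2⟩ := h i hi
      exact ⟨j, hj, h2⟩
  · rintro ⟨hK, h⟩ i hi
    obtain ⟨j, hj, h2⟩ := h i hi
    exact ⟨j, hj, hK hi, h2⟩
end
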